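/- arXiv:1910.01095 — 3 statements merged into one kernel-verified Lean document; each statement's English description precedes it below -/
import Mathlib

section
/- Let F be a field, let λ=(λ_1,…,λ_m) be an m-partition of n (i.e. n=λ_1+…+λ_m), and let p ∈ F[x_1,…,x_n] be a polynomial with deg_i(p)=d_i for each i, where deg_i denotes the degree in the i-th block of variables. Assume there is a monomial x^α appearing with nonzero coefficient in p such that deg_i(x^α)=d_i for all i ∈ [m]. Let S_i ⊂ F^{λ_i} be finite sets with deg(S_i) > d_i for all i, and let S = S_1 × S_2 × … × S_m ⊂ F^n. Then there exists t ∈ S such that p(t) ≠ 0. -/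
open MvPolynomial in
/-- If no nonzero polynomial of total degree at most `d` vanishes on the finite set `S`, then each
coefficient of a polynomial of total degree at most `d` is a fixed linear combination of its values
on `S`. -/
theorem exists_weights_sum_eval_eq_coeff {F σ : Type*} [Field F] (d : ℕ) (S : Finset (σ → F))
    (hS : ∀ q : MvPolynomial σ F, q ≠ 0 → q.totalDegree ≤ d → ∃ y ∈ S, eval y q ≠ 0)
    (β : σ →₀ ℕ) :
    ∃ w : S → F, ∀ q : MvPolynomial σ F, q.totalDegree ≤ d →
      ∑ y : S, w y * eval y.1 q = coeff β q := by
  classical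
  let E : restrictTotalDegree σ F d →ₗ[F] (S → F) :=
    LinearMap.pi fun y => (aeval (R := F) y.1).toLinearMap ∘ₗ Submodule.subtype _
  have hE (q : restrictTotalDegree σ F d) (y : S) : E q y = eval y.1 q.1 := by
    simp [E, aeval_eq_eval]
  have hker : LinearMap.ker E = ⊥ := by
    rw [LinearMap.ker_eq_bot']
    intro q hq
    by_contra hne
    obtain ⟨y, hy, hyq⟩ := hS q.1 (fun h => hne (Subtype.ext h))
      ((mem_restrictTotalDegree _ _ _).1 q.2)
    exact hyq (by rw [← hE q ⟨y, hy⟩, hq]; rfl)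
  obtain ⟨g, hg⟩ := E.exists_leftInverse_of_injective hker
  let φ : (S → F) →ₗ[F] F := lcoeff F β ∘ₗ Submodule.subtype _ ∘ₗ g
  refine ⟨fun y => φ (Pi.single y 1), fun q hq => ?_⟩
  let q' : restrictTotalDegree σ F d := ⟨q, (mem_restrictTotalDegree _ _ _).2 hq⟩
  have hφ : φ (E q') = coeff β q := by
    have h : g (E q') = q' := LinearMap.congr_fun hg q'
    simp [φ, h, q']
  rw [← hφ, LinearMap.pi_apply_eq_sum_univ φ (E q')]
  refine Finset.sum_congr rfl fun y _ => ?_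
  rw [hE, smul_eq_mul, mul_comm]
  congr 1
  refine congrArg φ (funext fun z => ?_)
  simp [Pi.single_apply, eq_comm]

/-- **Multivariate Combinatorial Nullstellensatz.**
Variables are indexed by the sigma type `(i : Fin m) × Fin (lam i)`, so that the
`i`-th block of variables is `Fin (lam i)`.  The hypothesis `hS` expresses that the
algebraic degree of `S i` is greater than `d i`: no nonzero polynomial of total degree
at most `d i` vanishes on all of `S i`. -/
theorem stmt_0 {F : Type*} [Field F] (m : ℕ) (lam : Fin m → ℕ)
    (p : MvPolynomial ((i : Fin m) × Fin (lam i)) F) (d : Fin m → ℕ)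
    (hdeg : ∀ i : Fin m, ∀ α ∈ p.support, (∑ j : Fin (lam i), α ⟨i, j⟩) ≤ d i)
    (hmax : ∃ α ∈ p.support, p.coeff α ≠ 0 ∧
      ∀ i : Fin m, (∑ j : Fin (lam i), α ⟨i, j⟩) = d i)
    (S : (i : Fin m) → Finset (Fin (lam i) → F))
    (hS : ∀ i : Fin m, ∀ q : MvPolynomial (Fin (lam i)) F, q ≠ 0 → q.totalDegree ≤ d i →
      ∃ y ∈ S i, MvPolynomial.eval y q ≠ 0) :
    ∃ t : (i : Fin m) → Fin (lam i) → F, (∀ i, t i ∈ S i) ∧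
      MvPolynomial.eval (fun q : (i : Fin m) × Fin (lam i) => t q.1 q.2) p ≠ 0 := by
  classical
  obtain ⟨α, hα, hα0, -⟩ := hmax
  let r (γ : ((i : Fin m) × Fin (lam i)) →₀ ℕ) (i : Fin m) : Fin (lam i) →₀ ℕ :=
    Finsupp.equivFunOnFinite.symm fun j => γ ⟨i, j⟩
  choose w hw using fun i => exists_weights_sum_eval_eq_coeff (d i) (S i) (hS i) (r α i)
  have hmon (γ) (hγ : γ ∈ p.support) (i : Fin m) :
      ∑ y : S i, w i y * ∏ j, y.1 j ^ γ ⟨i, j⟩ = if r γ i = r α i then 1 else 0 := by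
    have h := hw i (MvPolynomial.monomial (r γ i) 1) (by
      rw [MvPolynomial.totalDegree_monomial _ one_ne_zero, Finsupp.sum_fintype _ _ (by simp)]
      exact hdeg i γ hγ)
    simpa [MvPolynomial.eval_monomial, Finsupp.prod_fintype, r, MvPolynomial.coeff_monomial]
      using h
  have hsum : ∑ s : (i : Fin m) → S i, (∏ i, w i (s i)) *
      MvPolynomial.eval (fun q : (i : Fin m) × Fin (lam i) => (s q.1).1 q.2) p = p.coeff α := by
    simp_rw [MvPolynomial.eval_eq', Finset.mul_sum]
    rw [Finset.sum_comm]
    have hterm (γ) (hγ : γ ∈ p.support) :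
        ∑ s : (i : Fin m) → S i, (∏ i, w i (s i)) *
          (p.coeff γ * ∏ q : (i : Fin m) × Fin (lam i), (s q.1).1 q.2 ^ γ q) =
        if γ = α then p.coeff γ else 0 := by
      have hprod := Fintype.prod_sum fun i (y : S i) => w i y * ∏ j, y.1 j ^ γ ⟨i, j⟩
      simp_rw [hmon γ hγ, Finset.prod_mul_distrib] at hprod
      simp_rw [Fintype.prod_sigma, mul_left_comm _ (p.coeff γ), ← Finset.mul_sum, ← hprod]
      have hiff : γ = α ↔ ∀ i, r γ i = r α i := by
        refine ⟨fun h i => by rw [h], fun h => Finsupp.ext fun ⟨i, j⟩ => ?_⟩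
        exact DFunLike.congr_fun (h i) j
      rw [Finset.prod_ite_zero]
      simp [hiff]
    rw [Finset.sum_congr rfl hterm, Finset.sum_ite_eq' p.support α, if_pos hα]
  obtain ⟨s, -, hs⟩ := Finset.exists_ne_zero_of_sum_ne_zero (hsum ▸ hα0)
  exact ⟨fun i => (s i).1, fun i => (s i).2, right_ne_zero_of_mul hs⟩
end

section
/- For every ε>0 there is a constant C_ε such that the following holds. Let P be a finite set of points in the complex plane ℂ² and let L be a finite set of complex lines in ℂ². Then the set of point-line incidences satisfies |I(P,L)| ≤ C_ε ( |P|^{2/3+ε} |L|^{2/3+ε} + |P| + |L| ). -/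
section SzemerediTrotter

open Finset

/-- The determinant of the matrix whose rows are `v (x k)`, followed by `w`, as a linear form
in `w`. -/
noncomputable def lastRowDet {κ X : Type*} [Fintype κ] [DecidableEq κ]
    (v : X → Option κ → ℝ) (x : κ → X) : (Option κ → ℝ) →ₗ[ℝ] ℝ :=
  (Matrix.detRowAlternating (n := Option κ) (R := ℝ)).toMultilinearMap.toLinearMap
    (fun o => o.elim 0 (fun k => v (x k))) none

theorem lastRowDet_apply {κ X : Type*} [Fintype κ] [DecidableEq κ]
    (v : X → Option κ → ℝ) (x : κ → X) (w : Option κ → ℝ) :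
    lastRowDet v x w = Matrix.det (Matrix.of fun o : Option κ => o.elim w (fun k => v (x k))) := by
  unfold lastRowDet
  rw [MultilinearMap.toLinearMap_apply]
  change Matrix.det _ = _
  congr 1
  ext o o'
  cases o <;> simp [Function.update]

theorem lastRowDet_update {κ X : Type*} [Fintype κ] [DecidableEq κ]
    (v : X → Option κ → ℝ) (x : κ → X) (k : κ) (a : X) :
    lastRowDet v (Function.update x k a) (v (x k)) = - lastRowDet v x (v a) := by
  rw [lastRowDet_apply, lastRowDet_apply]
  have := Matrix.det_permute (Equiv.swap none (some k))
    (Matrix.of fun o : Option κ => o.elim (v a) (fun k => v (x k)))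
  rw [Equiv.Perm.sign_swap (by simp)] at this
  simp only [Units.val_neg, Units.val_one, Int.cast_neg, Int.cast_one, neg_mul, one_mul] at this
  rw [← this]
  congr 1
  ext o o'
  rcases o with _ | j
  · simp
  · by_cases h : j = k
    · subst h; simp
    · rw [Matrix.submatrix_apply, Equiv.swap_apply_of_ne_of_ne (by simp) (by simpa using h)]
      simp [Function.update, h]

theorem lastRowDet_update_update {κ X : Type*} [Fintype κ] [DecidableEq κ]
    (v : X → Option κ → ℝ) (x : κ → X) (k : κ) (a b : X) :
    lastRowDet v (Function.update x k a) (v b) = - lastRowDet v (Function.update x k b) (v a) := by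
  have := lastRowDet_update v (Function.update x k b) k a
  simpa using this

/-- Averaged over the choice of the zeros `x k ∈ S k`, the form `lastRowDet v x` separates a third
of the pairs of each `S k`. -/
theorem card_pairs_le_sum_lastRowDet {κ X : Type*} [Fintype κ] [DecidableEq κ] [DecidableEq X]
    (v : X → Option κ → ℝ) (S : κ → Finset X) (k : κ) :
    #(Fintype.piFinset S) * #(S k) ^ 2 ≤ 3 * ∑ x ∈ Fintype.piFinset S,
      #{q ∈ S k ×ˢ S k | lastRowDet v x (v q.1) * lastRowDet v x (v q.2) ≤ 0} := by
  classical
  set F : (κ → X) × (X × X) → ℕ := fun t =>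
    if lastRowDet v t.1 (v t.2.1) * lastRowDet v t.1 (v t.2.2) ≤ 0 then 1 else 0 with hF
  set σ : (κ → X) × (X × X) → (κ → X) × (X × X) := fun t =>
    (Function.update t.1 k t.2.1, (t.2.2, t.1 k)) with hσ
  set D := Fintype.piFinset S ×ˢ (S k ×ˢ S k) with hD
  have hσ3 : ∀ t, σ (σ (σ t)) = t := by
    rintro ⟨x, y, z⟩
    simp [hσ]
  have hσD : ∀ t ∈ D, σ t ∈ D := by
    rintro ⟨x, y, z⟩ h
    simp only [hD, mem_product, Fintype.mem_piFinset] at h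
    simp only [hD, hσ, mem_product, Fintype.mem_piFinset]
    refine ⟨fun j => ?_, h.2.2, h.1 k⟩
    by_cases hj : j = k
    · subst hj; simpa using h.2.1
    · simpa [hj] using h.1 j
  have hsum : ∀ G : (κ → X) × (X × X) → ℕ, ∑ t ∈ D, G (σ t) = ∑ t ∈ D, G t := by
    intro G
    refine Finset.sum_nbij' σ (fun t => σ (σ t)) hσD (fun t ht => hσD _ (hσD _ ht))
      (fun t _ => hσ3 t) (fun t _ => hσ3 t) (fun t _ => rfl)
  have hkey : ∀ t, 1 ≤ F t + F (σ t) + F (σ (σ t)) := by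
    rintro ⟨x, y, z⟩
    by_contra hcon
    have hz : F (x, y, z) = 0 ∧ F (σ (x, y, z)) = 0 ∧ F (σ (σ (x, y, z))) = 0 := by omega
    have h1 := lastRowDet_update v x k y
    have h2 := lastRowDet_update v x k z
    have h3 := lastRowDet_update_update v x k y z
    simp only [hF, hσ, Function.update_idem, Function.update_self, ite_eq_right_iff, one_ne_zero,
      imp_false, not_le, h1, h2, h3] at hz
    obtain ⟨a1, a2, a3⟩ := hz
    nlinarith [mul_pos (mul_pos a1 a2) a3, sq_nonneg (lastRowDet v x (v y) *
      lastRowDet v x (v z) * lastRowDet v (Function.update x k z) (v y))]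
  have hcount : ∑ t ∈ D, F t = ∑ x ∈ Fintype.piFinset S,
      #{q ∈ S k ×ˢ S k | lastRowDet v x (v q.1) * lastRowDet v x (v q.2) ≤ 0} := by
    rw [hD, Finset.sum_product]
    refine Finset.sum_congr rfl fun x _ => ?_
    rw [Finset.card_filter]
  calc #(Fintype.piFinset S) * #(S k) ^ 2 = ∑ t ∈ D, 1 := by
        rw [Finset.sum_const, smul_eq_mul, mul_one, hD, card_product, card_product, sq]
    _ ≤ ∑ t ∈ D, (F t + F (σ t) + F (σ (σ t))) := Finset.sum_le_sum fun t _ => hkey t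
    _ = 3 * ∑ t ∈ D, F t := by
        rw [sum_add_distrib, sum_add_distrib, hsum (fun t => F (σ t)), hsum F]; ring
    _ = _ := by rw [hcount]

theorem exists_lastRowDet {κ X : Type*} [Fintype κ] [DecidableEq κ] [DecidableEq X]
    (v : X → Option κ → ℝ) (S : κ → Finset X) (hS : ∀ k, (S k).Nonempty) :
    ∃ x ∈ Fintype.piFinset S, ∑ k, #(S k) ^ 2 ≤ 3 * ∑ k,
      #{q ∈ S k ×ˢ S k | lastRowDet v x (v q.1) * lastRowDet v x (v q.2) ≤ 0} := by
  have hne : (Fintype.piFinset S).Nonempty := Fintype.piFinset_nonempty.2 hS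
  refine Finset.exists_le_of_sum_le hne ?_
  rw [Finset.sum_const, smul_eq_mul, ← Finset.mul_sum, Finset.sum_comm, Finset.mul_sum, Finset.mul_sum]
  exact Finset.sum_le_sum fun k _ => card_pairs_le_sum_lastRowDet v S k

theorem eventually_lastRowDet_ne_zero {κ X : Type*} [Fintype κ] [DecidableEq κ]
    (v : X → Option κ → ℝ) (U : Finset X) :
    ∃ u : X → Option κ → ℝ, ∀ x : κ → X, (∀ k, x k ∈ U) → Function.Injective x →
      ∀ᶠ δ in nhdsWithin (0 : ℝ) (Set.Ioi 0), lastRowDet (fun p => v p + δ • u p) x ≠ 0 := by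
  obtain ⟨t, ht⟩ := Set.countable_iff_exists_injOn.1 U.finite_toSet.countable
  let e := Fintype.equivFin (Option κ)
  refine ⟨fun p o => (t p : ℝ) ^ (e o : ℕ), fun x hxU hx => ?_⟩
  set w : Option κ → ℝ := fun o => (-1 : ℝ) ^ (e o : ℕ)
  set B : Matrix (Option κ) (Option κ) ℝ := Matrix.of fun o o' : Option κ =>
    (o.elim (-1 : ℝ) (fun k => (t (x k) : ℝ))) ^ (e o' : ℕ) with hB
  set A : Matrix (Option κ) (Option κ) ℝ := Matrix.of fun o : Option κ =>
    o.elim 0 (fun k => v (x k)) with hA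
  have hBdet : B.det ≠ 0 := by
    have : B = (Matrix.vandermonde
        (fun i => (e.symm i).elim (-1 : ℝ) (fun k => (t (x k) : ℝ)))).submatrix e e := by
      ext o o'
      simp [hB, Matrix.vandermonde]
    rw [this, Matrix.det_submatrix_equiv_self, Matrix.det_vandermonde_ne_zero_iff]
    have hinj : Function.Injective
        (fun o : Option κ => o.elim (-1 : ℝ) (fun k => (t (x k) : ℝ))) := by
      rintro (_ | a) (_ | b) h
      · rfl
      · simp only [Option.elim] at h
        have : (0 : ℝ) ≤ t (x b) := Nat.cast_nonneg _
        linarith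
      · simp only [Option.elim] at h
        have : (0 : ℝ) ≤ t (x a) := Nat.cast_nonneg _
        linarith
      · simp only [Option.elim, Nat.cast_inj] at h
        rw [hx (ht (hxU a) (hxU b) h)]
    exact hinj.comp e.symm.injective
  set p : Polynomial ℝ :=
    Matrix.det ((Polynomial.X : Polynomial ℝ) • B.map Polynomial.C + A.map Polynomial.C) with hp
  have hp0 : p ≠ 0 := by
    intro h
    have := Polynomial.coeff_det_X_add_C_card B A
    rw [← hp, h, Polynomial.coeff_zero] at this
    exact hBdet this.symm
  have hroots : ∀ᶠ δ in nhdsWithin (0 : ℝ) (Set.Ioi 0), p.eval δ ≠ 0 := by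
    have hfin : {δ | p.eval δ = 0}.Finite := by
      refine p.roots.toFinset.finite_toSet.subset fun δ hδ => ?_
      simpa [hp0] using hδ
    have : ∀ᶠ δ in nhdsWithin (0 : ℝ) {0}ᶜ, p.eval δ ≠ 0 := by
      have h2 := (hfin.subset
        (Set.sdiff_subset : {δ | p.eval δ = 0} \ {0} ⊆ {δ | p.eval δ = 0})).isClosed.isOpen_compl.mem_nhds
        (show (0 : ℝ) ∈ ({δ | p.eval δ = 0} \ {0})ᶜ by simp)
      filter_upwards [mem_nhdsWithin_of_mem_nhds h2, self_mem_nhdsWithin] with δ h3 h4 h5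
      exact h3 ⟨h5, h4⟩
    exact this.filter_mono (nhdsWithin_mono _ (fun a ha => ne_of_gt ha))
  filter_upwards [hroots] with δ hδ h0
  apply hδ
  have h1 := lastRowDet_apply (fun p => v p + δ • fun o => (t p : ℝ) ^ (e o : ℕ)) x (δ • w)
  rw [h0, LinearMap.zero_apply] at h1
  rw [hp, ← Polynomial.coe_evalRingHom, RingHom.map_det, h1]
  congr 1
  ext o o'
  rcases o with _ | k <;> simp [hB, hA, w] <;> ring

/-- A weak discrete ham-sandwich theorem: some nonzero linear form separates a third of the pairs
of points inside the given sets, when there are fewer sets than coordinates. -/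
theorem exists_form_separating_option {κ X : Type*} [Fintype κ] [DecidableEq κ] [DecidableEq X]
    (v : X → Option κ → ℝ) (S : κ → Finset X) (hS : ∀ k, (S k).Nonempty)
    (hd : Pairwise fun j k => Disjoint (S j) (S k)) :
    ∃ c : Option κ → ℝ, c ≠ 0 ∧ ∑ k, #(S k) ^ 2 ≤ 3 * ∑ k,
      #{q ∈ S k ×ˢ S k | (c ⬝ᵥ v q.1) * (c ⬝ᵥ v q.2) ≤ 0} := by
  classical
  obtain ⟨u, hu⟩ := eventually_lastRowDet_ne_zero v (univ.biUnion S)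
  have hev : ∀ᶠ δ in nhdsWithin (0 : ℝ) (Set.Ioi 0), ∃ c ∈ Metric.sphere (0 : Option κ → ℝ) 1,
      ∑ k, #(S k) ^ 2 ≤ 3 * ∑ k, #{q ∈ S k ×ˢ S k |
        (c ⬝ᵥ (v q.1 + δ • u q.1)) * (c ⬝ᵥ (v q.2 + δ • u q.2)) ≤ 0} := by
    have hall : ∀ᶠ δ in nhdsWithin (0 : ℝ) (Set.Ioi 0), ∀ x ∈ Fintype.piFinset S,
        lastRowDet (fun p => v p + δ • u p) x ≠ 0 := by
      rw [Filter.eventually_all_finset]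
      intro x hx
      rw [Fintype.mem_piFinset] at hx
      refine hu x (fun k => mem_biUnion.2 ⟨k, mem_univ _, hx k⟩) fun j k hjk => ?_
      by_contra hne
      exact disjoint_left.1 (hd hne) (hx j) (hjk ▸ hx k)
    filter_upwards [hall] with δ hδ
    obtain ⟨x, hx, hsum⟩ := exists_lastRowDet (fun p => v p + δ • u p) S hS
    set φ := lastRowDet (fun p => v p + δ • u p) x with hφ
    set c : Option κ → ℝ := fun o => φ (fun o' => if o = o' then 1 else 0) with hc
    have hφc : ∀ w, φ w = c ⬝ᵥ w := by
      intro w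
      rw [LinearMap.pi_apply_eq_sum_univ φ w, dotProduct]
      exact Finset.sum_congr rfl fun o _ => by rw [smul_eq_mul, mul_comm]
    have hc0 : c ≠ 0 := by
      intro h
      refine hδ x hx (LinearMap.ext fun w => ?_)
      rw [hφc, h]; simp
    have hn : 0 < ‖c‖ := norm_pos_iff.2 hc0
    refine ⟨‖c‖⁻¹ • c, by simp [norm_smul, hn.ne'], hsum.trans ?_⟩
    gcongr 3 * ∑ k, #?_ with k
    intro q hq
    simp only [mem_filter] at hq ⊢
    refine ⟨hq.1, ?_⟩
    have h2 := hq.2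
    rw [hφc, hφc] at h2
    rw [smul_dotProduct, smul_dotProduct, smul_eq_mul, smul_eq_mul]
    have : 0 ≤ ‖c‖⁻¹ * ‖c‖⁻¹ := by positivity
    nlinarith
  have hseq : ∃ δ : ℕ → ℝ, Filter.Tendsto δ Filter.atTop (nhdsWithin (0 : ℝ) (Set.Ioi 0)) :=
    Filter.exists_seq_tendsto _
  obtain ⟨δ, hδ⟩ := hseq
  obtain ⟨n₀, hn₀⟩ := Filter.eventually_atTop.1 (hδ.eventually hev)
  choose! c hcs hcsum using hn₀
  obtain ⟨c₀, hc₀, ψ, hψ, hlim⟩ := (isCompact_sphere (0 : Option κ → ℝ) 1).tendsto_subseq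
    (x := fun n => c (n + n₀)) (fun n => hcs _ (Nat.le_add_left _ _))
  refine ⟨c₀, by rintro rfl; simp at hc₀, ?_⟩
  have hδ0 : Filter.Tendsto (fun n => δ (ψ n + n₀)) Filter.atTop (nhds 0) :=
    (hδ.mono_right nhdsWithin_le_nhds).comp
      ((Filter.tendsto_add_atTop_nat n₀).comp hψ.tendsto_atTop)
  have hval : ∀ p : X, Filter.Tendsto
      (fun n => c (ψ n + n₀) ⬝ᵥ (v p + δ (ψ n + n₀) • u p)) Filter.atTop (nhds (c₀ ⬝ᵥ v p)) := by
    intro p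
    have h1 : Filter.Tendsto (fun n => v p + δ (ψ n + n₀) • u p) Filter.atTop (nhds (v p)) := by
      simpa using tendsto_const_nhds.add (hδ0.smul_const (u p))
    have hcont : Continuous fun z : (Option κ → ℝ) × (Option κ → ℝ) => z.1 ⬝ᵥ z.2 := by
      unfold dotProduct; fun_prop
    exact (hcont.tendsto (c₀, v p)).comp (hlim.prodMk_nhds h1)
  have hgood : ∀ᶠ n in Filter.atTop, ∀ q ∈ (univ.biUnion S) ×ˢ (univ.biUnion S),
      (c (ψ n + n₀) ⬝ᵥ (v q.1 + δ (ψ n + n₀) • u q.1)) *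
        (c (ψ n + n₀) ⬝ᵥ (v q.2 + δ (ψ n + n₀) • u q.2)) ≤ 0 →
      (c₀ ⬝ᵥ v q.1) * (c₀ ⬝ᵥ v q.2) ≤ 0 := by
    rw [Filter.eventually_all_finset]
    intro q _
    by_cases hq : (c₀ ⬝ᵥ v q.1) * (c₀ ⬝ᵥ v q.2) ≤ 0
    · exact Filter.Eventually.of_forall fun _ _ => hq
    · filter_upwards [((hval q.1).mul (hval q.2)).eventually_const_lt (not_le.1 hq)] with n hn h
      exact absurd h (not_le.2 hn)
  obtain ⟨n, hn⟩ := hgood.exists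
  refine (hcsum (ψ n + n₀) (Nat.le_add_left _ _)).trans ?_
  gcongr 3 * ∑ k, #?_ with k
  intro q hq
  simp only [mem_filter, mem_product] at hq ⊢
  exact ⟨hq.1, hn q (mem_product.2 ⟨mem_biUnion.2 ⟨k, mem_univ _, hq.1.1⟩,
    mem_biUnion.2 ⟨k, mem_univ _, hq.1.2⟩⟩) hq.2⟩

theorem exists_form_separating {ι κ X : Type*} [Fintype ι] [Fintype κ] [DecidableEq X]
    (hcard : Fintype.card κ < Fintype.card ι)
    (v : X → ι → ℝ) (S : κ → Finset X) (hS : ∀ k, (S k).Nonempty)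
    (hd : Pairwise fun j k => Disjoint (S j) (S k)) :
    ∃ c : ι → ℝ, c ≠ 0 ∧ ∑ k, #(S k) ^ 2 ≤ 3 * ∑ k,
      #{q ∈ S k ×ˢ S k | (c ⬝ᵥ v q.1) * (c ⬝ᵥ v q.2) ≤ 0} := by
  classical
  obtain ⟨e⟩ : Nonempty (Option κ ↪ ι) :=
    Function.Embedding.nonempty_of_card_le (by rw [Fintype.card_option]; omega)
  obtain ⟨c, hc, hsum⟩ := exists_form_separating_option (fun p o => v p (e o)) S hS hd
  have hdot : ∀ p, (Function.extend e c 0 : ι → ℝ) ⬝ᵥ v p = c ⬝ᵥ fun o => v p (e o) := by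
    intro p
    unfold dotProduct
    rw [← Finset.sum_subset (Finset.subset_univ (univ.map e)), Finset.sum_map]
    · exact Finset.sum_congr rfl fun o _ => by rw [e.injective.extend_apply]
    · intro i _ hi
      rw [Function.extend_apply', Pi.zero_apply, zero_mul]
      rintro ⟨o, rfl⟩
      exact hi (mem_map_of_mem _ (mem_univ _))
  refine ⟨Function.extend e c 0, fun h => hc ?_, ?_⟩
  · ext o
    rw [← e.injective.extend_apply c 0 o, h]; simp
  · simpa only [hdot] using hsum

/-- The ordered pairs of points of `P` on which every polynomial of `gs` takes values of the same
strict sign. -/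
noncomputable def sameCell {σ X : Type*} (P : Finset X) (z : X → σ → ℝ)
    (gs : List (MvPolynomial σ ℝ)) : Finset (X × X) :=
  open Classical in
  {q ∈ P ×ˢ P | ∀ g ∈ gs, 0 < MvPolynomial.eval (z q.1) g * MvPolynomial.eval (z q.2) g}

theorem mem_sameCell {σ X : Type*} {P : Finset X} {z : X → σ → ℝ}
    {gs : List (MvPolynomial σ ℝ)} {q : X × X} :
    q ∈ sameCell P z gs ↔ (q.1 ∈ P ∧ q.2 ∈ P) ∧
      ∀ g ∈ gs, 0 < MvPolynomial.eval (z q.1) g * MvPolynomial.eval (z q.2) g := by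
  simp [sameCell]

/-- The list of signs of the polynomials `gs` at a point. -/
noncomputable def signList {σ : Type*} (gs : List (MvPolynomial σ ℝ)) (x : σ → ℝ) :
    List SignType :=
  gs.map fun g => SignType.sign (MvPolynomial.eval x g)

theorem signList_eq_iff {σ : Type*} {gs : List (MvPolynomial σ ℝ)} {x y : σ → ℝ}
    (hx : ∀ g ∈ gs, MvPolynomial.eval x g ≠ 0) :
    signList gs x = signList gs y ↔
      ∀ g ∈ gs, 0 < MvPolynomial.eval x g * MvPolynomial.eval y g := by
  unfold signList
  rw [List.map_inj_left]
  refine forall₂_congr fun g hg => ?_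
  rcases lt_or_gt_of_ne (hx g hg) with h | h
  · rw [sign_neg h, eq_comm, sign_eq_neg_one_iff]
    exact ⟨fun h' => mul_pos_of_neg_of_neg h h', fun h' => by nlinarith⟩
  · rw [sign_pos h, eq_comm, sign_eq_one_iff]
    exact ⟨fun h' => mul_pos h h', fun h' => by nlinarith⟩

/-- The points of `P` with a given sign list. -/
noncomputable def signCell {σ X : Type*} (P : Finset X) (z : X → σ → ℝ)
    (gs : List (MvPolynomial σ ℝ)) (k : List SignType) : Finset X :=
  {p ∈ P | signList gs (z p) = k}

/-- The sign lists, with no zero entry, of the points of `P`. -/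
noncomputable def signKeys {σ X : Type*} (P : Finset X) (z : X → σ → ℝ)
    (gs : List (MvPolynomial σ ℝ)) : Finset (List SignType) :=
  {k ∈ P.image (fun p => signList gs (z p)) | 0 ∉ k}

theorem zero_notMem_signList {σ : Type*} {gs : List (MvPolynomial σ ℝ)} {x : σ → ℝ} :
    0 ∉ signList gs x ↔ ∀ g ∈ gs, MvPolynomial.eval x g ≠ 0 := by
  simp [signList]

theorem signCell_nonempty {σ X : Type*} {P : Finset X} {z : X → σ → ℝ}
    {gs : List (MvPolynomial σ ℝ)} {k : List SignType} (hk : k ∈ signKeys P z gs) :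
    (signCell P z gs k).Nonempty := by
  obtain ⟨h1, -⟩ := mem_filter.1 hk
  obtain ⟨p, hp, rfl⟩ := mem_image.1 h1
  exact ⟨p, mem_filter.2 ⟨hp, rfl⟩⟩

theorem disjoint_signCell {σ X : Type*} (P : Finset X) (z : X → σ → ℝ)
    (gs : List (MvPolynomial σ ℝ)) {k l : List SignType} (h : k ≠ l) :
    Disjoint (signCell P z gs k) (signCell P z gs l) := by
  rw [disjoint_left]
  intro p hp hq
  exact h ((mem_filter.1 hp).2.symm.trans (mem_filter.1 hq).2)

theorem filter_sameCell_eq {σ X : Type*} {P : Finset X} {z : X → σ → ℝ}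
    {gs : List (MvPolynomial σ ℝ)} {k : List SignType} (hk : k ∈ signKeys P z gs) :
    {q ∈ sameCell P z gs | signList gs (z q.1) = k} =
      signCell P z gs k ×ˢ signCell P z gs k := by
  have h0 := (mem_filter.1 hk).2
  ext ⟨p, q⟩
  simp only [mem_filter, mem_sameCell, signCell, mem_product]
  constructor
  · rintro ⟨⟨⟨hp, hq⟩, h⟩, rfl⟩
    refine ⟨⟨hp, rfl⟩, hq, ?_⟩
    exact ((signList_eq_iff (zero_notMem_signList.1 h0)).2 h).symm
  · rintro ⟨⟨hp, rfl⟩, hq, h⟩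
    exact ⟨⟨⟨hp, hq⟩, (signList_eq_iff (zero_notMem_signList.1 h0)).1 h.symm⟩, rfl⟩

theorem sum_sameCell {σ X : Type*} (P : Finset X) (z : X → σ → ℝ)
    (gs : List (MvPolynomial σ ℝ)) (F : X × X → ℕ) :
    ∑ q ∈ sameCell P z gs, F q =
      ∑ k ∈ signKeys P z gs, ∑ q ∈ signCell P z gs k ×ˢ signCell P z gs k, F q := by
  rw [← Finset.sum_fiberwise_of_maps_to (t := signKeys P z gs)
    (g := fun q : X × X => signList gs (z q.1))]
  · exact Finset.sum_congr rfl fun k hk => by rw [filter_sameCell_eq hk]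
  · intro q hq
    obtain ⟨h1, h2⟩ := mem_sameCell.1 hq
    refine mem_filter.2 ⟨mem_image_of_mem _ h1.1, zero_notMem_signList.2 fun g hg h => ?_⟩
    simpa [h] using h2 g hg

theorem card_sameCell {σ X : Type*} (P : Finset X) (z : X → σ → ℝ)
    (gs : List (MvPolynomial σ ℝ)) :
    #(sameCell P z gs) = ∑ k ∈ signKeys P z gs, #(signCell P z gs k) ^ 2 := by
  have := sum_sameCell P z gs fun _ => 1
  simpa [sq] using this

theorem card_sameCell_cons {σ X : Type*} (P : Finset X) (z : X → σ → ℝ)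
    (gs : List (MvPolynomial σ ℝ)) (g : MvPolynomial σ ℝ) :
    #(sameCell P z (g :: gs)) = ∑ k ∈ signKeys P z gs,
      #{q ∈ signCell P z gs k ×ˢ signCell P z gs k |
        0 < MvPolynomial.eval (z q.1) g * MvPolynomial.eval (z q.2) g} := by
  classical
  have h := sum_sameCell P z gs fun q =>
    if 0 < MvPolynomial.eval (z q.1) g * MvPolynomial.eval (z q.2) g then 1 else 0
  simp only [← Finset.card_filter] at h
  rw [← h]
  congr 1
  ext q
  simp [mem_sameCell, and_assoc, and_comm, and_left_comm]

theorem sum_card_signCell_le {σ X : Type*} (P : Finset X) (z : X → σ → ℝ)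
    (gs : List (MvPolynomial σ ℝ)) (K : Finset (List SignType)) :
    ∑ k ∈ K, #(signCell P z gs k) ≤ #P := by
  classical
  rw [← Finset.card_biUnion fun k _ l _ h => disjoint_signCell P z gs h]
  exact card_le_card (biUnion_subset.2 fun k _ => filter_subset _ _)

/-- The polynomial with given coefficients and degree at most `d` in each variable. -/
noncomputable def boxPolynomial {σ : Type*} [Fintype σ] [DecidableEq σ] {d : ℕ} (c : (σ → Fin (d + 1)) → ℝ) :
    MvPolynomial σ ℝ :=
  ∑ i, MvPolynomial.monomial (Finsupp.equivFunOnFinite.symm fun s => (i s : ℕ)) (c i)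

theorem boxPolynomial_ne_zero {σ : Type*} [Fintype σ] [DecidableEq σ] {d : ℕ} {c : (σ → Fin (d + 1)) → ℝ}
    (hc : c ≠ 0) : boxPolynomial c ≠ 0 := by
  classical
  obtain ⟨i, hi⟩ := Function.ne_iff.1 hc
  intro h
  have h2 := congrArg (MvPolynomial.coeff
    (Finsupp.equivFunOnFinite.symm fun s => (i s : ℕ))) h
  rw [boxPolynomial, MvPolynomial.coeff_sum, Finset.sum_eq_single i] at h2
  · simp at h2
    exact hi h2
  · intro j _ hj
    rw [MvPolynomial.coeff_monomial, if_neg]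
    intro h3
    apply hj
    ext s
    exact congrFun (Finsupp.equivFunOnFinite.symm.injective h3) s
  · simp

theorem totalDegree_boxPolynomial_le {σ : Type*} [Fintype σ] [DecidableEq σ] {d : ℕ}
    (c : (σ → Fin (d + 1)) → ℝ) : (boxPolynomial c).totalDegree ≤ Fintype.card σ * d := by
  classical
  refine MvPolynomial.totalDegree_finsetSum_le fun i _ => ?_
  refine (MvPolynomial.totalDegree_monomial_le _ _).trans ?_
  rw [Finsupp.sum_fintype _ _ (fun _ => rfl)]
  calc _ ≤ ∑ _s : σ, d := Finset.sum_le_sum fun s _ => Nat.lt_succ_iff.1 (i s).2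
    _ = _ := by simp

theorem eval_boxPolynomial {σ : Type*} [Fintype σ] [DecidableEq σ] {d : ℕ} (c : (σ → Fin (d + 1)) → ℝ)
    (x : σ → ℝ) :
    MvPolynomial.eval x (boxPolynomial c) = c ⬝ᵥ fun i => ∏ s, x s ^ (i s : ℕ) := by
  classical
  rw [boxPolynomial, map_sum, dotProduct]
  refine Finset.sum_congr rfl fun i _ => ?_
  rw [MvPolynomial.eval_monomial, Finsupp.prod_fintype _ _ (by simp)]
  rfl

/-- One more polynomial, of controlled degree, cuts down the number of pairs in a common cell. -/
theorem exists_cons_card_sameCell_le {σ X : Type*} [Fintype σ] [DecidableEq σ] (P : Finset X) (z : X → σ → ℝ)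
    (gs : List (MvPolynomial σ ℝ)) {T : ℝ} (hT : 0 < T) {d : ℕ}
    (hd : 2 * T < ((d + 1 : ℕ) : ℝ) ^ Fintype.card σ)
    (hgs : T * #(sameCell P z gs) ≤ (#P : ℝ) ^ 2) :
    ∃ g : MvPolynomial σ ℝ, g ≠ 0 ∧ g.totalDegree ≤ Fintype.card σ * d ∧
      (6 / 5 * T) * #(sameCell P z (g :: gs)) ≤ (#P : ℝ) ^ 2 := by
  classical
  rcases P.eq_empty_or_nonempty with rfl | hP
  · refine ⟨1, one_ne_zero, by simp, ?_⟩
    simp [sameCell]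
  have hPpos : (0 : ℝ) < #P := by exact_mod_cast hP.card_pos
  set S := signCell P z gs
  set K := {k ∈ signKeys P z gs | (#P : ℝ) ≤ 2 * T * #(S k)} with hK
  set K' := {k ∈ signKeys P z gs | ¬ (#P : ℝ) ≤ 2 * T * #(S k)} with hK'
  have hKcard : (#K : ℝ) ≤ 2 * T := by
    have h1 : (#K : ℝ) * #P ≤ ∑ k ∈ K, 2 * T * #(S k) := by
      rw [← nsmul_eq_mul]
      exact Finset.card_nsmul_le_sum _ _ _ fun k hk => (mem_filter.1 hk).2
    have h2 : (∑ k ∈ K, (#(S k) : ℝ)) ≤ #P := by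
      exact_mod_cast sum_card_signCell_le P z gs K
    rw [← Finset.mul_sum] at h1
    have h3 : (#K : ℝ) * #P ≤ 2 * T * #P := h1.trans (by gcongr)
    exact le_of_mul_le_mul_right h3 hPpos
  have hcard : Fintype.card K < Fintype.card (σ → Fin (d + 1)) := by
    rw [Fintype.card_coe, Fintype.card_fun, Fintype.card_fin]
    exact_mod_cast hKcard.trans_lt hd
  obtain ⟨c, hc, hsum⟩ := exists_form_separating hcard
    (fun p i => ∏ s, z p s ^ (i s : ℕ)) (fun k : K => S k)
    (fun k => signCell_nonempty (mem_filter.1 k.2).1)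
    (fun j k hjk => disjoint_signCell P z gs fun h => hjk (Subtype.ext h))
  refine ⟨boxPolynomial c, boxPolynomial_ne_zero hc, totalDegree_boxPolynomial_le c, ?_⟩
  simp only [← eval_boxPolynomial] at hsum
  set g := boxPolynomial c
  have e1 := Finset.sum_coe_sort K fun k => #(S k) ^ 2
  have e2 := Finset.sum_coe_sort K fun k => #{q ∈ S k ×ˢ S k |
    MvPolynomial.eval (z q.1) g * MvPolynomial.eval (z q.2) g ≤ 0}
  rw [e1, e2] at hsum
  have hsplit : ∀ k, #{q ∈ S k ×ˢ S k | MvPolynomial.eval (z q.1) g *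
      MvPolynomial.eval (z q.2) g ≤ 0} + #{q ∈ S k ×ˢ S k | 0 < MvPolynomial.eval (z q.1) g *
      MvPolynomial.eval (z q.2) g} = #(S k) ^ 2 := by
    intro k
    rw [sq, ← card_product, ← Finset.card_filter_add_card_filter_not
      (s := S k ×ˢ S k) (fun q : X × X => MvPolynomial.eval (z q.1) g *
      MvPolynomial.eval (z q.2) g ≤ 0)]
    simp only [not_le]
  have hbig : 3 * ∑ k ∈ K, #{q ∈ S k ×ˢ S k | 0 < MvPolynomial.eval (z q.1) g *
      MvPolynomial.eval (z q.2) g} ≤ 2 * ∑ k ∈ K, #(S k) ^ 2 := by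
    have := Finset.sum_congr (s₁ := K) rfl fun k _ => hsplit k
    rw [sum_add_distrib] at this
    omega
  have hsmall : ∑ k ∈ K', #{q ∈ S k ×ˢ S k | 0 < MvPolynomial.eval (z q.1) g *
      MvPolynomial.eval (z q.2) g} ≤ ∑ k ∈ K', #(S k) ^ 2 :=
    Finset.sum_le_sum fun k _ => by have := hsplit k; omega
  have hsq : 2 * T * ∑ k ∈ K', (#(S k) : ℝ) ^ 2 ≤ (#P : ℝ) ^ 2 := by
    have h2 : (∑ k ∈ K', (#(S k) : ℝ)) ≤ #P := by
      exact_mod_cast sum_card_signCell_le P z gs K'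
    calc 2 * T * ∑ k ∈ K', (#(S k) : ℝ) ^ 2 = ∑ k ∈ K', (2 * T * #(S k)) * #(S k) := by
          rw [Finset.mul_sum]
          exact Finset.sum_congr rfl fun k _ => by ring
      _ ≤ ∑ k ∈ K', (#P : ℝ) * #(S k) := Finset.sum_le_sum fun k hk => by
          have := (mem_filter.1 hk).2
          gcongr
          linarith
      _ ≤ (#P : ℝ) ^ 2 := by rw [← Finset.mul_sum, sq]; gcongr
  have t1 : #(sameCell P z gs) = ∑ k ∈ K, #(S k) ^ 2 + ∑ k ∈ K', #(S k) ^ 2 := by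
    rw [card_sameCell, ← Finset.sum_filter_add_sum_filter_not _ fun k =>
      (#P : ℝ) ≤ 2 * T * #(S k)]
  have t2 : 3 * #(sameCell P z (g :: gs)) ≤
      2 * ∑ k ∈ K, #(S k) ^ 2 + 3 * ∑ k ∈ K', #(S k) ^ 2 := by
    rw [card_sameCell_cons, ← Finset.sum_filter_add_sum_filter_not _ fun k =>
      (#P : ℝ) ≤ 2 * T * #(S k)]
    linarith
  have t3 : (3 : ℝ) * #(sameCell P z (g :: gs)) ≤
      2 * ∑ k ∈ K, (#(S k) : ℝ) ^ 2 + 3 * ∑ k ∈ K', (#(S k) : ℝ) ^ 2 := by exact_mod_cast t2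
  rw [t1] at hgs
  push_cast at hgs
  nlinarith [mul_le_mul_of_nonneg_left t3 hT.le]

/-- Polynomial partitioning, in a form counting pairs of points in a common cell. -/
theorem exists_partition (σ : Type) [Fintype σ] [DecidableEq σ] [Nonempty σ] :
    ∃ K : ℕ, 0 < K ∧ ∀ (i : ℕ) (X : Type) (P : Finset X) (z : X → σ → ℝ),
      ∃ gs : List (MvPolynomial σ ℝ), (∀ g ∈ gs, g ≠ 0) ∧
        (gs.map MvPolynomial.totalDegree).sum ≤ K * 2 ^ i ∧
        ((2 : ℝ) ^ i) ^ Fintype.card σ * #(sameCell P z gs) ≤ (#P : ℝ) ^ 2 := by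
  set m := Fintype.card σ with hm
  have hm0 : m ≠ 0 := Fintype.card_ne_zero
  obtain ⟨R, hR⟩ := pow_unbounded_of_one_lt ((2 : ℝ) ^ m) (show (1 : ℝ) < 6 / 5 by norm_num)
  obtain ⟨D, hD⟩ := exists_nat_gt (2 * (6 / 5 : ℝ) ^ R)
  have hD1 : (1 : ℝ) < D := lt_of_le_of_lt (by
    have : (1 : ℝ) ≤ (6 / 5) ^ R := one_le_pow₀ (by norm_num)
    linarith) hD
  have hDm : 2 * (6 / 5 : ℝ) ^ R < (D : ℝ) ^ m :=
    hD.trans_le (le_self_pow₀ hD1.le hm0)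
  have hDpos : 0 < D := by
    have : (0 : ℝ) < D := by linarith
    exact_mod_cast this
  refine ⟨R * (m * D) + 1, by omega, fun i X P z => ?_⟩
  induction i with
  | zero =>
    refine ⟨[], by simp, by simp, ?_⟩
    simp only [pow_zero, one_pow, one_mul]
    have : #(sameCell P z []) ≤ #P ^ 2 := by
      classical
      rw [sq, ← card_product]
      exact card_le_card (filter_subset _ _)
    exact_mod_cast this
  | succ i ih =>
    have hrounds : ∀ j ≤ R, ∃ gs : List (MvPolynomial σ ℝ), (∀ g ∈ gs, g ≠ 0) ∧
        (gs.map MvPolynomial.totalDegree).sum ≤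
          (R * (m * D) + 1) * 2 ^ i + j * (m * (D * 2 ^ i)) ∧
        ((2 ^ i : ℝ) ^ m * (6 / 5) ^ j) * #(sameCell P z gs) ≤ (#P : ℝ) ^ 2 := by
      intro j
      induction j with
      | zero => intro _; simpa using ih
      | succ j ihj =>
        intro hj
        obtain ⟨gs, h1, h2, h3⟩ := ihj (by omega)
        have hd : 2 * ((2 ^ i : ℝ) ^ m * (6 / 5) ^ j) <
            ((D * 2 ^ i - 1 + 1 : ℕ) : ℝ) ^ Fintype.card σ := by
          rw [Nat.sub_add_cancel (Nat.mul_pos hDpos (by positivity)), ← hm]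
          push_cast
          rw [mul_pow]
          have : (6 / 5 : ℝ) ^ j ≤ (6 / 5) ^ R :=
            pow_le_pow_right₀ (by norm_num) (by omega)
          calc 2 * ((2 ^ i : ℝ) ^ m * (6 / 5) ^ j) = (2 * (6 / 5) ^ j) * (2 ^ i) ^ m := by ring
            _ < _ := by gcongr; linarith
        obtain ⟨g, hg0, hgd, hg⟩ := exists_cons_card_sameCell_le P z gs (by positivity) hd h3
        refine ⟨g :: gs, by simpa [hg0] using h1, ?_, ?_⟩
        · rw [← hm] at hgd
          have : m * (D * 2 ^ i - 1) ≤ m * (D * 2 ^ i) := Nat.mul_le_mul_left _ (Nat.sub_le _ _)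
          rw [List.map_cons, List.sum_cons, add_mul j]
          omega
        · calc _ = (6 / 5 * ((2 ^ i : ℝ) ^ m * (6 / 5) ^ j)) * #(sameCell P z (g :: gs)) := by
                ring
            _ ≤ _ := hg
    obtain ⟨gs, h1, h2, h3⟩ := hrounds R le_rfl
    refine ⟨gs, h1, h2.trans ?_, le_trans ?_ h3⟩
    · rw [pow_succ]
      have : R * (m * (D * 2 ^ i)) = R * (m * D) * 2 ^ i := by ring
      nlinarith [Nat.zero_le (2 ^ i)]
    · gcongr
      rw [pow_succ, mul_pow]
      gcongr

section Bezout

open MvPolynomial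

theorem finrank_restrictTotalDegree_fin_two (n : ℕ) :
    2 * Module.finrank ℝ (restrictTotalDegree (Fin 2) ℝ n) = (n + 1) * (n + 2) := by
  have h1 : Module.finrank ℝ (restrictTotalDegree (Fin 2) ℝ n) =
      Nat.card {s : Fin 2 →₀ ℕ | (s.sum fun _ e => e) ≤ n} :=
    Module.finrank_eq_nat_card_basis (basisRestrictSupport ℝ _)
  let e : (Fin 2 →₀ ℕ) ≃ ℕ × ℕ := Finsupp.equivFunOnFinite.trans (finTwoArrowEquiv ℕ)
  have h2 : Nat.card {s : Fin 2 →₀ ℕ | (s.sum fun _ e => e) ≤ n} =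
      #((range (n + 1)).sigma fun k => antidiagonal k) := by
    have himg : {s : Fin 2 →₀ ℕ | (s.sum fun _ e => e) ≤ n} =
        (fun t : (_ : ℕ) × (ℕ × ℕ) => e.symm t.2) ''
          ((range (n + 1)).sigma fun k => antidiagonal k : Finset _) := by
      ext s
      obtain ⟨⟨i, j⟩, rfl⟩ := e.symm.surjective s
      have hs : ((e.symm (i, j)).sum fun _ e => e) = i + j := by
        rw [Finsupp.sum_fintype _ _ (fun _ => rfl), Fin.sum_univ_two]
        rfl
      simp [hs]
    rw [Nat.card_coe_set_eq, himg, Set.InjOn.ncard_image, Set.ncard_coe_finset]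
    rintro ⟨k, p⟩ hp ⟨l, q⟩ hq h
    obtain rfl : p = q := e.symm.injective h
    simp only [coe_sigma, Set.mem_sigma_iff, mem_coe, HasAntidiagonal.mem_antidiagonal] at hp hq
    obtain rfl : k = l := hp.2.symm.trans hq.2
    rfl
  rw [h1, h2, card_sigma]
  simp only [Finset.Nat.card_antidiagonal]
  clear h1 h2 e
  induction n with
  | zero => simp
  | succ n ih => rw [Finset.sum_range_succ, mul_add, ih]; ring

theorem exists_eval_interpolation {Z : Finset (Fin 2 → ℝ)} {z : Fin 2 → ℝ} :
    ∃ p : MvPolynomial (Fin 2) ℝ, p.totalDegree ≤ #Z ∧ eval z p ≠ 0 ∧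
      ∀ w ∈ Z, w ≠ z → eval w p = 0 := by
  classical
  have : ∀ w : Fin 2 → ℝ, ∃ p : MvPolynomial (Fin 2) ℝ, p.totalDegree ≤ 1 ∧ eval z p ≠ 0 ∧
      (w ≠ z → eval w p = 0) := by
    intro w
    by_cases h : w = z
    · exact ⟨1, by simp, by simp, fun h' => absurd h h'⟩
    · obtain ⟨i, hi⟩ := Function.ne_iff.1 h
      refine ⟨X i - C (w i), (totalDegree_sub_C_le _ _).trans (by simp), ?_, by simp⟩
      simpa [sub_eq_zero] using Ne.symm hi
  choose p h1 h2 h3 using this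
  refine ⟨∏ w ∈ Z, p w, (totalDegree_finsetProd _ _).trans ?_, ?_, fun w hw hwz => ?_⟩
  · simpa using Finset.sum_le_card_nsmul Z _ 1 fun w _ => h1 w
  · rw [map_prod]
    exact Finset.prod_ne_zero_iff.2 fun w _ => h2 w
  · rw [map_prod]
    exact Finset.prod_eq_zero hw (h3 w hwz)

/-- Evaluation at the points of `Z`, on the polynomials of degree at most `n`. -/
noncomputable def evalRestrict (Z : Finset (Fin 2 → ℝ)) (n : ℕ) :
    restrictTotalDegree (Fin 2) ℝ n →ₗ[ℝ] (Z → ℝ) :=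
  LinearMap.pi fun z => (aeval (z : Fin 2 → ℝ)).toLinearMap ∘ₗ Submodule.subtype _

theorem evalRestrict_apply (Z : Finset (Fin 2 → ℝ)) (n : ℕ)
    (p : restrictTotalDegree (Fin 2) ℝ n) (z : Z) :
    evalRestrict Z n p z = eval (z : Fin 2 → ℝ) (p : MvPolynomial (Fin 2) ℝ) := by
  simp [evalRestrict, aeval_eq_eval]

theorem evalRestrict_surjective {Z : Finset (Fin 2 → ℝ)} {n : ℕ} (hn : #Z ≤ n) :
    Function.Surjective (evalRestrict Z n) := by
  classical
  rw [← LinearMap.range_eq_top, eq_top_iff, ← (Pi.basisFun ℝ Z).span_eq, Submodule.span_le]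
  rintro _ ⟨z, rfl⟩
  obtain ⟨p, hp, hpz, hpw⟩ := exists_eval_interpolation (Z := Z) (z := z)
  refine ⟨⟨(eval (z : Fin 2 → ℝ) p)⁻¹ • p, (mem_restrictTotalDegree _ _ _).2
    ((totalDegree_smul_le _ _).trans (hp.trans hn))⟩, ?_⟩
  ext w
  rw [evalRestrict_apply]
  by_cases h : w = z
  · subst h
    simp [smul_eval, hpz]
  · have : (w : Fin 2 → ℝ) ≠ z := fun h' => h (Subtype.ext h')
    simp [smul_eval, hpw w w.2 this, h]

/-- Multiplication by `q`, from polynomials of degree at most `m` to degree at most `n`. -/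
noncomputable def mulRestrict (q : MvPolynomial (Fin 2) ℝ) {m n : ℕ}
    (h : q.totalDegree + m ≤ n) :
    restrictTotalDegree (Fin 2) ℝ m →ₗ[ℝ] restrictTotalDegree (Fin 2) ℝ n :=
  (LinearMap.mulLeft ℝ q).restrict fun _ hp => (mem_restrictTotalDegree _ _ _).2 <|
    (totalDegree_mul _ _).trans <|
      (Nat.add_le_add_left ((mem_restrictTotalDegree _ _ _).1 hp) _).trans h

/-- A weak form of Bézout's theorem for a prime polynomial. -/
theorem card_le_totalDegree_mul_totalDegree {q v : MvPolynomial (Fin 2) ℝ} (hq : Prime q)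
    (hqv : ¬ q ∣ v) {Z : Finset (Fin 2 → ℝ)} (hZq : ∀ z ∈ Z, eval z q = 0)
    (hZv : ∀ z ∈ Z, eval z v = 0) : #Z ≤ q.totalDegree * v.totalDegree := by
  set a := q.totalDegree with ha
  set b := v.totalDegree with hb
  set N := #Z
  have hv0 : v ≠ 0 := fun h => hqv (h ▸ dvd_zero q)
  let Φ := (mulRestrict q (m := N + b) (n := N + a + b) (by omega)).coprod
    (mulRestrict v (m := N + a) (n := N + a + b) (by omega))
  let Ψ := (-(mulRestrict v (m := N) (n := N + b) (by omega))).prod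
    (mulRestrict q (m := N) (n := N + a) (by omega))
  have hker : LinearMap.ker Φ ≤ LinearMap.range Ψ := by
    rintro ⟨⟨A, hA⟩, ⟨B, hB⟩⟩ h
    have h' : q * A + v * B = 0 := by
      simpa [Φ, mulRestrict, Subtype.ext_iff] using h
    have hdvd : q ∣ v * B := ⟨-A, by linear_combination h'⟩
    obtain ⟨w, rfl⟩ := (hq.dvd_or_dvd hdvd).resolve_left hqv
    have hAw : A = -(v * w) := by
      apply mul_left_cancel₀ hq.ne_zero
      linear_combination h'
    have hw : w ∈ restrictTotalDegree (Fin 2) ℝ N := by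
      rw [mem_restrictTotalDegree] at hB ⊢
      rcases eq_or_ne w 0 with rfl | hw0
      · simp
      · rw [totalDegree_mul_of_isDomain hq.ne_zero hw0] at hB
        omega
    refine ⟨⟨w, hw⟩, ?_⟩
    simp [Ψ, mulRestrict, Subtype.ext_iff, hAw]
  have hrange : LinearMap.range Φ ≤ LinearMap.ker (evalRestrict Z (N + a + b)) := by
    rintro _ ⟨⟨A, B⟩, rfl⟩
    rw [LinearMap.mem_ker]
    ext z
    rw [evalRestrict_apply]
    simp [Φ, mulRestrict, hZq z z.2, hZv z z.2]
  have e1 := LinearMap.finrank_range_add_finrank_ker Φ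
  have e2 := (Submodule.finrank_mono hker).trans (LinearMap.finrank_range_le Ψ)
  have e3 := Submodule.finrank_mono hrange
  have e4 := LinearMap.finrank_range_add_finrank_ker (evalRestrict Z (N + a + b))
  rw [LinearMap.range_eq_top.2 (evalRestrict_surjective (by omega)), finrank_top,
    Module.finrank_pi, Fintype.card_coe] at e4
  rw [Module.finrank_prod] at e1
  have f1 := finrank_restrictTotalDegree_fin_two N
  have f2 := finrank_restrictTotalDegree_fin_two (N + a)
  have f3 := finrank_restrictTotalDegree_fin_two (N + b)
  have f4 := finrank_restrictTotalDegree_fin_two (N + a + b)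
  nlinarith

end Bezout

section CurveCells

open MvPolynomial

theorem hasStrictFDerivAt_eval {σ : Type*} [Fintype σ] (p : MvPolynomial σ ℝ) (x : σ → ℝ) :
    HasStrictFDerivAt (fun y => eval y p)
      (∑ i, eval x (pderiv i p) • (ContinuousLinearMap.proj i : (σ → ℝ) →L[ℝ] ℝ)) x := by
  classical
  induction p using MvPolynomial.induction_on with
  | C a => simpa using hasStrictFDerivAt_const a x
  | add p q hp hq =>
    simp only [map_add, add_smul, sum_add_distrib]
    exact hp.add hq
  | mul_X p i hp =>
    have h2 := hp.mul (ContinuousLinearMap.proj (R := ℝ) (φ := fun _ : σ => ℝ) i).hasStrictFDerivAt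
      (x := x)
    simp only [map_mul, eval_X]
    refine h2.congr_fderiv ?_
    simp only [Derivation.leibniz, pderiv_X, smul_eq_mul, map_add, map_mul, eval_X, add_smul,
      sum_add_distrib, ContinuousLinearMap.proj_apply, Finset.smul_sum]
    congr 1
    · rw [Finset.sum_eq_single i] <;> simp +contextual
    · exact Finset.sum_congr rfl fun j _ => by rw [mul_smul]

theorem continuous_eval_point {σ : Type*} [Fintype σ] (p : MvPolynomial σ ℝ) :
    Continuous fun x : σ → ℝ => eval x p :=
  continuous_iff_continuousAt.2 fun x => (hasStrictFDerivAt_eval p x).continuousAt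

theorem fderiv_eval_single {σ : Type*} [Fintype σ] [DecidableEq σ] (p : MvPolynomial σ ℝ)
    (x : σ → ℝ) (j : σ) :
    (∑ i, eval x (pderiv i p) • (ContinuousLinearMap.proj i : (σ → ℝ) →L[ℝ] ℝ))
      (Pi.single j 1) = eval x (pderiv j p) := by
  simp [Pi.single_apply]

theorem totalDegree_pderiv_le {σ : Type*} (i : σ) (p : MvPolynomial σ ℝ) :
    (pderiv i p).totalDegree ≤ p.totalDegree - 1 := by
  classical
  rw [p.as_sum, map_sum]
  refine totalDegree_finsetSum_le fun s hs => ?_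
  rw [← p.as_sum, pderiv_monomial]
  rcases eq_or_ne (s i) 0 with h | h
  · simp [h]
  refine (totalDegree_monomial_le _ _).trans ?_
  have h1 := le_totalDegree hs
  have h2 : s = (s - Finsupp.single i 1) + Finsupp.single i 1 := by
    rw [tsub_add_cancel_of_le]
    simpa using Nat.one_le_iff_ne_zero.2 h
  rw [h2, Finsupp.sum_add_index' (fun _ => rfl) (fun _ _ _ => rfl)] at h1
  rw [Finsupp.sum_single_index rfl] at h1
  change ((s - Finsupp.single i 1).sum fun _ e => e) ≤ _
  omega

theorem exists_pderiv_ne_zero {σ : Type*} [Fintype σ] {p : MvPolynomial σ ℝ}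
    (hp : p.totalDegree ≠ 0) : ∃ i, pderiv i p ≠ 0 := by
  by_contra! h
  apply hp
  have hd : ∀ x : σ → ℝ, HasStrictFDerivAt (fun y => eval y p) (0 : (σ → ℝ) →L[ℝ] ℝ) x := by
    intro x
    simpa [h] using hasStrictFDerivAt_eval p x
  have hconst : p = C (eval 0 p) := by
    refine MvPolynomial.funext fun x => ?_
    rw [eval_C]
    exact is_const_of_fderiv_eq_zero (𝕜 := ℝ) (fun x => (hd x).hasFDerivAt.differentiableAt)
      (fun x => (hd x).hasFDerivAt.fderiv) x 0
  rw [hconst, totalDegree_C]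

/-- One plus the squared distance to `c`. -/
noncomputable def onePlusDistSq (c : Fin 2 → ℝ) : MvPolynomial (Fin 2) ℝ :=
  1 + ∑ i, (X i - C (c i)) ^ 2

theorem eval_onePlusDistSq (c x : Fin 2 → ℝ) :
    eval x (onePlusDistSq c) = 1 + ((x 0 - c 0) ^ 2 + (x 1 - c 1) ^ 2) := by
  simp [onePlusDistSq]

theorem one_le_eval_onePlusDistSq (c x : Fin 2 → ℝ) : 1 ≤ eval x (onePlusDistSq c) := by
  rw [eval_onePlusDistSq]
  nlinarith [sq_nonneg (x 0 - c 0), sq_nonneg (x 1 - c 1)]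

theorem totalDegree_onePlusDistSq_le (c : Fin 2 → ℝ) : (onePlusDistSq c).totalDegree ≤ 2 := by
  refine (totalDegree_add _ _).trans (max_le (by simp) (totalDegree_finsetSum_le fun i _ => ?_))
  refine (totalDegree_pow _ _).trans ?_
  have := (totalDegree_sub_C_le (X i : MvPolynomial (Fin 2) ℝ) (c i)).trans (totalDegree_X i).le
  omega

theorem norm_sub_le_eval_onePlusDistSq (c x : Fin 2 → ℝ) :
    ‖x - c‖ ≤ eval x (onePlusDistSq c) := by
  have h1 := one_le_eval_onePlusDistSq c x
  rw [pi_norm_le_iff_of_nonneg (by linarith), eval_onePlusDistSq]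
  intro i
  rw [Real.norm_eq_abs, Pi.sub_apply]
  fin_cases i <;> simp only [Fin.zero_eta, Fin.mk_one]
  · nlinarith [sq_abs (x 0 - c 0), sq_nonneg (x 1 - c 1), sq_nonneg (|x 0 - c 0| - 1)]
  · nlinarith [sq_abs (x 1 - c 1), sq_nonneg (x 0 - c 0), sq_nonneg (|x 1 - c 1| - 1)]

theorem pderiv_onePlusDistSq (c : Fin 2 → ℝ) (i : Fin 2) :
    pderiv i (onePlusDistSq c) = 2 * (X i - C (c i)) := by
  fin_cases i <;> simp [onePlusDistSq, pderiv_X, Derivation.leibniz_pow]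

theorem exists_abs_eval_le (p : MvPolynomial (Fin 2) ℝ) (c : Fin 2 → ℝ) :
    ∃ n : ℕ, ∀ x, |eval x p| ≤ n * eval x (onePlusDistSq c) ^ n := by
  have hr := one_le_eval_onePlusDistSq c
  induction p using MvPolynomial.induction_on with
  | C a =>
    obtain ⟨n, hn⟩ := exists_nat_ge |a|
    refine ⟨n, fun x => ?_⟩
    rw [eval_C]
    have : (1 : ℝ) ≤ eval x (onePlusDistSq c) ^ n := one_le_pow₀ (hr x)
    nlinarith [abs_nonneg a]
  | add p q hp hq =>
    obtain ⟨n, hn⟩ := hp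
    obtain ⟨m, hm⟩ := hq
    refine ⟨n + m, fun x => ?_⟩
    rw [map_add]
    have h1 := pow_le_pow_right₀ (hr x) (Nat.le_add_right n m)
    have h2 := pow_le_pow_right₀ (hr x) (Nat.le_add_left m n)
    calc _ ≤ |eval x p| + |eval x q| := abs_add_le _ _
      _ ≤ n * eval x (onePlusDistSq c) ^ n + m * eval x (onePlusDistSq c) ^ m :=
        add_le_add (hn x) (hm x)
      _ ≤ n * eval x (onePlusDistSq c) ^ (n + m) + m * eval x (onePlusDistSq c) ^ (n + m) := by
        gcongr
      _ = _ := by push_cast; ring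
  | mul_X p i hp =>
    obtain ⟨n, hn⟩ := hp
    obtain ⟨m, hm⟩ := exists_nat_ge (|c i| + 1)
    refine ⟨n * m + (n + 1), fun x => ?_⟩
    rw [map_mul, eval_X, abs_mul]
    have hx : |x i| ≤ m * eval x (onePlusDistSq c) := by
      have h1 := (norm_le_pi_norm (x - c) i).trans (norm_sub_le_eval_onePlusDistSq c x)
      rw [Real.norm_eq_abs, Pi.sub_apply] at h1
      have h2 := abs_add_le (x i - c i) (c i)
      rw [sub_add_cancel] at h2
      nlinarith [hr x, abs_nonneg (c i)]
    have h3 := hr x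
    calc |eval x p| * |x i| ≤ (n * eval x (onePlusDistSq c) ^ n) *
          (m * eval x (onePlusDistSq c)) := by gcongr; exact hn x
      _ = (n * m : ℕ) * eval x (onePlusDistSq c) ^ (n + 1) := by push_cast; ring
      _ ≤ (n * m + (n + 1) : ℕ) * eval x (onePlusDistSq c) ^ (n * m + (n + 1)) := by
        exact mul_le_mul (Nat.cast_le.2 (by omega)) (pow_le_pow_right₀ h3 (by omega))
          (by positivity) (by positivity)

/-- A cell of a closed set contains a local maximum of `g² / rᴺ`, with `g` the product of the
polynomials cutting out the cells and `r` one plus a squared distance. -/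
theorem exists_local_max (gs : List (MvPolynomial (Fin 2) ℝ)) (c : Fin 2 → ℝ) :
    ∃ N₀ : ℕ, ∀ N ≥ N₀, ∀ K : Set (Fin 2 → ℝ), IsClosed K → ∀ z ∈ K, (∀ g ∈ gs, eval z g ≠ 0) →
      ∃ w ∈ K, (∀ g ∈ gs, 0 < eval z g * eval w g) ∧
        ∀ᶠ x in nhdsWithin w K, eval x gs.prod ^ 2 * eval w (onePlusDistSq c) ^ N ≤
          eval w gs.prod ^ 2 * eval x (onePlusDistSq c) ^ N := by
  obtain ⟨n, hn⟩ := exists_abs_eval_le gs.prod c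
  refine ⟨2 * n + 1, fun N hN K hK z hz hgz => ?_⟩
  set r : (Fin 2 → ℝ) → ℝ := fun x => eval x (onePlusDistSq c) with hr
  set G : (Fin 2 → ℝ) → ℝ := fun x => eval x gs.prod with hG
  have hr1 : ∀ x, 1 ≤ r x := one_le_eval_onePlusDistSq c
  have hrpos : ∀ x, 0 < r x := fun x => zero_lt_one.trans_le (hr1 x)
  have hrc : Continuous r := continuous_eval_point _
  have hGc : Continuous G := continuous_eval_point _
  set F : (Fin 2 → ℝ) → ℝ := fun x => G x ^ 2 / r x ^ N with hF
  have hFc : Continuous F :=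
    (hGc.pow 2).div (hrc.pow N) fun x => (pow_pos (hrpos x) N).ne'
  have hGne : ∀ x, G x ≠ 0 ↔ ∀ g ∈ gs, eval x g ≠ 0 := by
    intro x
    simp [hG, map_list_prod, List.prod_eq_zero_iff]
  have hFz : 0 < F z := div_pos (sq_pos_iff.2 ((hGne z).2 hgz)) (pow_pos (hrpos z) N)
  set K' : Set (Fin 2 → ℝ) := K ∩ {w | ∀ g ∈ gs, 0 ≤ eval z g * eval w g} with hK'
  have hK'c : IsClosed K' := by
    refine hK.inter ?_
    simp only [Set.ofPred_forall]
    exact isClosed_iInter fun g => isClosed_iInter fun _ =>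
      isClosed_le continuous_const (continuous_const.mul (continuous_eval_point g))
  have hdecay : ∀ x, F x * r x ≤ n ^ 2 := by
    intro x
    have h1 : G x ^ 2 ≤ (n * r x ^ n) ^ 2 := by
      rw [← sq_abs]
      exact pow_le_pow_left₀ (abs_nonneg _) (hn x) 2
    rw [hF]
    simp only
    rw [div_mul_eq_mul_div, div_le_iff₀ (pow_pos (hrpos x) N)]
    calc G x ^ 2 * r x ≤ (n * r x ^ n) ^ 2 * r x := by have := hrpos x; gcongr
      _ = n ^ 2 * r x ^ (2 * n + 1) := by ring
      _ ≤ n ^ 2 * r x ^ N := by gcongr; exact hr1 x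
  have hev : ∀ᶠ x in Filter.cocompact (Fin 2 → ℝ) ⊓ Filter.principal K', F x ≤ F z := by
    refine Filter.Eventually.filter_mono inf_le_left ?_
    filter_upwards [(tendsto_norm_cocompact_atTop (E := Fin 2 → ℝ)).eventually_ge_atTop
      (‖c‖ + n ^ 2 / F z)] with x hx
    have h1 : n ^ 2 / F z ≤ r x := by
      have h2 := norm_sub_le_eval_onePlusDistSq c x
      have h3 := norm_sub_norm_le x c
      simp only [hr]
      linarith
    rw [div_le_iff₀ hFz] at h1
    have h2 := hdecay x
    exact le_of_mul_le_mul_right (by linarith) (hrpos x)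
  obtain ⟨w, hw, hmax⟩ := hFc.continuousOn.exists_isMaxOn' hK'c
    (x₀ := z) ⟨hz, fun g _ => mul_self_nonneg _⟩ hev
  have hFw : 0 < F w := hFz.trans_le (hmax ⟨hz, fun g _ => mul_self_nonneg _⟩)
  have hGw : G w ≠ 0 := by
    intro h
    simp [hF, h] at hFw
  have hpos : ∀ g ∈ gs, 0 < eval z g * eval w g := fun g hg =>
    lt_of_le_of_ne (hw.2 g hg) (mul_ne_zero (hgz g hg) ((hGne w).1 hGw g hg)).symm
  refine ⟨w, hw.1, hpos, ?_⟩
  have hnear : ∀ᶠ x in nhds w, ∀ g ∈ gs, 0 ≤ eval z g * eval x g := by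
    have : ∀ᶠ x in nhds w, ∀ g ∈ {g | g ∈ gs}, 0 ≤ eval z g * eval x g := by
      rw [Filter.eventually_all_finite (List.finite_toSet gs)]
      intro g hg
      have : Continuous fun x => eval z g * eval x g :=
        continuous_const.mul (continuous_eval_point g)
      exact (this.continuousAt.eventually (lt_mem_nhds (hpos g hg))).mono fun x => le_of_lt
    exact this
  filter_upwards [mem_nhdsWithin_of_mem_nhds hnear, self_mem_nhdsWithin] with x hx hxK
  have h1 : F x ≤ F w := hmax ⟨hxK, hx⟩
  rw [hF] at h1
  simp only at h1
  rwa [div_le_div_iff₀ (pow_pos (hrpos x) N) (pow_pos (hrpos w) N)] at h1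

end CurveCells

section CurveCells

open MvPolynomial

/-- The Jacobian determinant of two bivariate polynomials. -/
noncomputable def jac (p q : MvPolynomial (Fin 2) ℝ) : MvPolynomial (Fin 2) ℝ :=
  pderiv 0 p * pderiv 1 q - pderiv 1 p * pderiv 0 q

theorem totalDegree_jac_le (p q : MvPolynomial (Fin 2) ℝ) :
    (jac p q).totalDegree ≤ p.totalDegree + q.totalDegree := by
  have h : ∀ i (p : MvPolynomial (Fin 2) ℝ), (pderiv i p).totalDegree ≤ p.totalDegree :=
    fun i p => (totalDegree_pderiv_le i p).trans (Nat.sub_le _ _)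
  exact (totalDegree_sub _ _).trans (max_le
    ((totalDegree_mul _ _).trans (add_le_add (h _ _) (h _ _)))
    ((totalDegree_mul _ _).trans (add_le_add (h _ _) (h _ _))))

theorem eval_pderiv_sq_mul_pow_sub (g r : MvPolynomial (Fin 2) ℝ) (w : Fin 2 → ℝ) (N : ℕ)
    (i : Fin 2) :
    eval w (pderiv i (g ^ 2 * C (eval w r ^ (N + 1)) - C (eval w g ^ 2) * r ^ (N + 1))) =
      eval w g * eval w r ^ N *
        eval w (2 * r * pderiv i g - (N + 1 : ℕ) * g * pderiv i r) := by
  simp only [map_sub, Derivation.leibniz, Derivation.leibniz_pow, pderiv_C, smul_eq_mul, map_add,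
    map_mul, map_pow, eval_C, map_natCast, nsmul_eq_mul, map_ofNat, map_zero, Nat.add_sub_cancel]
  push_cast
  ring

/-- The polynomial vanishing at the critical points, on `{q = 0}`, of `g² / rᴺ`. -/
noncomputable def critPoly (q g r : MvPolynomial (Fin 2) ℝ) (N : ℕ) : MvPolynomial (Fin 2) ℝ :=
  2 * r * jac g q - (N : MvPolynomial (Fin 2) ℝ) * g * jac r q

theorem totalDegree_critPoly_le (q g r : MvPolynomial (Fin 2) ℝ) (N : ℕ) :
    (critPoly q g r N).totalDegree ≤ q.totalDegree + g.totalDegree + r.totalDegree := by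
  have h1 := totalDegree_jac_le g q
  have h2 := totalDegree_jac_le r q
  have h3 : (2 * r : MvPolynomial (Fin 2) ℝ).totalDegree ≤ r.totalDegree := by
    refine (totalDegree_mul _ _).trans ?_
    rw [← map_ofNat C 2, totalDegree_C, zero_add]
  have h4 : (N * g : MvPolynomial (Fin 2) ℝ).totalDegree ≤ g.totalDegree := by
    refine (totalDegree_mul _ _).trans ?_
    rw [← map_natCast C, totalDegree_C, zero_add]
  refine (totalDegree_sub _ _).trans (max_le ((totalDegree_mul _ _).trans ?_)
    ((totalDegree_mul _ _).trans ?_)) <;> omega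

theorem eval_critPoly_eq_zero {q g r : MvPolynomial (Fin 2) ℝ} {w : Fin 2 → ℝ} {N : ℕ}
    (hq : eval w q = 0) (hg : eval w g ≠ 0) (hr : eval w r ≠ 0)
    (hmax : ∀ᶠ x in nhdsWithin w {x | eval x q = 0},
      eval x g ^ 2 * eval w r ^ (N + 1) ≤ eval w g ^ 2 * eval x r ^ (N + 1)) :
    eval w (critPoly q g r (N + 1)) = 0 := by
  set H := g ^ 2 * C (eval w r ^ (N + 1)) - C (eval w g ^ 2) * r ^ (N + 1) with hH
  have hloc : IsLocalExtrOn (fun x => eval x H) {x | eval x q = eval w q} w := by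
    refine Or.inr ?_
    rw [hq]
    filter_upwards [hmax] with x hx
    simp only [hH, map_sub, map_mul, map_pow, eval_C]
    linarith
  obtain ⟨a, b, hab, hlin⟩ := hloc.exists_multipliers_of_hasStrictFDerivAt_1d
    (hasStrictFDerivAt_eval q w) (hasStrictFDerivAt_eval H w)
  have hi : ∀ i, a * eval w (pderiv i q) + b * eval w (pderiv i H) = 0 := by
    intro i
    have := congrArg (fun f : (Fin 2 → ℝ) →L[ℝ] ℝ => f (Pi.single i 1)) hlin
    simp only [_root_.add_apply, _root_.smul_apply, fderiv_eval_single, smul_eq_mul] at this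
    simpa using this
  have hdet : eval w (pderiv 0 H) * eval w (pderiv 1 q) -
      eval w (pderiv 1 H) * eval w (pderiv 0 q) = 0 := by
    have h0 := hi 0
    have h1 := hi 1
    by_cases hb : b = 0
    · have ha : a ≠ 0 := fun ha => hab (by simp [ha, hb])
      simp only [hb, zero_mul, add_zero, mul_eq_zero, ha, false_or] at h0 h1
      simp [h0, h1]
    · apply mul_left_cancel₀ hb
      linear_combination eval w (pderiv 1 q) * h0 - eval w (pderiv 0 q) * h1
  rw [hH, eval_pderiv_sq_mul_pow_sub, eval_pderiv_sq_mul_pow_sub] at hdet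
  have hne : eval w g * eval w r ^ N ≠ 0 := mul_ne_zero hg (pow_ne_zero _ hr)
  apply mul_left_cancel₀ hne
  rw [mul_zero, ← hdet]
  simp only [critPoly, jac, map_sub, map_mul, map_natCast, map_ofNat]
  ring

theorem exists_not_dvd_jac_onePlusDistSq {q : MvPolynomial (Fin 2) ℝ} (hq : q.totalDegree ≠ 0) :
    ∃ c, ¬ q ∣ jac (onePlusDistSq c) q := by
  by_contra! h
  have e : ∀ c, jac (onePlusDistSq c) q =
      2 * (X 0 - C (c 0)) * pderiv 1 q - 2 * (X 1 - C (c 1)) * pderiv 0 q := by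
    intro c
    rw [jac, pderiv_onePlusDistSq, pderiv_onePlusDistSq]
  have h00 := h ![0, 0]
  have h10 := h ![1, 0]
  have h01 := h ![0, 1]
  rw [e] at h00 h10 h01
  simp only [Matrix.cons_val_zero, Matrix.cons_val_one, map_zero, map_one] at h00 h10 h01
  have hC : (C (1 / 2) : MvPolynomial (Fin 2) ℝ) * 2 = 1 := by
    rw [← map_ofNat C 2, ← C_mul]; norm_num
  have hd : ∀ i, q ∣ pderiv i q := by
    intro i
    fin_cases i
    · have := (dvd_sub h01 h00).mul_left (C (1 / 2))
      convert this using 1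
      simp only [Fin.zero_eta]
      linear_combination (-pderiv 0 q) * hC
    · have := (dvd_sub h00 h10).mul_left (C (1 / 2))
      convert this using 1
      simp only [Fin.mk_one]
      linear_combination (-pderiv 1 q) * hC
  obtain ⟨i, hi⟩ := exists_pderiv_ne_zero hq
  have h1 := totalDegree_le_of_dvd_of_isDomain (hd i) hi
  have h2 := totalDegree_pderiv_le i q
  omega

/-- On an irreducible plane curve, the number of sign patterns of polynomials. -/
theorem card_signs_on_curve_of_prime {q : MvPolynomial (Fin 2) ℝ} (hq : Prime q)
    (gs : List (MvPolynomial (Fin 2) ℝ)) {Z : Finset (Fin 2 → ℝ)}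
    (hZ : ∀ z ∈ Z, eval z q = 0) (hgs : ∀ z ∈ Z, ∀ g ∈ gs, eval z g ≠ 0)
    (hinj : ∀ z ∈ Z, ∀ y ∈ Z, (∀ g ∈ gs, 0 < eval z g * eval y g) → z = y) :
    #Z ≤ q.totalDegree * (q.totalDegree + gs.prod.totalDegree + 2) := by
  classical
  rcases Z.eq_empty_or_nonempty with rfl | ⟨z₀, hz₀⟩
  · simp
  have hq0 : q.totalDegree ≠ 0 := by
    intro h
    rw [totalDegree_eq_zero_iff_eq_C] at h
    have := hZ z₀ hz₀
    rw [h, eval_C] at this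
    rw [this, C_0] at h
    exact hq.ne_zero h
  have hprod : ∀ w, (∀ g ∈ gs, eval w g ≠ 0) → eval w gs.prod ≠ 0 := by
    intro w hw
    rw [map_list_prod]
    simpa [List.prod_eq_zero_iff] using hw
  have hqg : ¬ q ∣ gs.prod := by
    intro h
    refine hprod z₀ (hgs z₀ hz₀) ?_
    obtain ⟨u, hu⟩ := h
    rw [hu, map_mul, hZ z₀ hz₀, zero_mul]
  obtain ⟨c, hc⟩ := exists_not_dvd_jac_onePlusDistSq hq0
  obtain ⟨N₀, hN₀⟩ := exists_local_max gs c
  set r := onePlusDistSq c with hr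
  have hex : ∃ N, N₀ ≤ N + 1 ∧ ¬ q ∣ critPoly q gs.prod r (N + 1) := by
    by_contra! h
    have h1 := dvd_sub (h N₀ (by omega)) (h (N₀ + 1) (by omega))
    have h2 : critPoly q gs.prod r (N₀ + 1) - critPoly q gs.prod r (N₀ + 1 + 1) =
        gs.prod * jac r q := by
      simp only [critPoly]
      push_cast
      ring
    rw [h2] at h1
    exact (hq.dvd_or_dvd h1).elim hqg hc
  obtain ⟨N, hN, hqN⟩ := hex
  have hK : IsClosed {x | eval x q = 0} :=
    isClosed_eq (continuous_eval_point q) continuous_const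
  have hchoice : ∀ z ∈ Z, ∃ w, eval w q = 0 ∧ (∀ g ∈ gs, 0 < eval z g * eval w g) ∧
      eval w (critPoly q gs.prod r (N + 1)) = 0 := by
    intro z hz
    obtain ⟨w, hw, hsign, hmax⟩ := hN₀ (N + 1) hN _ hK z (hZ z hz) (hgs z hz)
    refine ⟨w, hw, hsign, eval_critPoly_eq_zero hw (hprod w fun g hg => ?_) ?_ hmax⟩
    · exact right_ne_zero_of_mul (hsign g hg).ne'
    · have := one_le_eval_onePlusDistSq c w
      exact (zero_lt_one.trans_le this).ne'
  choose! w hwq hws hwc using hchoice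
  have hwinj : Set.InjOn w Z := by
    intro z hz y hy h
    refine hinj z hz y hy fun g hg => ?_
    have h1 := hws z hz g hg
    have h2 := hws y hy g hg
    rw [h] at h1
    nlinarith [mul_pos h1 h2, sq_nonneg (eval (w y) g)]
  rw [← card_image_of_injOn hwinj]
  refine (card_le_totalDegree_mul_totalDegree hq hqN (by simpa using hwq)
    (by simpa using hwc)).trans (Nat.mul_le_mul_left _ ?_)
  have h1 := totalDegree_critPoly_le q gs.prod r (N + 1)
  have h2 := totalDegree_onePlusDistSq_le c
  rw [← hr] at h2
  omega

/-- On a plane curve, the number of sign patterns of polynomials. -/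
theorem card_signs_on_curve {h : MvPolynomial (Fin 2) ℝ} (hh : h ≠ 0)
    (gs : List (MvPolynomial (Fin 2) ℝ)) {Z : Finset (Fin 2 → ℝ)}
    (hZ : ∀ z ∈ Z, eval z h = 0) (hgs : ∀ z ∈ Z, ∀ g ∈ gs, eval z g ≠ 0)
    (hinj : ∀ z ∈ Z, ∀ y ∈ Z, (∀ g ∈ gs, 0 < eval z g * eval y g) → z = y) :
    #Z ≤ h.totalDegree * (h.totalDegree + gs.prod.totalDegree + 2) := by
  classical
  induction h using UniqueFactorizationMonoid.induction_on_prime generalizing Z with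
  | h₁ => exact absurd rfl hh
  | h₂ x hx =>
    have : Z = ∅ := by
      refine Finset.eq_empty_of_forall_notMem fun z hz => ?_
      have := hx.map (eval z)
      rw [hZ z hz] at this
      exact not_isUnit_zero this
    simp [this]
  | h₃ a q ha hq ih =>
    have hsub : Z ⊆ {z ∈ Z | eval z q = 0} ∪ {z ∈ Z | eval z a = 0} := by
      intro z hz
      have := hZ z hz
      rw [map_mul, mul_eq_zero] at this
      simpa [hz] using this
    have h1 := card_signs_on_curve_of_prime hq gs (Z := {z ∈ Z | eval z q = 0})
      (by simp) (fun z hz => hgs z (mem_filter.1 hz).1)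
      (fun z hz y hy => hinj z (mem_filter.1 hz).1 y (mem_filter.1 hy).1)
    have h2 := ih ha (Z := {z ∈ Z | eval z a = 0})
      (by simp) (fun z hz => hgs z (mem_filter.1 hz).1)
      (fun z hz y hy => hinj z (mem_filter.1 hz).1 y (mem_filter.1 hy).1)
    have h3 := (card_le_card hsub).trans (card_union_le _ _)
    rw [totalDegree_mul_of_isDomain hq.ne_zero ha]
    nlinarith [Nat.zero_le (q.totalDegree * a.totalDegree)]

/-- The number of strict sign patterns of polynomials on the plane. -/
theorem card_signs_on_plane (gs : List (MvPolynomial (Fin 2) ℝ)) {Z : Finset (Fin 2 → ℝ)}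
    (hgs : ∀ z ∈ Z, ∀ g ∈ gs, eval z g ≠ 0)
    (hinj : ∀ z ∈ Z, ∀ y ∈ Z, (∀ g ∈ gs, 0 < eval z g * eval y g) → z = y) :
    #Z ≤ 2 * (gs.prod.totalDegree + 3) ^ 2 := by
  classical
  rcases Z.eq_empty_or_nonempty with rfl | ⟨z₀, hz₀⟩
  · simp
  have hprod : ∀ w, (∀ g ∈ gs, eval w g ≠ 0) → eval w gs.prod ≠ 0 := by
    intro w hw
    rw [map_list_prod]
    simpa [List.prod_eq_zero_iff] using hw
  obtain ⟨N₀, hN₀⟩ := exists_local_max gs 0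
  set r := onePlusDistSq 0 with hr
  set D : ℕ → MvPolynomial (Fin 2) ℝ := fun N =>
    2 * r * pderiv 0 gs.prod - (N : ℕ) * gs.prod * pderiv 0 r with hD
  have hex : ∃ N, N₀ ≤ N + 1 ∧ D (N + 1) ≠ 0 := by
    by_contra! h
    have h1 := congrArg₂ (· - ·) (h N₀ (by omega)) (h (N₀ + 1) (by omega))
    have h2 : D (N₀ + 1) - D (N₀ + 1 + 1) = gs.prod * (2 * X 0) := by
      simp only [hD, hr, pderiv_onePlusDistSq, Pi.zero_apply, C_0, sub_zero]
      push_cast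
      ring
    simp only [h2, sub_zero] at h1
    refine mul_ne_zero (fun h => hprod z₀ (hgs z₀ hz₀) (by rw [h, map_zero]))
      (mul_ne_zero two_ne_zero (X_ne_zero 0)) h1
  obtain ⟨N, hN, hDN⟩ := hex
  have hchoice : ∀ z ∈ Z, ∃ w, (∀ g ∈ gs, 0 < eval z g * eval w g) ∧ eval w (D (N + 1)) = 0 := by
    intro z hz
    obtain ⟨w, -, hsign, hmax⟩ := hN₀ (N + 1) hN _ isClosed_univ z (Set.mem_univ z) (hgs z hz)
    rw [nhdsWithin_univ] at hmax
    refine ⟨w, hsign, ?_⟩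
    set H := gs.prod ^ 2 * C (eval w r ^ (N + 1)) - C (eval w gs.prod ^ 2) * r ^ (N + 1) with hH
    have hloc : IsLocalMax (fun x => eval x H) w := by
      filter_upwards [hmax] with x hx
      simp only [hH, map_sub, map_mul, map_pow, eval_C]
      linarith
    have h0 := hloc.hasFDerivAt_eq_zero (hasStrictFDerivAt_eval H w).hasFDerivAt
    have h1 := fderiv_eval_single H w 0
    rw [h0, _root_.zero_apply, hH, eval_pderiv_sq_mul_pow_sub, eq_comm, mul_eq_zero] at h1
    refine h1.resolve_left (mul_ne_zero (hprod w fun g hg => ?_) (pow_ne_zero _ ?_))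
    · exact right_ne_zero_of_mul (hsign g hg).ne'
    · have := one_le_eval_onePlusDistSq 0 w
      exact (zero_lt_one.trans_le this).ne'
  choose! w hws hwD using hchoice
  have hwinj : Set.InjOn w Z := by
    intro z hz y hy h
    refine hinj z hz y hy fun g hg => ?_
    have h1 := hws z hz g hg
    have h2 := hws y hy g hg
    rw [h] at h1
    nlinarith [mul_pos h1 h2, sq_nonneg (eval (w y) g)]
  rw [← card_image_of_injOn hwinj]
  have hdeg : (D (N + 1)).totalDegree ≤ gs.prod.totalDegree + 2 := by
    have hr2 := totalDegree_onePlusDistSq_le 0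
    rw [← hr] at hr2
    have h3 : (2 * r : MvPolynomial (Fin 2) ℝ).totalDegree ≤ r.totalDegree := by
      refine (totalDegree_mul _ _).trans ?_
      rw [← map_ofNat C 2, totalDegree_C, zero_add]
    have h4 : ((N + 1 : ℕ) * gs.prod : MvPolynomial (Fin 2) ℝ).totalDegree ≤
        gs.prod.totalDegree := by
      refine (totalDegree_mul _ _).trans ?_
      rw [← map_natCast C, totalDegree_C, zero_add]
    have h5 := totalDegree_pderiv_le 0 gs.prod
    have h6 := totalDegree_pderiv_le 0 r
    refine (totalDegree_sub _ _).trans (max_le ((totalDegree_mul _ _).trans ?_)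
      ((totalDegree_mul _ _).trans ?_)) <;> omega
  refine (card_signs_on_curve hDN gs (Z := Z.image w) ?_ ?_ ?_).trans ?_
  · simpa using hwD
  · simp only [forall_mem_image]
    exact fun z hz g hg => right_ne_zero_of_mul (hws z hz g hg).ne'
  · simp only [forall_mem_image]
    intro z hz y hy h
    rw [hinj z hz y hy fun g hg => ?_]
    have h1 := hws z hz g hg
    have h2 := hws y hy g hg
    have h3 := h g hg
    nlinarith [mul_pos (mul_pos h1 h2) h3, sq_nonneg (eval (w y) g * eval (w z) g)]
  · calc _ ≤ (gs.prod.totalDegree + 2) *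
          (gs.prod.totalDegree + 2 + gs.prod.totalDegree + 2) := by gcongr
      _ ≤ _ := by nlinarith

end CurveCells

/-- The number of incidences between points and lines. -/
noncomputable def incCount {X Y : Type*} (inc : X → Y → Prop) (P : Finset X) (L : Finset Y) : ℕ :=
  open Classical in #{q ∈ P ×ˢ L | inc q.1 q.2}

/-- Two distinct points are on at most one common line. -/
def LinearIncidence {X Y : Type*} (inc : X → Y → Prop) (P : Finset X) (L : Finset Y) : Prop :=
  ∀ p ∈ P, ∀ q ∈ P, ∀ l ∈ L, ∀ m ∈ L, inc p l → inc q l → inc p m → inc q m → p = q ∨ l = m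

theorem LinearIncidence.mono {X Y : Type*} {inc : X → Y → Prop} {P P' : Finset X}
    {L L' : Finset Y} (h : LinearIncidence inc P L) (hP : P' ⊆ P) (hL : L' ⊆ L) :
    LinearIncidence inc P' L' :=
  fun p hp q hq l hl m hm => h p (hP hp) q (hP hq) l (hL hl) m (hL hm)

theorem incCount_comm {X Y : Type*} (inc : X → Y → Prop) (P : Finset X) (L : Finset Y) :
    incCount (fun l p => inc p l) L P = incCount inc P L := by
  classical
  refine Finset.card_bij' (fun q _ => q.swap) (fun q _ => q.swap) ?_ ?_ ?_ ?_ <;>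
    simp +contextual

theorem incCount_mono {X Y : Type*} (inc : X → Y → Prop) {P P' : Finset X} {L L' : Finset Y}
    (hP : P ⊆ P') (hL : L ⊆ L') : incCount inc P L ≤ incCount inc P' L' := by
  classical
  exact card_le_card (filter_subset_filter _ (product_subset_product hP hL))

theorem incCount_le_mul {X Y : Type*} (inc : X → Y → Prop) (P : Finset X) (L : Finset Y) :
    incCount inc P L ≤ #P * #L := by
  classical
  exact (card_le_card (filter_subset _ _)).trans (card_product _ _).le

theorem incCount_eq_sum_right {X Y : Type*} (inc : X → Y → Prop) (P : Finset X) (L : Finset Y) :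
    incCount inc P L = open Classical in ∑ l ∈ L, #{p ∈ P | inc p l} := by
  classical
  rw [incCount, card_filter, sum_product_right]
  simp only [card_filter]

theorem incCount_eq_sum_left {X Y : Type*} (inc : X → Y → Prop) (P : Finset X) (L : Finset Y) :
    incCount inc P L = open Classical in ∑ p ∈ P, #{l ∈ L | inc p l} := by
  rw [← incCount_comm, incCount_eq_sum_right]

theorem incCount_union_left_le {X Y : Type*} [DecidableEq X] (inc : X → Y → Prop)
    (P P' : Finset X) (L : Finset Y) :
    incCount inc (P ∪ P') L ≤ incCount inc P L + incCount inc P' L := by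
  classical
  simp only [incCount, union_product, filter_union]
  exact card_union_le _ _

theorem incCount_union_right_le {X Y : Type*} [DecidableEq Y] (inc : X → Y → Prop)
    (P : Finset X) (L L' : Finset Y) :
    incCount inc P (L ∪ L') ≤ incCount inc P L + incCount inc P L' := by
  classical
  simp only [incCount, product_union, filter_union]
  exact card_union_le _ _

theorem incCount_biUnion_le {X Y κ : Type*} [DecidableEq X] (inc : X → Y → Prop)
    (K : Finset κ) (S : κ → Finset X) (L : Finset Y) :
    incCount inc (K.biUnion S) L ≤ ∑ k ∈ K, incCount inc (S k) L := by
  classical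
  induction K using Finset.induction_on with
  | empty => simp [incCount]
  | insert k K hk ih =>
    rw [biUnion_insert, sum_insert hk]
    exact (incCount_union_left_le inc _ _ _).trans (Nat.add_le_add_left ih _)

theorem sq_incCount_le {X Y : Type*} {inc : X → Y → Prop} {P : Finset X} {L : Finset Y}
    (h : LinearIncidence inc P L) :
    incCount inc P L ^ 2 ≤ #L * incCount inc P L + #L * #P ^ 2 := by
  classical
  have h1 : incCount inc P L ^ 2 ≤ #L * ∑ l ∈ L, #{p ∈ P | inc p l} ^ 2 := by
    rw [incCount_eq_sum_right]
    exact sq_sum_le_card_mul_sum_sq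
  have h2 : ∑ l ∈ L, #{p ∈ P | inc p l} ^ 2 ≤ incCount inc P L + #P ^ 2 := by
    have h3 : ∀ l, #{p ∈ P | inc p l} ^ 2 =
        ∑ q ∈ P ×ˢ P, if inc q.1 l ∧ inc q.2 l then 1 else 0 := by
      intro l
      rw [sq, ← card_product, ← filter_product, card_filter]
    simp only [h3]
    rw [sum_comm]
    calc _ ≤ ∑ q ∈ P ×ˢ P, ((if q.1 = q.2 then #{l ∈ L | inc q.1 l} else 0) + 1) := by
          refine sum_le_sum fun q hq => ?_
          rw [← card_filter]
          split_ifs with heq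
          · simp [heq]
          · rw [zero_add, card_le_one]
            simp only [mem_filter]
            rintro l ⟨hl, hl1, hl2⟩ m ⟨hm, hm1, hm2⟩
            rw [mem_product] at hq
            exact (h _ hq.1 _ hq.2 l hl m hm hl1 hl2 hm1 hm2).resolve_left heq
      _ = _ := by
          rw [sum_add_distrib, sum_product, incCount_eq_sum_left]
          simp [sq]
  calc _ ≤ _ := h1
    _ ≤ #L * (incCount inc P L + #P ^ 2) := Nat.mul_le_mul_left _ h2
    _ = _ := by ring

theorem incCount_le_of_sq_le_right {X Y : Type*} {inc : X → Y → Prop} {P : Finset X}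
    {L : Finset Y} (h : LinearIncidence inc P L) (hPL : #P ^ 2 ≤ #L) :
    incCount inc P L ≤ 2 * #L := by
  have := sq_incCount_le h
  by_contra! hc
  nlinarith

theorem incCount_le_of_sq_le_left {X Y : Type*} {inc : X → Y → Prop} {P : Finset X}
    {L : Finset Y} (h : LinearIncidence inc P L) (hPL : #L ^ 2 ≤ #P) :
    incCount inc P L ≤ 2 * #P := by
  rw [← incCount_comm]
  refine incCount_le_of_sq_le_right (fun l hl m hm p hp q hq h1 h2 h3 h4 => ?_) hPL
  exact (h p hp q hq l hl m hm h1 h3 h2 h4).symm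

/-- The Szemerédi–Trotter quantity with exponent loss `ε`. -/
noncomputable def stBound (ε x y : ℝ) : ℝ :=
  x ^ ((2 : ℝ) / 3 + ε) * y ^ ((2 : ℝ) / 3 + ε) + x + y

theorem stBound_mono {ε x y x' y' : ℝ} (hε : 0 < ε) (hx : 0 ≤ x) (hy : 0 ≤ y) (hxx : x ≤ x')
    (hyy : y ≤ y') : stBound ε x y ≤ stBound ε x' y' := by
  unfold stBound
  have := hx.trans hxx
  have := hy.trans hyy
  gcongr

theorem stBound_nonneg {ε x y : ℝ} (hx : 0 ≤ x) (hy : 0 ≤ y) : 0 ≤ stBound ε x y := by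
  unfold stBound
  positivity

theorem sum_rpow_two_thirds_le {κ : Type*} (K : Finset κ) {x y : κ → ℝ} (hx : ∀ k ∈ K, 0 ≤ x k)
    (hy : ∀ k ∈ K, 0 ≤ y k) :
    ∑ k ∈ K, x k ^ ((2 : ℝ) / 3) * y k ^ ((2 : ℝ) / 3) ≤
      (∑ k ∈ K, x k ^ 2) ^ ((1 : ℝ) / 3) * (∑ k ∈ K, y k) ^ ((2 : ℝ) / 3) := by
  have hpq : (3 : ℝ).HolderConjugate (3 / 2) := by
    rw [Real.holderConjugate_iff]; norm_num
  have h := Real.inner_le_Lp_mul_Lq_of_nonneg K hpq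
    (f := fun k => x k ^ ((2 : ℝ) / 3)) (g := fun k => y k ^ ((2 : ℝ) / 3))
    (fun k hk => Real.rpow_nonneg (hx k hk) _) (fun k hk => Real.rpow_nonneg (hy k hk) _)
  refine h.trans_eq ?_
  congr 2
  · refine sum_congr rfl fun k hk => ?_
    rw [← Real.rpow_mul (hx k hk), ← Real.rpow_natCast]
    norm_num
  · refine sum_congr rfl fun k hk => ?_
    rw [← Real.rpow_mul (hy k hk)]
    norm_num
  · norm_num

/-- A partition of the points of `P` off `P₀` into cells, each line meeting at most `s` cells. -/
structure CellDecomposition {X Y : Type*} (κ : Type*) (inc : X → Y → Prop) (P : Finset X)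
    (L : Finset Y) (t : ℝ) (s : ℕ) where
  boundary : Finset X
  keys : Finset κ
  cell : κ → Finset X
  boundary_subset : boundary ⊆ P
  cell_subset : ∀ k ∈ keys, cell k ⊆ P
  cover : ∀ p ∈ P, p ∈ boundary ∨ ∃ k ∈ keys, p ∈ cell k
  sum_card_le : ∑ k ∈ keys, #(cell k) ≤ #P
  sum_sq_le : t * ∑ k ∈ keys, (#(cell k) : ℝ) ^ 2 ≤ (#P : ℝ) ^ 2
  line_cells_le : ∀ l ∈ L, ∀ K' ⊆ keys, (∀ k ∈ K', ∃ p ∈ cell k, inc p l) → #K' ≤ s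

theorem sum_cells_rpow_le {κ : Type*} (K : Finset κ) {x y : κ → ℝ} {X Y ε t s A : ℝ}
    (hx : ∀ k ∈ K, 0 ≤ x k) (hy : ∀ k ∈ K, 0 ≤ y k) (hX : 0 ≤ X) (hY : 0 ≤ Y) (hε : 0 < ε)
    (ht : 0 < t) (hA : 0 < A) (hsA : s ^ 2 ≤ A * t)
    (hsq : t * ∑ k ∈ K, x k ^ 2 ≤ X ^ 2) (hyY : ∀ k ∈ K, y k ≤ Y)
    (hysum : ∑ k ∈ K, y k ≤ s * Y) (htA : 4 * A ^ ((1 : ℝ) / 3) ≤ t ^ (ε / 2)) :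
    4 * ∑ k ∈ K, x k ^ ((2 : ℝ) / 3 + ε) * y k ^ ((2 : ℝ) / 3 + ε) ≤
      X ^ ((2 : ℝ) / 3 + ε) * Y ^ ((2 : ℝ) / 3 + ε) := by
  have hsplit : ∀ z : ℝ, 0 ≤ z → z ^ ((2 : ℝ) / 3 + ε) = z ^ ((2 : ℝ) / 3) * z ^ ε :=
    fun z hz => Real.rpow_add_of_nonneg hz (by norm_num) hε.le
  have hthird : ∀ z : ℝ, 0 ≤ z → z ^ ((2 : ℝ) / 3) = (z ^ 2) ^ ((1 : ℝ) / 3) := by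
    intro z hz
    rw [← Real.rpow_natCast, ← Real.rpow_mul hz]
    norm_num
  have hA3 : 0 < A ^ ((1 : ℝ) / 3) := Real.rpow_pos_of_pos hA _
  have hcell : ∀ k ∈ K, t ^ (ε / 2) * x k ^ ε ≤ X ^ ε := by
    intro k hk
    have h1 : t * x k ^ 2 ≤ X ^ 2 := le_trans (by
      gcongr
      exact single_le_sum (f := fun k => x k ^ 2) (fun _ _ => sq_nonneg _) hk) hsq
    have h2 : √t * x k ≤ X := by
      refine abs_le_of_sq_le_sq' ?_ hX |>.2
      rwa [mul_pow, Real.sq_sqrt ht.le]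
    have h3 : t ^ (ε / 2) = √t ^ ε := by
      rw [Real.sqrt_eq_rpow, ← Real.rpow_mul ht.le]
      ring_nf
    rw [h3, ← Real.mul_rpow (Real.sqrt_nonneg _) (hx k hk)]
    exact Real.rpow_le_rpow (mul_nonneg (Real.sqrt_nonneg _) (hx k hk)) h2 hε.le
  have hterm : ∀ k ∈ K, t ^ (ε / 2) * (x k ^ ((2 : ℝ) / 3 + ε) * y k ^ ((2 : ℝ) / 3 + ε)) ≤
      X ^ ε * Y ^ ε * (x k ^ ((2 : ℝ) / 3) * y k ^ ((2 : ℝ) / 3)) := by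
    intro k hk
    rw [hsplit _ (hx k hk), hsplit _ (hy k hk)]
    have h1 := hcell k hk
    have h2 : y k ^ ε ≤ Y ^ ε := Real.rpow_le_rpow (hy k hk) (hyY k hk) hε.le
    have hx0 := Real.rpow_nonneg (hx k hk) ((2 : ℝ) / 3)
    have hy0 := Real.rpow_nonneg (hy k hk) ((2 : ℝ) / 3)
    have hyε := Real.rpow_nonneg (hy k hk) ε
    calc _ = (t ^ (ε / 2) * x k ^ ε) * y k ^ ε * (x k ^ ((2 : ℝ) / 3) * y k ^ ((2 : ℝ) / 3)) := by
          ring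
      _ ≤ _ := by gcongr
  have hholder : ∑ k ∈ K, x k ^ ((2 : ℝ) / 3) * y k ^ ((2 : ℝ) / 3) ≤
      A ^ ((1 : ℝ) / 3) * (X ^ ((2 : ℝ) / 3) * Y ^ ((2 : ℝ) / 3)) := by
    refine (sum_rpow_two_thirds_le K hx hy).trans ?_
    have hx2 : 0 ≤ ∑ k ∈ K, x k ^ 2 := sum_nonneg fun _ _ => sq_nonneg _
    have hy1 := sum_nonneg hy
    rw [hthird _ hy1, hthird _ hX, hthird _ hY, ← Real.mul_rpow hx2 (sq_nonneg _),
      ← Real.mul_rpow (sq_nonneg _) (sq_nonneg _), ← Real.mul_rpow hA.le (by positivity)]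
    refine Real.rpow_le_rpow (by positivity) ?_ (by norm_num)
    apply le_of_mul_le_mul_left _ ht
    calc t * ((∑ k ∈ K, x k ^ 2) * (∑ k ∈ K, y k) ^ 2)
        = (t * ∑ k ∈ K, x k ^ 2) * (∑ k ∈ K, y k) ^ 2 := by ring
      _ ≤ X ^ 2 * (s * Y) ^ 2 := by gcongr
      _ = s ^ 2 * (X ^ 2 * Y ^ 2) := by ring
      _ ≤ A * t * (X ^ 2 * Y ^ 2) := by gcongr
      _ = _ := by ring
  rw [hsplit _ hX, hsplit _ hY]
  apply le_of_mul_le_mul_left _ hA3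
  have hS : 0 ≤ ∑ k ∈ K, x k ^ ((2 : ℝ) / 3 + ε) * y k ^ ((2 : ℝ) / 3 + ε) :=
    sum_nonneg fun k hk => mul_nonneg (Real.rpow_nonneg (hx k hk) _) (Real.rpow_nonneg (hy k hk) _)
  calc _ = (4 * A ^ ((1 : ℝ) / 3)) *
        ∑ k ∈ K, x k ^ ((2 : ℝ) / 3 + ε) * y k ^ ((2 : ℝ) / 3 + ε) := by ring
    _ ≤ t ^ (ε / 2) * ∑ k ∈ K, x k ^ ((2 : ℝ) / 3 + ε) * y k ^ ((2 : ℝ) / 3 + ε) := by gcongr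
    _ ≤ X ^ ε * Y ^ ε * ∑ k ∈ K, x k ^ ((2 : ℝ) / 3) * y k ^ ((2 : ℝ) / 3) := by
      rw [mul_sum, mul_sum]
      exact sum_le_sum hterm
    _ ≤ X ^ ε * Y ^ ε * (A ^ ((1 : ℝ) / 3) * (X ^ ((2 : ℝ) / 3) * Y ^ ((2 : ℝ) / 3))) := by
      gcongr
    _ = _ := by ring

/-- One step of the divide-and-conquer argument. -/
theorem incCount_le_of_cells {X Y κ : Type*} {inc : X → Y → Prop} {P : Finset X} {L : Finset Y}
    {t : ℝ} {s : ℕ} (D : CellDecomposition κ inc P L t s) {ε A B C : ℝ} (hε : 0 < ε) (ht : 0 < t)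
    (hA : 0 < A) (hsA : (s : ℝ) ^ 2 ≤ A * t) (htA : 4 * A ^ ((1 : ℝ) / 3) ≤ t ^ (ε / 2))
    (hC0 : 0 ≤ C)
    (hB : incCount inc D.boundary L ≤ B * stBound ε #P #L)
    (hC : ∀ k ∈ D.keys, ∀ L' ⊆ L, incCount inc (D.cell k) L' ≤ C * stBound ε #(D.cell k) #L') :
    incCount inc P L ≤ B * stBound ε #P #L +
      C * ((#P : ℝ) ^ ((2 : ℝ) / 3 + ε) * (#L : ℝ) ^ ((2 : ℝ) / 3 + ε) / 4 + #P + s * #L) := by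
  classical
  set M : κ → Finset Y := fun k => {l ∈ L | ∃ p ∈ D.cell k, inc p l} with hM
  have h1 : incCount inc P L ≤
      incCount inc D.boundary L + ∑ k ∈ D.keys, incCount inc (D.cell k) (M k) := by
    have hcell : ∀ k, incCount inc (D.cell k) L = incCount inc (D.cell k) (M k) := by
      intro k
      unfold incCount
      congr 1
      ext q
      simp only [hM, mem_filter, mem_product]
      exact ⟨fun h => ⟨⟨h.1.1, h.1.2, q.1, h.1.1, h.2⟩, h.2⟩, fun h => ⟨⟨h.1.1, h.1.2.1⟩, h.2⟩⟩
    simp only [← hcell]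
    refine le_trans (incCount_mono inc (P' := D.boundary ∪ D.keys.biUnion D.cell) ?_ subset_rfl)
      ((incCount_union_left_le inc _ _ _).trans
        (Nat.add_le_add_left (incCount_biUnion_le inc _ _ _) _))
    intro p hp
    rw [mem_union, mem_biUnion]
    exact D.cover p hp
  have hMsum : ∑ k ∈ D.keys, (#(M k) : ℝ) ≤ s * #L := by
    have h2 : ∑ k ∈ D.keys, #(M k) ≤ #L * s := by
      simp only [hM, card_filter]
      rw [sum_comm]
      refine sum_le_card_nsmul _ _ _ fun l hl => ?_
      rw [← card_filter]
      exact D.line_cells_le l hl _ (filter_subset _ _) fun k hk => (mem_filter.1 hk).2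
    rw [mul_comm]
    exact_mod_cast h2
  have hsum := sum_cells_rpow_le D.keys (x := fun k => (#(D.cell k) : ℝ))
    (y := fun k => (#(M k) : ℝ)) (fun _ _ => Nat.cast_nonneg _) (fun _ _ => Nat.cast_nonneg _)
    (Nat.cast_nonneg #P) (Nat.cast_nonneg #L) hε ht hA hsA D.sum_sq_le
    (fun k _ => Nat.cast_le.2 (card_le_card (filter_subset _ _))) hMsum htA
  have hPsum : ∑ k ∈ D.keys, (#(D.cell k) : ℝ) ≤ #P := by exact_mod_cast D.sum_card_le
  have h3 : (∑ k ∈ D.keys, (incCount inc (D.cell k) (M k) : ℝ)) ≤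
      C * ∑ k ∈ D.keys, stBound ε #(D.cell k) #(M k) := by
    rw [mul_sum]
    exact sum_le_sum fun k hk => hC k hk _ (filter_subset _ _)
  have h4 : ∑ k ∈ D.keys, stBound ε #(D.cell k) #(M k) ≤
      (#P : ℝ) ^ ((2 : ℝ) / 3 + ε) * (#L : ℝ) ^ ((2 : ℝ) / 3 + ε) / 4 + #P + s * #L := by
    simp only [stBound, sum_add_distrib]
    linarith
  have h5 : (incCount inc P L : ℝ) ≤ incCount inc D.boundary L +
      ∑ k ∈ D.keys, (incCount inc (D.cell k) (M k) : ℝ) := by exact_mod_cast h1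
  have := mul_le_mul_of_nonneg_left h4 hC0
  linarith

/-- When neither side dominates quadratically, the linear terms are negligible. -/
theorem mul_rpow_mul_le {x y ε : ℝ} (hx : 1 ≤ x) (hy : 1 ≤ y) (hxy : x ≤ y ^ 2) :
    (x * y) ^ ε * x ≤ x ^ ((2 : ℝ) / 3 + ε) * y ^ ((2 : ℝ) / 3 + ε) := by
  have hx0 : 0 < x := by linarith
  have hy0 : 0 < y := by linarith
  have h1 : x ^ ((1 : ℝ) / 3) ≤ y ^ ((2 : ℝ) / 3) := by
    have := Real.rpow_le_rpow hx0.le hxy (show (0 : ℝ) ≤ 1 / 3 by norm_num)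
    rwa [← Real.rpow_natCast, ← Real.rpow_mul hy0.le,
      show ((2 : ℕ) : ℝ) * (1 / 3) = 2 / 3 by norm_num] at this
  have h2 : x = x ^ ((2 : ℝ) / 3) * x ^ ((1 : ℝ) / 3) := by
    rw [← Real.rpow_add hx0]; norm_num
  rw [Real.mul_rpow hx0.le hy0.le, Real.rpow_add hx0, Real.rpow_add hy0]
  calc x ^ ε * y ^ ε * x = x ^ ε * y ^ ε * (x ^ ((2 : ℝ) / 3) * x ^ ((1 : ℝ) / 3)) := by rw [← h2]
    _ ≤ x ^ ε * y ^ ε * (x ^ ((2 : ℝ) / 3) * y ^ ((2 : ℝ) / 3)) := by gcongr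
    _ = _ := by ring

theorem recursion_arith {W x y s B C : ℝ} (hx : 0 ≤ x) (hy : 0 ≤ y) (hs : 0 ≤ s) (hC : 0 ≤ C)
    (hCB : 6 * B ≤ C) (hxW : 4 * (1 + s) * x ≤ W) (hyW : 4 * (1 + s) * y ≤ W) :
    B * (W + x + y) + C * (W / 4 + x + s * y) ≤ C * (W + x + y) := by
  have hsx := mul_nonneg hs hx
  have hsy := mul_nonneg hs hy
  have h1 : x ≤ W / 4 := by linarith
  have h2 : y ≤ W / 4 := by linarith
  have h3 : s * y ≤ W / 4 := by linarith
  have h4 : B * (W + x + y) ≤ C / 6 * (W + x + y) :=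
    mul_le_mul_of_nonneg_right (by linarith) (by linarith)
  have h5 : C * (W + x + y) ≤ C * (3 / 2 * W) := mul_le_mul_of_nonneg_left (by linarith) hC
  have h6 : C * (W / 4 + x + s * y) ≤ C * (3 / 4 * W) :=
    mul_le_mul_of_nonneg_left (by linarith) hC
  have h7 : C * W ≤ C * (W + x + y) := mul_le_mul_of_nonneg_left (by linarith) hC
  linarith

/-- Divide and conquer: a class of configurations, closed under passing to subsets, all of whose
members admit good cell decompositions, satisfies the Szemerédi–Trotter bound. -/
theorem exists_incCount_le {X Y κ : Type*} {inc : X → Y → Prop}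
    {G : Finset X → Finset Y → Prop} (hG : ∀ P L P' L', G P L → P' ⊆ P → L' ⊆ L → G P' L')
    (hlin : ∀ P L, G P L → LinearIncidence inc P L) {ε : ℝ} (hε : 0 < ε) {m : ℕ} (hm : m ≠ 0)
    {A : ℝ} (hA : 0 < A)
    (hcell : ∀ i : ℕ, ∃ (s : ℕ) (B : ℝ), (s : ℝ) ^ 2 ≤ A * (2 ^ i) ^ m ∧
      ∀ P L, G P L → ∃ D : CellDecomposition κ inc P L ((2 ^ i) ^ m) s,
        incCount inc D.boundary L ≤ B * stBound ε #P #L) :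
    ∃ C : ℝ, 0 ≤ C ∧ ∀ P L, G P L → incCount inc P L ≤ C * stBound ε #P #L := by
  obtain ⟨i, hi, hi1⟩ : ∃ i : ℕ, 4 * A ^ ((1 : ℝ) / 3) ≤ (((2 : ℝ) ^ i) ^ m) ^ (ε / 2) ∧ i ≠ 0 := by
    have h1 : Filter.Tendsto (fun i : ℕ => (((2 : ℝ) ^ i) ^ m) ^ (ε / 2)) Filter.atTop
        Filter.atTop :=
      (tendsto_rpow_atTop (by positivity)).comp ((Filter.tendsto_pow_atTop hm).comp
        (tendsto_pow_atTop_atTop_of_one_lt one_lt_two))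
    exact ((h1.eventually_ge_atTop _).and (Filter.eventually_ne_atTop 0)).exists
  obtain ⟨s, B, hs, hD⟩ := hcell i
  set t : ℝ := (2 ^ i) ^ m with ht
  have ht1 : 1 < t := one_lt_pow₀ (one_lt_pow₀ one_lt_two hi1) hm
  obtain ⟨M, hM1, hM⟩ : ∃ M : ℝ, 1 ≤ M ∧ 4 * (1 + s) ≤ M ^ ε :=
    (((Filter.eventually_ge_atTop 1).and
      ((tendsto_rpow_atTop hε).eventually_ge_atTop (4 * (1 + (s : ℝ))))).exists)
  set C := max (max M 2) (6 * B) with hC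
  have hCM : M ≤ C := (le_max_left _ _).trans (le_max_left _ _)
  have hC2 : 2 ≤ C := (le_max_right _ _).trans (le_max_left _ _)
  have hCB : 6 * B ≤ C := le_max_right _ _
  refine ⟨C, by linarith, fun P => ?_⟩
  induction P using Finset.strongInduction with
  | H P ih =>
  intro L hPL
  have hx0 : (0 : ℝ) ≤ #P := Nat.cast_nonneg _
  have hy0 : (0 : ℝ) ≤ #L := Nat.cast_nonneg _
  have hW0 : 0 ≤ (#P : ℝ) ^ ((2 : ℝ) / 3 + ε) * (#L : ℝ) ^ ((2 : ℝ) / 3 + ε) := by positivity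
  by_cases h1 : #P ^ 2 ≤ #L
  · have h2 : (incCount inc P L : ℝ) ≤ 2 * #L := by
      exact_mod_cast incCount_le_of_sq_le_right (hlin P L hPL) h1
    unfold stBound
    nlinarith
  by_cases h2 : #L ^ 2 ≤ #P
  · have h2 : (incCount inc P L : ℝ) ≤ 2 * #P := by
      exact_mod_cast incCount_le_of_sq_le_left (hlin P L hPL) h2
    unfold stBound
    nlinarith
  push Not at h1 h2
  have hx1 : (1 : ℝ) ≤ #P := by
    have : 0 < #P := by by_contra! h; simp_all
    exact_mod_cast this
  have hy1 : (1 : ℝ) ≤ #L := by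
    have : 0 < #L := by by_contra! h; simp_all
    exact_mod_cast this
  by_cases hsmall : (#P * #L : ℝ) < M
  · have h3 : (incCount inc P L : ℝ) ≤ #P * #L := by exact_mod_cast incCount_le_mul inc P L
    unfold stBound
    nlinarith
  push Not at hsmall
  have hMxy : 4 * (1 + (s : ℝ)) ≤ ((#P : ℝ) * #L) ^ ε :=
    hM.trans (Real.rpow_le_rpow (by linarith) hsmall hε.le)
  have hx2 := mul_rpow_mul_le (ε := ε) hx1 hy1 (by exact_mod_cast h2.le)
  have hy2 := mul_rpow_mul_le (ε := ε) hy1 hx1 (by exact_mod_cast h1.le)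
  rw [mul_comm (#L : ℝ) #P, mul_comm ((#L : ℝ) ^ _)] at hy2
  set W := (#P : ℝ) ^ ((2 : ℝ) / 3 + ε) * (#L : ℝ) ^ ((2 : ℝ) / 3 + ε) with hW
  have hxW : 4 * (1 + (s : ℝ)) * #P ≤ W := (mul_le_mul_of_nonneg_right hMxy hx0).trans hx2
  have hyW : 4 * (1 + (s : ℝ)) * #L ≤ W := (mul_le_mul_of_nonneg_right hMxy hy0).trans hy2
  have hs0 : (0 : ℝ) ≤ s := Nat.cast_nonneg s
  obtain ⟨D, hDB⟩ := hD P L hPL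
  have hrec := incCount_le_of_cells D hε (by linarith) hA hs hi (C := C) (by linarith) hDB ?_
  · exact hrec.trans (recursion_arith hx0 hy0 hs0 (by linarith) hCB hxW hyW)
  · intro k hk L' hL'
    refine ih _ ?_ L' (hG P L _ _ hPL (D.cell_subset k hk) hL')
    refine (D.cell_subset k hk).ssubset_of_ne fun heq => ?_
    have h7 : t * (#(D.cell k) : ℝ) ^ 2 ≤ (#P : ℝ) ^ 2 := le_trans (by
      gcongr
      exact single_le_sum (f := fun k => (#(D.cell k) : ℝ) ^ 2) (fun _ _ => sq_nonneg _) hk)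
      D.sum_sq_le
    rw [heq] at h7
    have h8 : 0 < (t - 1) * (#P : ℝ) ^ 2 := by
      have : 0 < t - 1 := by linarith
      positivity
    linarith

section PlaneCurves

open MvPolynomial

theorem eval_list_prod_eq_zero_iff {σ : Type*} {gs : List (MvPolynomial σ ℝ)} {x : σ → ℝ} :
    eval x gs.prod = 0 ↔ ∃ g ∈ gs, eval x g = 0 := by
  rw [map_list_prod]
  simp [List.prod_eq_zero_iff]

/-- The cell decomposition given by the sign patterns of a list of polynomials. -/
theorem exists_cellDecomposition {X Y σ : Type*} {inc : X → Y → Prop} {P : Finset X}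
    {L : Finset Y} (z : X → σ → ℝ) (gs : List (MvPolynomial σ ℝ)) {t : ℝ} {s : ℕ}
    (ht : t * #(sameCell P z gs) ≤ (#P : ℝ) ^ 2)
    (hline : ∀ l ∈ L, ∀ S ⊆ P, (∀ p ∈ S, inc p l) → (∀ p ∈ S, ∀ g ∈ gs, eval (z p) g ≠ 0) →
      (∀ p ∈ S, ∀ q ∈ S, (∀ g ∈ gs, 0 < eval (z p) g * eval (z q) g) → p = q) → #S ≤ s) :
    ∃ D : CellDecomposition (List SignType) inc P L t s,
      ∀ p ∈ D.boundary, eval (z p) gs.prod = 0 := by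
  classical
  refine ⟨{
    boundary := {p ∈ P | eval (z p) gs.prod = 0}
    keys := signKeys P z gs
    cell := signCell P z gs
    boundary_subset := filter_subset _ _
    cell_subset := fun k _ => filter_subset _ _
    cover := fun p hp => ?_
    sum_card_le := sum_card_signCell_le P z gs _
    sum_sq_le := ?_
    line_cells_le := fun l hl K' hK' hK => ?_ }, fun p hp => (mem_filter.1 hp).2⟩
  · by_cases h : ∃ g ∈ gs, eval (z p) g = 0
    · exact Or.inl (mem_filter.2 ⟨hp, eval_list_prod_eq_zero_iff.2 h⟩)
    · push Not at h
      refine Or.inr ⟨signList gs (z p), mem_filter.2 ⟨mem_image_of_mem _ hp, ?_⟩,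
        mem_filter.2 ⟨hp, rfl⟩⟩
      exact zero_notMem_signList.2 h
  · rw [card_sameCell] at ht
    exact_mod_cast ht
  · rcases K'.eq_empty_or_nonempty with rfl | ⟨k₀, hk₀⟩
    · simp
    have : Nonempty X := let ⟨p, _⟩ := hK k₀ hk₀; ⟨p⟩
    choose! p hp hpl using hK
    have hsign : ∀ k ∈ K', signList gs (z (p k)) = k := fun k hk => (mem_filter.1 (hp k hk)).2
    have hne : ∀ k ∈ K', ∀ g ∈ gs, eval (z (p k)) g ≠ 0 := by
      intro k hk
      rw [← zero_notMem_signList, hsign k hk]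
      exact (mem_filter.1 (hK' hk)).2
    have hinj : Set.InjOn p (K' : Finset (List SignType)) := by
      intro j hj k hk hjk
      rw [← hsign j hj, ← hsign k hk, hjk]
    rw [← card_image_of_injOn hinj]
    refine hline l hl _ ?_ ?_ ?_ ?_
    · intro q hq
      obtain ⟨k, hk, rfl⟩ := mem_image.1 hq
      exact (mem_filter.1 (hp k hk)).1
    · simpa using hpl
    · simpa using hne
    · simp only [mem_image, forall_exists_index, and_imp, forall_apply_eq_imp_iff₂]
      intro j hj k hk hjk
      rw [← signList_eq_iff (hne j hj), hsign j hj, hsign k hk] at hjk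
      rw [hjk]

/-- The incidences of `P` and `L` are realised by points and curves of degree at most `d` in the
plane, where distinct points on the same curve stay distinct. -/
def IsCurveSystem {X Y : Type*} (inc : X → Y → Prop) (d : ℕ) (P : Finset X) (L : Finset Y) :
    Prop :=
  LinearIncidence inc P L ∧ ∃ (z : X → Fin 2 → ℝ) (f : Y → MvPolynomial (Fin 2) ℝ),
    ∀ l ∈ L, f l ≠ 0 ∧ (f l).totalDegree ≤ d ∧ (∀ p ∈ P, inc p l ↔ eval (z p) (f l) = 0) ∧
      ∀ p ∈ P, ∀ q ∈ P, inc p l → inc q l → z p = z q → p = q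

theorem IsCurveSystem.mono {X Y : Type*} {inc : X → Y → Prop} {d : ℕ} {P P' : Finset X}
    {L L' : Finset Y} (h : IsCurveSystem inc d P L) (hP : P' ⊆ P) (hL : L' ⊆ L) :
    IsCurveSystem inc d P' L' := by
  obtain ⟨h1, z, f, h2⟩ := h
  refine ⟨h1.mono hP hL, z, f, fun l hl => ?_⟩
  obtain ⟨h3, h4, h5, h6⟩ := h2 l (hL hl)
  exact ⟨h3, h4, fun p hp => h5 p (hP hp), fun p hp q hq => h6 p (hP hp) q (hP hq)⟩

theorem incCount_le_add_of_complete {X Y : Type*} {inc : X → Y → Prop} {P : Finset X}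
    {L : Finset Y} (h : LinearIncidence inc P L) (hc : ∀ p ∈ P, ∀ l ∈ L, inc p l) :
    incCount inc P L ≤ #P + #L := by
  refine (incCount_le_mul inc P L).trans ?_
  by_cases hP : #P ≤ 1
  · nlinarith
  · have hL : #L ≤ 1 := by
      obtain ⟨p, hp, q, hq, hpq⟩ := one_lt_card.1 (not_le.1 hP)
      exact card_le_one.2 fun l hl m hm =>
        (h p hp q hq l hl m hm (hc p hp l hl) (hc q hq l hl) (hc p hp m hm)
          (hc q hq m hm)).resolve_left hpq
    nlinarith

theorem one_le_totalDegree_of_prime {σ : Type*} {q : MvPolynomial σ ℝ} (hq : Prime q) :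
    1 ≤ q.totalDegree := by
  rw [Nat.one_le_iff_ne_zero]
  intro h
  rw [totalDegree_eq_zero_iff_eq_C] at h
  refine hq.not_isUnit (h ▸ (IsUnit.mk0 _ fun h0 => hq.ne_zero ?_).map C)
  rw [h, h0, C_0]

/-- Incidences whose points lie on a plane curve. -/
theorem incCount_on_curve_le {X Y : Type*} {inc : X → Y → Prop} {d : ℕ} {P : Finset X}
    {L : Finset Y} (hlin : LinearIncidence inc P L) {z : X → Fin 2 → ℝ}
    {f : Y → MvPolynomial (Fin 2) ℝ}
    (hf : ∀ l ∈ L, f l ≠ 0 ∧ (f l).totalDegree ≤ d ∧ (∀ p ∈ P, inc p l ↔ eval (z p) (f l) = 0) ∧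
      ∀ p ∈ P, ∀ q ∈ P, inc p l → inc q l → z p = z q → p = q)
    {g : MvPolynomial (Fin 2) ℝ} (hg : g ≠ 0) {Q : Finset X} (hQP : Q ⊆ P)
    (hQ : ∀ p ∈ Q, eval (z p) g = 0) :
    incCount inc Q L ≤ g.totalDegree * (#P + (d + 1) * #L) := by
  classical
  induction g using UniqueFactorizationMonoid.induction_on_prime generalizing Q with
  | h₁ => exact absurd rfl hg
  | h₂ x hx =>
    have : Q = ∅ := by
      refine Finset.eq_empty_of_forall_notMem fun p hp => ?_
      have := hx.map (eval (z p))
      rw [hQ p hp] at this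
      exact not_isUnit_zero this
    simp [this, incCount]
  | h₃ a q ha hq ih =>
    have hsub : Q ⊆ {p ∈ Q | eval (z p) q = 0} ∪ {p ∈ Q | eval (z p) a = 0} := by
      intro p hp
      have := hQ p hp
      rw [map_mul, mul_eq_zero] at this
      simpa [hp] using this
    have h2 := ih ha (Q := {p ∈ Q | eval (z p) a = 0}) ((filter_subset _ _).trans hQP) (by simp)
    set R := {p ∈ Q | eval (z p) q = 0} with hR
    have hRP : R ⊆ P := (filter_subset _ _).trans hQP
    have hLsub : L ⊆ {l ∈ L | q ∣ f l} ∪ {l ∈ L | ¬ q ∣ f l} := by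
      rw [filter_union_filter_not_eq]
    have h3 : incCount inc R {l ∈ L | q ∣ f l} ≤ #P + #L := by
      refine (incCount_le_add_of_complete (hlin.mono hRP (filter_subset _ _)) ?_).trans
        (Nat.add_le_add (card_le_card hRP) (card_le_card (filter_subset _ _)))
      intro p hp l hl
      obtain ⟨hl, c, hc⟩ := mem_filter.1 hl
      rw [(hf l hl).2.2.1 p (hRP hp), hc, map_mul, (mem_filter.1 hp).2, zero_mul]
    have h4 : incCount inc R {l ∈ L | ¬ q ∣ f l} ≤ #L * (q.totalDegree * d) := by
      rw [incCount_eq_sum_right]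
      refine (sum_le_card_nsmul _ _ (q.totalDegree * d) fun l hl => ?_).trans
        (Nat.mul_le_mul_right _ (card_le_card (filter_subset _ _)))
      obtain ⟨hl, hql⟩ := mem_filter.1 hl
      obtain ⟨-, hd, hinc, hinj⟩ := hf l hl
      have hinj' : Set.InjOn z ({p ∈ R | inc p l} : Finset X) := by
        intro p hp p' hp' h
        obtain ⟨hp, hpl⟩ := mem_filter.1 hp
        obtain ⟨hp', hpl'⟩ := mem_filter.1 hp'
        exact hinj p (hRP hp) p' (hRP hp') hpl hpl' h
      rw [← card_image_of_injOn hinj']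
      refine (card_le_totalDegree_mul_totalDegree hq hql ?_ ?_).trans (Nat.mul_le_mul_left _ hd)
      · intro w hw
        obtain ⟨p, hp, rfl⟩ := mem_image.1 hw
        exact (mem_filter.1 (mem_filter.1 hp).1).2
      · intro w hw
        obtain ⟨p, hp, rfl⟩ := mem_image.1 hw
        obtain ⟨hp, hpl⟩ := mem_filter.1 hp
        exact (hinc p (hRP hp)).1 hpl
    have h5 := (incCount_mono inc subset_rfl hLsub).trans (incCount_union_right_le inc R _ _)
    have h6 := (incCount_mono inc hsub subset_rfl).trans (incCount_union_left_le inc _ _ L)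
    have h7 := one_le_totalDegree_of_prime hq
    rw [totalDegree_mul_of_isDomain hq.ne_zero ha]
    calc _ ≤ (#P + #L) + #L * (q.totalDegree * d) + a.totalDegree * (#P + (d + 1) * #L) := by
          omega
      _ ≤ q.totalDegree * (#P + #L) + #L * (q.totalDegree * d) +
          a.totalDegree * (#P + (d + 1) * #L) := by
          gcongr
          exact Nat.le_mul_of_pos_left _ h7
      _ = _ := by ring

/-- The Szemerédi–Trotter bound for systems of plane curves of bounded degree. -/
theorem exists_incCount_le_of_isCurveSystem {X Y : Type} (inc : X → Y → Prop) {ε : ℝ}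
    (hε : 0 < ε) (d : ℕ) :
    ∃ C : ℝ, 0 ≤ C ∧ ∀ P L, IsCurveSystem inc d P L → incCount inc P L ≤ C * stBound ε #P #L := by
  obtain ⟨K, -, hK⟩ := exists_partition (Fin 2)
  refine exists_incCount_le (κ := List SignType) (G := IsCurveSystem inc d)
    (fun P L P' L' h hP hL => h.mono hP hL) (fun P L h => h.1) hε two_ne_zero
    (A := ((d * (d + K + 2) : ℕ) : ℝ) ^ 2 + 1) (by positivity) fun i => ?_
  refine ⟨d * (d + K * 2 ^ i + 2), (K * 2 ^ i : ℕ) * (d + 1 : ℕ), ?_, fun P L hPL => ?_⟩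
  · have h1 : d * (d + K * 2 ^ i + 2) ≤ d * (d + K + 2) * 2 ^ i := by
      have : 1 ≤ 2 ^ i := Nat.one_le_two_pow
      rw [mul_assoc]
      gcongr
      nlinarith
    have h2 : ((d * (d + K * 2 ^ i + 2) : ℕ) : ℝ) ≤ (d * (d + K + 2) : ℕ) * 2 ^ i := by
      exact_mod_cast h1
    calc _ ≤ (((d * (d + K + 2) : ℕ) : ℝ) * 2 ^ i) ^ 2 := by gcongr
      _ = ((d * (d + K + 2) : ℕ) : ℝ) ^ 2 * (2 ^ i) ^ 2 := by ring
      _ ≤ _ := by gcongr; linarith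
  · obtain ⟨hlin, z, f, hf⟩ := hPL
    obtain ⟨gs, hgs0, hdeg, hcard⟩ := hK i X P z
    have hdeg' := (totalDegree_list_prod gs).trans hdeg
    have hdec : ∃ D : CellDecomposition (List SignType) inc P L ((2 ^ i) ^ 2)
        (d * (d + K * 2 ^ i + 2)), ∀ p ∈ D.boundary, eval (z p) gs.prod = 0 := by
      refine exists_cellDecomposition z gs (by simpa using hcard) ?_
      intro l hl S hS hSl hSgs hSinj
      obtain ⟨hf0, hfd, hinc, hinj⟩ := hf l hl
      have hinj' : Set.InjOn z (S : Finset X) := fun p hp q hq =>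
        hinj p (hS hp) q (hS hq) (hSl p hp) (hSl q hq)
      rw [← card_image_of_injOn hinj']
      refine (card_signs_on_curve hf0 gs ?_ ?_ ?_).trans (Nat.mul_le_mul hfd (by omega))
      · simp only [mem_image, forall_exists_index, and_imp, forall_apply_eq_imp_iff₂]
        exact fun p hp => (hinc p (hS hp)).1 (hSl p hp)
      · simpa using hSgs
      · simp only [mem_image, forall_exists_index, and_imp, forall_apply_eq_imp_iff₂]
        exact fun p hp q hq h => congrArg z (hSinj p hp q hq h)
    obtain ⟨D, hD⟩ := hdec
    refine ⟨D, ?_⟩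
    have h1 := incCount_on_curve_le hlin hf
      (List.prod_ne_zero fun h => hgs0 0 h rfl) D.boundary_subset hD
    have h2 : incCount inc D.boundary L ≤ K * 2 ^ i * (d + 1) * (#P + #L) := by
      calc _ ≤ _ := h1
        _ ≤ K * 2 ^ i * (#P + (d + 1) * #L) := by gcongr
        _ ≤ K * 2 ^ i * ((d + 1) * #P + (d + 1) * #L) := by
          gcongr
          exact Nat.le_mul_of_pos_left _ d.succ_pos
        _ = _ := by ring
    have h3 : (incCount inc D.boundary L : ℝ) ≤
        (K * 2 ^ i : ℕ) * (d + 1 : ℕ) * ((#P : ℝ) + #L) := by exact_mod_cast h2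
    refine h3.trans ?_
    have h4 : (0 : ℝ) ≤ (#P : ℝ) ^ ((2 : ℝ) / 3 + ε) * (#L : ℝ) ^ ((2 : ℝ) / 3 + ε) := by
      positivity
    unfold stBound
    gcongr
    linarith

end PlaneCurves

section ComplexLines

open MvPolynomial Topology

theorem totalDegree_aeval_le {σ τ : Type*} [Fintype σ] {f : σ → MvPolynomial τ ℝ}
    (hf : ∀ i, (f i).totalDegree ≤ 1) (p : MvPolynomial σ ℝ) :
    (aeval f p).totalDegree ≤ p.totalDegree := by
  rw [aeval_def, eval₂_eq']
  refine totalDegree_finsetSum_le fun m hm => ?_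
  refine (totalDegree_mul _ _).trans ?_
  rw [algebraMap_eq, totalDegree_C, zero_add]
  refine (totalDegree_finsetProd _ _).trans (le_trans ?_ (le_totalDegree hm))
  rw [Finsupp.sum_fintype _ _ fun _ => rfl]
  refine sum_le_sum fun i _ => (totalDegree_pow _ _).trans ?_
  simpa using Nat.mul_le_mul_left (m i) (hf i)

/-- Real coordinates on `ℂ`. -/
def planeCoords (w : ℂ) : Fin 2 → ℝ := ![w.re, w.im]

/-- Real coordinates on `ℂ × ℂ`. -/
def spaceCoords (x : ℂ × ℂ) : Fin 4 → ℝ := ![x.1.re, x.1.im, x.2.re, x.2.im]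

theorem planeCoords_injective : Function.Injective planeCoords := fun _ _ h =>
  Complex.ext (congrFun h 0) (congrFun h 1)

theorem continuous_spaceCoords : Continuous spaceCoords := by
  refine continuous_pi fun i => ?_
  fin_cases i <;> simp only [spaceCoords] <;> simp <;> fun_prop

theorem eq_zero_of_eventually_eval_planeCoords {g : MvPolynomial (Fin 2) ℝ} {w₀ : ℂ}
    (h : ∀ᶠ w in 𝓝 w₀, eval (planeCoords w) g = 0) : g = 0 := by
  obtain ⟨r, hr, hball⟩ := Metric.eventually_nhds_iff.1 h
  refine funext_set (fun i => Set.Ioo (planeCoords w₀ i - r / 2) (planeCoords w₀ i + r / 2))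
    (fun i => Set.Ioo_infinite (by linarith)) fun x hx => ?_
  have h0 := hx 0 trivial
  have h1 := hx 1 trivial
  simp only [planeCoords, Matrix.cons_val_zero, Matrix.cons_val_one, Set.mem_Ioo] at h0 h1
  have hx' : x = planeCoords ⟨x 0, x 1⟩ := by
    ext i
    fin_cases i <;> rfl
  rw [hx', hball, map_zero]
  rw [dist_eq_norm]
  refine (Complex.norm_le_abs_re_add_abs_im _).trans_lt ?_
  have h2 : |x 0 - w₀.re| < r / 2 := abs_lt.2 ⟨by linarith, by linarith⟩
  have h3 : |x 1 - w₀.im| < r / 2 := abs_lt.2 ⟨by linarith, by linarith⟩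
  simp only [Complex.sub_re, Complex.sub_im]
  linarith

/-- The substitution of the parametrisation `w ↦ q + w • d` of a complex line. -/
noncomputable def lineRestrict (q d : ℂ × ℂ) :
    MvPolynomial (Fin 4) ℝ →ₐ[ℝ] MvPolynomial (Fin 2) ℝ :=
  aeval ![C q.1.re + (C d.1.re * X 0 - C d.1.im * X 1),
    C q.1.im + (C d.1.im * X 0 + C d.1.re * X 1),
    C q.2.re + (C d.2.re * X 0 - C d.2.im * X 1),
    C q.2.im + (C d.2.im * X 0 + C d.2.re * X 1)]

theorem eval_lineRestrict (q d : ℂ × ℂ) (f : MvPolynomial (Fin 4) ℝ) (w : ℂ) :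
    eval (planeCoords w) (lineRestrict q d f) = eval (spaceCoords (q + w • d)) f := by
  rw [lineRestrict, ← coe_aeval_eq_eval, ← coe_aeval_eq_eval]
  change aeval _ (aeval _ f) = aeval _ f
  rw [← AlgHom.comp_apply]
  congr 1
  refine algHom_ext fun i => ?_
  fin_cases i <;> simp [planeCoords, spaceCoords] <;> ring

theorem totalDegree_lineRestrict_le (q d : ℂ × ℂ) (f : MvPolynomial (Fin 4) ℝ) :
    (lineRestrict q d f).totalDegree ≤ f.totalDegree := by
  have hmul : ∀ (a : ℝ) (j : Fin 2), (C a * X j : MvPolynomial (Fin 2) ℝ).totalDegree ≤ 1 :=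
    fun a j => (totalDegree_mul _ _).trans (by simp)
  have hsub : ∀ a b c : ℝ,
      (C a + (C b * X 0 - C c * X 1) : MvPolynomial (Fin 2) ℝ).totalDegree ≤ 1 := fun a b c =>
    (totalDegree_add _ _).trans (max_le (by simp)
      ((totalDegree_sub _ _).trans (max_le (hmul _ _) (hmul _ _))))
  have hadd : ∀ a b c : ℝ,
      (C a + (C b * X 0 + C c * X 1) : MvPolynomial (Fin 2) ℝ).totalDegree ≤ 1 := fun a b c =>
    (totalDegree_add _ _).trans (max_le (by simp)
      ((totalDegree_add _ _).trans (max_le (hmul _ _) (hmul _ _))))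
  refine totalDegree_aeval_le (fun i => ?_) f
  fin_cases i
  · exact hsub _ _ _
  · exact hadd _ _ _
  · exact hsub _ _ _
  · exact hadd _ _ _

/-- Complex lines, in parametric form. -/
def IsComplexLine (l : Set (ℂ × ℂ)) : Prop :=
  ∃ q d : ℂ × ℂ, d ≠ 0 ∧ l = Set.range fun w : ℂ => q + w • d

theorem isComplexLine_setOf {a b c : ℂ} (hab : (a, b) ≠ ((0 : ℂ), (0 : ℂ))) :
    IsComplexLine {z : ℂ × ℂ | a * z.1 + b * z.2 + c = 0} := by
  by_cases hb : b = 0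
  · have ha : a ≠ 0 := fun h => hab (by rw [h, hb])
    refine ⟨(-c / a, 0), (0, 1), by simp, ?_⟩
    ext ⟨x, y⟩
    simp only [hb, Set.mem_ofPred_eq, Set.mem_range, Prod.smul_mk, Prod.mk_add_mk, Prod.mk.injEq,
      smul_eq_mul]
    constructor
    · intro h
      refine ⟨y, ?_, by ring⟩
      field_simp
      linear_combination -h
    · rintro ⟨w, rfl, rfl⟩
      field_simp
      ring
  · refine ⟨(0, -c / b), (1, -a / b), by simp, ?_⟩
    ext ⟨x, y⟩
    simp only [Set.mem_ofPred_eq, Set.mem_range, Prod.smul_mk, Prod.mk_add_mk, Prod.mk.injEq,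
      smul_eq_mul]
    constructor
    · intro h
      refine ⟨x, by ring, ?_⟩
      field_simp
      linear_combination -h
    · rintro ⟨w, rfl, rfl⟩
      field_simp
      ring

theorem IsComplexLine.eq_range {l : Set (ℂ × ℂ)} (hl : IsComplexLine l) {x y : ℂ × ℂ}
    (hx : x ∈ l) (hy : y ∈ l) (hxy : x ≠ y) : l = Set.range fun w : ℂ => x + w • (y - x) := by
  obtain ⟨q, d, -, rfl⟩ := hl
  obtain ⟨u, rfl⟩ := hx
  obtain ⟨v, rfl⟩ := hy
  have huv : v - u ≠ 0 := fun h => hxy (by simp [sub_eq_zero.1 h])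
  ext z
  constructor
  · rintro ⟨w, rfl⟩
    refine ⟨(w - u) / (v - u), ?_⟩
    have : q + v • d - (q + u • d) = (v - u) • d := by module
    simp only [this, smul_smul, div_mul_cancel₀ _ huv]
    module
  · rintro ⟨w, rfl⟩
    exact ⟨u + w * (v - u), by module⟩

theorem linearIncidence_of_isComplexLine (P : Finset (ℂ × ℂ)) {L : Finset (Set (ℂ × ℂ))}
    (hL : ∀ l ∈ L, IsComplexLine l) : LinearIncidence (· ∈ ·) P L := by
  intro p _ q _ l hl m hm hpl hql hpm hqm
  by_cases h : p = q
  · exact Or.inl h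
  · exact Or.inr (((hL l hl).eq_range hpl hql h).trans ((hL m hm).eq_range hpm hqm h).symm)

/-- The linear projection `ℂ × ℂ → ℂ` with parameter `s`. -/
def shear (s : ℂ) : ℂ × ℂ →ₗ[ℂ] ℂ := LinearMap.fst ℂ ℂ ℂ + s • LinearMap.snd ℂ ℂ ℂ

theorem shear_apply (s : ℂ) (x : ℂ × ℂ) : shear s x = x.1 + s * x.2 := rfl

theorem isOpen_shear_ne_zero (d : ℂ × ℂ) : IsOpen {s | shear s d ≠ 0} := by
  simp only [shear_apply]
  exact isOpen_ne_fun (by fun_prop) continuous_const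

theorem dense_shear_ne_zero {d : ℂ × ℂ} (hd : d ≠ 0) : Dense {s | shear s d ≠ 0} := by
  have : {s | shear s d = 0}.Subsingleton := by
    intro s hs t ht
    simp only [shear_apply, Set.mem_ofPred_eq] at hs ht
    have h1 : (s - t) * d.2 = 0 := by linear_combination hs - ht
    rcases mul_eq_zero.1 h1 with h | h
    · exact sub_eq_zero.1 h
    · exact absurd (Prod.ext (by simpa [h] using hs) h) hd
  exact this.countable.dense_compl ℂ

theorem dense_eval_ne_zero {q d p : ℂ × ℂ} (hd : d ≠ 0)
    (hp : p ∉ Set.range fun w : ℂ => q + w • d) {h : MvPolynomial (Fin 4) ℝ}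
    (hh : ∃ w : ℂ, eval (spaceCoords (q + w • d)) h ≠ 0) :
    IsOpen {s | shear s d ≠ 0 ∧
        eval (spaceCoords (q + (shear s (p - q) / shear s d) • d)) h ≠ 0} ∧
      Dense {s | shear s d ≠ 0 ∧
        eval (spaceCoords (q + (shear s (p - q) / shear s d) • d)) h ≠ 0} := by
  set e := p - q with he
  constructor
  · refine ContinuousOn.isOpen_inter_preimage (t := {0}ᶜ) ?_ (isOpen_shear_ne_zero d)
      isOpen_compl_singleton
    refine (continuous_eval_point h).comp_continuousOn (continuous_spaceCoords.comp_continuousOn ?_)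
    refine continuousOn_const.add (ContinuousOn.smul (ContinuousOn.div ?_ ?_ fun s hs => hs)
      continuousOn_const)
    · simp only [shear_apply]; fun_prop
    · simp only [shear_apply]; fun_prop
  · rw [dense_iff_inter_open]
    intro U hU hUne
    by_contra hempty
    obtain ⟨s₀, hs₀, hs₀d⟩ := (dense_shear_ne_zero hd).inter_open_nonempty U hU hUne
    have hzero : ∀ s ∈ U ∩ {s | shear s d ≠ 0},
        eval (spaceCoords (q + (shear s e / shear s d) • d)) h = 0 := by
      intro s hs
      by_contra h0
      exact hempty ⟨s, hs.1, hs.2, h0⟩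
    set w₀ := shear s₀ e / shear s₀ d with hw₀
    have hw₀' : (e.1 - w₀ * d.1) + s₀ * (e.2 - w₀ * d.2) = 0 := by
      have : w₀ * shear s₀ d = shear s₀ e := div_mul_cancel₀ _ hs₀d
      simp only [shear_apply] at this
      linear_combination -this
    have hne : e.2 - w₀ * d.2 ≠ 0 := by
      intro h2
      rw [h2, mul_zero, add_zero] at hw₀'
      refine hp ⟨w₀, ?_⟩
      have : e = w₀ • d := Prod.ext (sub_eq_zero.1 hw₀') (sub_eq_zero.1 h2)
      change q + w₀ • d = p
      rw [← this, he, add_sub_cancel]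
    let ν : ℂ → ℂ := fun w => -(e.1 - w * d.1) / (e.2 - w * d.2)
    have hν : ContinuousAt ν w₀ := ContinuousAt.div (by fun_prop) (by fun_prop) hne
    have hν₀ : ν w₀ = s₀ := by
      rw [div_eq_iff hne]
      linear_combination -hw₀'
    have h1 : ∀ᶠ w in 𝓝 w₀, ν w ∈ U ∩ {s | shear s d ≠ 0} :=
      hν.eventually_mem (by
        rw [hν₀]
        exact (hU.inter (isOpen_shear_ne_zero d)).mem_nhds ⟨hs₀, hs₀d⟩)
    have h2 : ∀ᶠ w in 𝓝 w₀, e.2 - w * d.2 ≠ 0 :=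
      (ContinuousAt.eventually_ne (by fun_prop) hne)
    have h3 : lineRestrict q d h = 0 := by
      refine eq_zero_of_eventually_eval_planeCoords (w₀ := w₀) ?_
      filter_upwards [h1, h2] with w hw hw2
      have h4 : shear (ν w) e / shear (ν w) d = w := by
        rw [div_eq_iff hw.2]
        have : ν w * (e.2 - w * d.2) = -(e.1 - w * d.1) := div_mul_cancel₀ _ hw2
        simp only [shear_apply]
        linear_combination this
      have h5 := hzero _ hw
      rwa [h4, ← eval_lineRestrict] at h5
    obtain ⟨w, hw⟩ := hh
    rw [← eval_lineRestrict, h3, map_zero] at hw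
    exact hw rfl

/-- A generic projection, used as a common parameter for finitely many lines, separates the lines
from the points off them by means of `h`. -/
theorem exists_shear (P : Finset (ℂ × ℂ)) {L : Finset (Set (ℂ × ℂ))}
    (hL : ∀ l ∈ L, IsComplexLine l) {h : MvPolynomial (Fin 4) ℝ}
    (hh : ∀ l ∈ L, ∃ x ∈ l, eval (spaceCoords x) h ≠ 0) :
    ∃ s : ℂ, ∀ l ∈ L, ∃ q d : ℂ × ℂ, l = (Set.range fun w : ℂ => q + w • d) ∧
      shear s q = 0 ∧ shear s d = 1 ∧
      ∀ p ∈ P, p ∉ l → eval (spaceCoords (q + shear s p • d)) h ≠ 0 := by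
  choose! q d hd hl using hL
  let U : (ℂ × ℂ) × Set (ℂ × ℂ) → Set ℂ := fun x => {s | x.1 ∉ x.2 →
    eval (spaceCoords (q x.2 + (shear s (x.1 - q x.2) / shear s (d x.2)) • d x.2)) h ≠ 0}
  have hopen : ∀ l ∈ L, IsOpen {s | shear s (d l) ≠ 0} ∧ Dense {s | shear s (d l) ≠ 0} :=
    fun l hlL => ⟨isOpen_shear_ne_zero _, dense_shear_ne_zero (hd l hlL)⟩
  have hopen' : ∀ x ∈ P ×ˢ L, IsOpen ({s | shear s (d x.2) ≠ 0} ∩ U x) ∧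
      Dense ({s | shear s (d x.2) ≠ 0} ∩ U x) := by
    rintro ⟨p, l⟩ hx
    have hlL := (mem_product.1 hx).2
    by_cases hpl : p ∈ l
    · simpa [U, hpl] using hopen l hlL
    · have hpl' := hpl
      rw [hl l hlL] at hpl'
      obtain ⟨x, hxl, hx0⟩ := hh l hlL
      rw [hl l hlL] at hxl
      obtain ⟨w, rfl⟩ := hxl
      simpa [U, hpl, Set.ofPred_and] using dense_eval_ne_zero (hd l hlL) hpl' ⟨w, hx0⟩
  have hdense : Dense ((⋂ l ∈ (L : Set (Set (ℂ × ℂ))), {s | shear s (d l) ≠ 0}) ∩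
      ⋂ x ∈ ((P ×ˢ L : Finset _) : Set ((ℂ × ℂ) × Set (ℂ × ℂ))),
        ({s | shear s (d x.2) ≠ 0} ∩ U x)) := by
    refine Dense.inter_of_isOpen_left ?_ ?_ ?_
    · exact dense_biInter_of_isOpen (fun l hl => (hopen l hl).1) L.countable_toSet
        fun l hl => (hopen l hl).2
    · exact dense_biInter_of_isOpen (fun x hx => (hopen' x hx).1) (P ×ˢ L).countable_toSet
        fun x hx => (hopen' x hx).2
    · exact L.finite_toSet.isOpen_biInter fun l hl => (hopen l hl).1
  obtain ⟨s, hs1, hs2⟩ := hdense.nonempty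
  refine ⟨s, fun l hlL => ?_⟩
  have hsd : shear s (d l) ≠ 0 := Set.mem_iInter₂.1 hs1 l hlL
  refine ⟨q l - (shear s (q l) / shear s (d l)) • d l, (shear s (d l))⁻¹ • d l, ?_, ?_, ?_, ?_⟩
  · refine (hl l hlL).trans (Set.ext fun x => ?_)
    constructor
    · rintro ⟨w, rfl⟩
      refine ⟨w * shear s (d l) + shear s (q l), ?_⟩
      simp only [smul_smul]
      rw [add_mul, mul_assoc, mul_inv_cancel₀ hsd, div_eq_mul_inv]
      module
    · rintro ⟨w, rfl⟩
      refine ⟨w * (shear s (d l))⁻¹ - shear s (q l) / shear s (d l), ?_⟩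
      module
  · rw [map_sub, map_smul, smul_eq_mul, div_mul_cancel₀ _ hsd, sub_self]
  · rw [map_smul, smul_eq_mul, inv_mul_cancel₀ hsd]
  · intro p hp hpl
    have := (Set.mem_iInter₂.1 hs2 (p, l) (mem_coe.2 (mem_product.2 ⟨hp, hlL⟩))).2 hpl
    convert this using 4
    rw [map_sub, sub_div, div_eq_mul_inv (shear s p)]
    module

end ComplexLines

section Incidences

open MvPolynomial

theorem isCurveSystem_of_not_subset {P : Finset (ℂ × ℂ)} {L : Finset (Set (ℂ × ℂ))}
    (hL : ∀ l ∈ L, IsComplexLine l) {h : MvPolynomial (Fin 4) ℝ} {n : ℕ} (hn : h.totalDegree ≤ n)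
    (hP : ∀ p ∈ P, eval (spaceCoords p) h = 0)
    (hh : ∀ l ∈ L, ∃ x ∈ l, eval (spaceCoords x) h ≠ 0) : IsCurveSystem (· ∈ ·) n P L := by
  obtain ⟨s, hs⟩ := exists_shear P hL hh
  choose! q d hl hq hd hP' using hs
  have hon : ∀ l ∈ L, ∀ p ∈ l, p = q l + shear s p • d l := by
    intro l hlL p hp
    rw [hl l hlL] at hp
    obtain ⟨w, hw⟩ := hp
    rw [← hw]
    simp only [map_add, map_smul, hq l hlL, hd l hlL, zero_add, smul_eq_mul, mul_one]
  refine ⟨linearIncidence_of_isComplexLine P hL, fun p => planeCoords (shear s p),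
    fun l => lineRestrict (q l) (d l) h, fun l hlL =>
      ⟨fun h0 => ?_, (totalDegree_lineRestrict_le _ _ _).trans hn, fun p hp => ?_, ?_⟩⟩
  · obtain ⟨x, hx, hx0⟩ := hh l hlL
    change lineRestrict (q l) (d l) h = 0 at h0
    rw [hon l hlL x hx, ← eval_lineRestrict, h0, map_zero] at hx0
    exact hx0 rfl
  · rw [eval_lineRestrict]
    constructor
    · intro hpl
      rw [← hon l hlL p hpl]
      exact hP p hp
    · intro h0
      by_contra hpl
      exact hP' l hlL p hp hpl h0
  · intro p _ p' _ hpl hpl' heq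
    rw [hon l hlL p hpl, hon l hlL p' hpl', planeCoords_injective heq]

theorem exists_eq_smul_add_smul {l m : Set (ℂ × ℂ)} {p d e : ℂ × ℂ} (hd : d ≠ 0) (he : e ≠ 0)
    (hl : l = Set.range fun w : ℂ => p + w • d) (hm : m = Set.range fun w : ℂ => p + w • e)
    (hlm : l ≠ m) (u : ℂ × ℂ) : ∃ v w : ℂ, u = v • d + w • e := by
  by_cases hdet : d.1 * e.2 - d.2 * e.1 = 0
  · exfalso
    obtain ⟨c, hc⟩ : ∃ c : ℂ, d = c • e := by
      by_cases h1 : e.1 = 0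
      · have h2 : e.2 ≠ 0 := fun h2 => he (Prod.ext h1 h2)
        refine ⟨d.2 / e.2, Prod.ext ?_ ?_⟩
        · rw [h1, mul_zero, sub_zero] at hdet
          simp [h1, (mul_eq_zero.1 hdet).resolve_right h2]
        · simp [div_mul_cancel₀ _ h2]
      · refine ⟨d.1 / e.1, Prod.ext ?_ ?_⟩
        · simp [div_mul_cancel₀ _ h1]
        · simp only [Prod.smul_snd, smul_eq_mul]
          field_simp
          linear_combination -hdet
    have hlL : IsComplexLine l := ⟨p, d, hd, hl⟩
    have hmL : IsComplexLine m := ⟨p, e, he, hm⟩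
    have hne : p ≠ p + d := fun h => hd (by simpa using h)
    have hpl : p ∈ l := hl ▸ ⟨0, by simp⟩
    have hpm : p ∈ m := hm ▸ ⟨0, by simp⟩
    have hql : p + d ∈ l := hl ▸ ⟨1, by simp⟩
    have hqm : p + d ∈ m := hm ▸ ⟨c, by simp [hc]⟩
    exact hlm ((hlL.eq_range hpl hql hne).trans (hmL.eq_range hpm hqm hne).symm)
  · refine ⟨(u.1 * e.2 - u.2 * e.1) / (d.1 * e.2 - d.2 * e.1),
      (d.1 * u.2 - d.2 * u.1) / (d.1 * e.2 - d.2 * e.1), Prod.ext ?_ ?_⟩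
    · rw [Prod.fst_add, Prod.smul_fst, Prod.smul_fst, smul_eq_mul, smul_eq_mul,
        div_mul_eq_mul_div, div_mul_eq_mul_div, ← add_div, eq_div_iff hdet]
      ring
    · rw [Prod.snd_add, Prod.smul_snd, Prod.smul_snd, smul_eq_mul, smul_eq_mul,
        div_mul_eq_mul_div, div_mul_eq_mul_div, ← add_div, eq_div_iff hdet]
      ring

theorem spaceCoords_add (x y : ℂ × ℂ) : spaceCoords (x + y) = spaceCoords x + spaceCoords y := by
  ext i
  fin_cases i <;> simp [spaceCoords]

theorem spaceCoords_ofReal_smul (t : ℝ) (x : ℂ × ℂ) :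
    spaceCoords ((t : ℂ) • x) = t • spaceCoords x := by
  ext i
  fin_cases i <;> simp [spaceCoords]

theorem exists_spaceCoords_eq (y : Fin 4 → ℝ) : ∃ x, spaceCoords x = y := by
  refine ⟨(⟨y 0, y 1⟩, ⟨y 2, y 3⟩), ?_⟩
  ext i
  fin_cases i <;> rfl

theorem fderiv_eval_eq_zero_of_line {f : MvPolynomial (Fin 4) ℝ} {p d : ℂ × ℂ}
    (h : ∀ w : ℂ, eval (spaceCoords (p + w • d)) f = 0) (w : ℂ) :
    (∑ i, eval (spaceCoords p) (pderiv i f) •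
      (ContinuousLinearMap.proj i : (Fin 4 → ℝ) →L[ℝ] ℝ)) (spaceCoords (w • d)) = 0 := by
  have h1 : HasDerivAt (fun t : ℝ => spaceCoords p + t • spaceCoords (w • d))
      (spaceCoords (w • d)) 0 := by
    simpa using ((hasDerivAt_id (0 : ℝ)).smul_const (spaceCoords (w • d))).const_add
      (spaceCoords p)
  refine ((hasStrictFDerivAt_eval f (spaceCoords p)).hasFDerivAt.comp_hasDerivAt_of_eq (0 : ℝ) h1
    (by simp)).unique ?_
  convert hasDerivAt_const (0 : ℝ) (0 : ℝ) using 1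
  ext t
  have := h (t * w)
  rwa [mul_smul, spaceCoords_add, spaceCoords_ofReal_smul] at this

/-- A point on two complex lines contained in a real hypersurface is singular. -/
theorem pderiv_eq_zero_of_two_lines {f : MvPolynomial (Fin 4) ℝ} {l m : Set (ℂ × ℂ)}
    (hl : IsComplexLine l) (hm : IsComplexLine m) (hlm : l ≠ m) {p : ℂ × ℂ} (hpl : p ∈ l)
    (hpm : p ∈ m) (hfl : ∀ x ∈ l, eval (spaceCoords x) f = 0)
    (hfm : ∀ x ∈ m, eval (spaceCoords x) f = 0) (i : Fin 4) :
    eval (spaceCoords p) (pderiv i f) = 0 := by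
  have hbase : ∀ k : Set (ℂ × ℂ), IsComplexLine k → p ∈ k →
      ∃ d : ℂ × ℂ, d ≠ 0 ∧ k = Set.range fun w : ℂ => p + w • d := by
    rintro k ⟨q, d, hd, rfl⟩ ⟨v, rfl⟩
    refine ⟨d, hd, Set.ext fun x => ?_⟩
    constructor
    · rintro ⟨w, rfl⟩
      exact ⟨w - v, by module⟩
    · rintro ⟨w, rfl⟩
      exact ⟨v + w, by module⟩
  obtain ⟨d, hd, hl'⟩ := hbase l hl hpl
  obtain ⟨e, he, hm'⟩ := hbase m hm hpm
  rw [← fderiv_eval_single]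
  obtain ⟨u, hu⟩ := exists_spaceCoords_eq (Pi.single i 1)
  obtain ⟨v, w, rfl⟩ := exists_eq_smul_add_smul hd he hl' hm' hlm u
  rw [← hu, spaceCoords_add, map_add,
    fderiv_eval_eq_zero_of_line (fun w => hfl _ (hl' ▸ ⟨w, rfl⟩)) v,
    fderiv_eval_eq_zero_of_line (fun w => hfm _ (hm' ▸ ⟨w, rfl⟩)) w, add_zero]

/-- Incidences whose points lie on a real hypersurface of bounded degree. -/
theorem exists_incCount_le_of_hypersurface {ε : ℝ} (hε : 0 < ε) (n : ℕ) :
    ∃ C : ℝ, 0 ≤ C ∧ ∀ (P : Finset (ℂ × ℂ)) (L : Finset (Set (ℂ × ℂ))),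
      (∀ l ∈ L, IsComplexLine l) → ∀ f : MvPolynomial (Fin 4) ℝ, f ≠ 0 → f.totalDegree ≤ n →
      (∀ p ∈ P, eval (spaceCoords p) f = 0) →
      incCount (· ∈ ·) P L ≤ C * stBound ε #P #L := by
  classical
  have hconst : ∀ (P : Finset (ℂ × ℂ)) (f : MvPolynomial (Fin 4) ℝ), f ≠ 0 → f.totalDegree = 0 →
      (∀ p ∈ P, eval (spaceCoords p) f = 0) → P = ∅ := by
    intro P f hf hdeg hP
    refine Finset.eq_empty_of_forall_notMem fun p hp => hf ?_
    rw [totalDegree_eq_zero_iff_eq_C] at hdeg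
    have := hP p hp
    rw [hdeg, eval_C] at this
    rw [hdeg, this, C_0]
  induction n with
  | zero =>
    refine ⟨0, le_rfl, fun P L _ f hf hdeg hP => ?_⟩
    rw [hconst P f hf (Nat.le_zero.1 hdeg) hP]
    simp [incCount]
  | succ n ih =>
    obtain ⟨C, hC, ih⟩ := ih
    obtain ⟨C', hC', hcurve⟩ := exists_incCount_le_of_isCurveSystem
      (fun (p : ℂ × ℂ) (l : Set (ℂ × ℂ)) => p ∈ l) hε (n + 1)
    refine ⟨1 + C' + C, by positivity, fun P L hL f hf hdeg hP => ?_⟩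
    by_cases hdeg0 : f.totalDegree = 0
    · rw [hconst P f hf hdeg0 hP]
      have := stBound_nonneg (ε := ε) (le_refl 0) (Nat.cast_nonneg (α := ℝ) #L)
      simp only [incCount, empty_product, filter_empty, card_empty, Nat.cast_zero]
      positivity
    obtain ⟨i, hi⟩ := exists_pderiv_ne_zero hdeg0
    set P₁ := {p ∈ P | eval (spaceCoords p) (pderiv i f) ≠ 0} with hP₁
    set P₂ := {p ∈ P | ¬ eval (spaceCoords p) (pderiv i f) ≠ 0} with hP₂
    set L₁ := {l ∈ L | ∃ x ∈ l, eval (spaceCoords x) f ≠ 0} with hL₁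
    set L₂ := {l ∈ L | ¬ ∃ x ∈ l, eval (spaceCoords x) f ≠ 0} with hL₂
    have hmono : ∀ {Q : Finset (ℂ × ℂ)} {M : Finset (Set (ℂ × ℂ))}, Q ⊆ P → M ⊆ L →
        stBound ε #Q #M ≤ stBound ε #P #L := fun hQ hM =>
      stBound_mono hε (Nat.cast_nonneg _) (Nat.cast_nonneg _) (Nat.cast_le.2 (card_le_card hQ))
        (Nat.cast_le.2 (card_le_card hM))
    have h1 : (incCount (· ∈ ·) P L₁ : ℝ) ≤ C' * stBound ε #P #L :=
      (hcurve _ _ (isCurveSystem_of_not_subset (fun l hl => hL l (mem_filter.1 hl).1) hdeg hP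
        fun l hl => (mem_filter.1 hl).2)).trans
        (mul_le_mul_of_nonneg_left (hmono subset_rfl (filter_subset _ _)) hC')
    have h2 : (incCount (· ∈ ·) P₂ L : ℝ) ≤ C * stBound ε #P #L := by
      refine (ih P₂ L hL (pderiv i f) hi ?_ ?_).trans
        (mul_le_mul_of_nonneg_left (hmono (filter_subset _ _) subset_rfl) hC)
      · have := totalDegree_pderiv_le i f
        omega
      · intro p hp
        simpa using (mem_filter.1 hp).2
    have h3 : (incCount (· ∈ ·) P₁ L₂ : ℝ) ≤ stBound ε #P #L := by
      have h4 : incCount (· ∈ ·) P₁ L₂ ≤ #P₁ * 1 := by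
        rw [incCount_eq_sum_left]
        refine sum_le_card_nsmul _ _ _ fun p hp => card_le_one.2 fun l hl m hm => ?_
        by_contra hlm
        obtain ⟨hl, hpl⟩ := mem_filter.1 hl
        obtain ⟨hm, hpm⟩ := mem_filter.1 hm
        obtain ⟨hl, hfl⟩ := mem_filter.1 hl
        obtain ⟨hm, hfm⟩ := mem_filter.1 hm
        push Not at hfl hfm
        exact (mem_filter.1 hp).2
          (pderiv_eq_zero_of_two_lines (hL l hl) (hL m hm) hlm hpl hpm hfl hfm i)
      have h5 : (incCount (· ∈ ·) P₁ L₂ : ℝ) ≤ #P := by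
        exact_mod_cast h4.trans ((mul_one _).le.trans (card_le_card (filter_subset _ _)))
      have h6 : (0 : ℝ) ≤ (#P : ℝ) ^ ((2 : ℝ) / 3 + ε) * (#L : ℝ) ^ ((2 : ℝ) / 3 + ε) := by
        positivity
      have h7 : (0 : ℝ) ≤ #L := Nat.cast_nonneg _
      unfold stBound
      linarith
    have h4 : incCount (· ∈ ·) P L ≤
        incCount (· ∈ ·) P₁ L₂ + incCount (· ∈ ·) P L₁ + incCount (· ∈ ·) P₂ L := by
      have hPP : P ⊆ P₁ ∪ P₂ := by rw [hP₁, hP₂, filter_union_filter_not_eq]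
      have hLL : L ⊆ L₁ ∪ L₂ := by rw [hL₁, hL₂, filter_union_filter_not_eq]
      have h5 := (incCount_mono (· ∈ ·) hPP (subset_refl L)).trans
        (incCount_union_left_le _ _ _ _)
      have h6 := (incCount_mono (· ∈ ·) (subset_refl P₁) hLL).trans
        (incCount_union_right_le _ _ _ _)
      have h7 := incCount_mono (· ∈ ·) (P := P₁) (filter_subset _ _) (subset_refl L₁)
      omega
    have h5 : (incCount (· ∈ ·) P L : ℝ) ≤ incCount (· ∈ ·) P₁ L₂ +
        incCount (· ∈ ·) P L₁ + incCount (· ∈ ·) P₂ L := by exact_mod_cast h4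
    linarith

/-- The Szemerédi–Trotter bound, with exponent loss, for complex lines. -/
theorem exists_incCount_le_of_isComplexLine {ε : ℝ} (hε : 0 < ε) :
    ∃ C : ℝ, 0 ≤ C ∧ ∀ (P : Finset (ℂ × ℂ)) (L : Finset (Set (ℂ × ℂ))),
      (∀ l ∈ L, IsComplexLine l) → incCount (· ∈ ·) P L ≤ C * stBound ε #P #L := by
  classical
  obtain ⟨K, -, hK⟩ := exists_partition (Fin 4)
  refine exists_incCount_le (κ := List SignType) (G := fun _ L => ∀ l ∈ L, IsComplexLine l)
    (fun P L P' L' h _ hL l hl => h l (hL hl))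
    (fun P L h => linearIncidence_of_isComplexLine P h) hε four_ne_zero
    (A := 4 * ((K + 3 : ℕ) : ℝ) ^ 4) (by positivity) fun i => ?_
  obtain ⟨C, hC, hsurf⟩ := exists_incCount_le_of_hypersurface hε (K * 2 ^ i)
  refine ⟨2 * (K * 2 ^ i + 3) ^ 2, C, ?_, fun P L hL => ?_⟩
  · have h1 : K * 2 ^ i + 3 ≤ (K + 3) * 2 ^ i := by
      have : 1 ≤ 2 ^ i := Nat.one_le_two_pow
      nlinarith
    have h2 : ((K * 2 ^ i + 3 : ℕ) : ℝ) ≤ (K + 3 : ℕ) * 2 ^ i := by exact_mod_cast h1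
    calc (((2 * (K * 2 ^ i + 3) ^ 2 : ℕ) : ℝ)) ^ 2 = 4 * ((K * 2 ^ i + 3 : ℕ) : ℝ) ^ 4 := by
          push_cast; ring
      _ ≤ 4 * (((K + 3 : ℕ) : ℝ) * 2 ^ i) ^ 4 := by gcongr
      _ = _ := by ring
  · obtain ⟨gs, hgs0, hdeg, hcard⟩ := hK i (ℂ × ℂ) P spaceCoords
    have hdeg' := (totalDegree_list_prod gs).trans hdeg
    have hdec : ∃ D : CellDecomposition (List SignType) (· ∈ ·) P L ((2 ^ i) ^ 4)
        (2 * (K * 2 ^ i + 3) ^ 2), ∀ p ∈ D.boundary, eval (spaceCoords p) gs.prod = 0 := by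
      refine exists_cellDecomposition spaceCoords gs (by simpa using hcard) ?_
      intro l hl S _ hSl hSgs hSinj
      obtain ⟨q, d, -, rfl⟩ := hL l hl
      choose! w hw using hSl
      have hinj : Set.InjOn (fun p => planeCoords (w p)) (S : Finset (ℂ × ℂ)) := by
        intro p hp p' hp' h
        rw [← hw p hp, ← hw p' hp', planeCoords_injective h]
      have heval : ∀ p ∈ S, ∀ g, eval (planeCoords (w p)) (lineRestrict q d g) =
          eval (spaceCoords p) g := by
        intro p hp g
        rw [eval_lineRestrict]
        exact congrArg (fun x => eval (spaceCoords x) g) (hw p hp)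
      rw [← card_image_of_injOn hinj]
      refine (card_signs_on_plane (gs.map (lineRestrict q d)) ?_ ?_).trans ?_
      · simp only [mem_image, forall_exists_index, and_imp, forall_apply_eq_imp_iff₂,
          List.mem_map]
        intro p hp g hg
        rw [heval p hp]
        exact hSgs p hp g hg
      · simp only [mem_image, forall_exists_index, and_imp, forall_apply_eq_imp_iff₂,
          List.mem_map]
        intro p hp p' hp' h
        have := hSinj p hp p' hp' fun g hg => by
          simpa only [heval p hp, heval p' hp'] using h g hg
        rw [this]
      · have h1 : (gs.map (lineRestrict q d)).prod.totalDegree ≤ K * 2 ^ i := by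
          rw [← map_list_prod]
          exact (totalDegree_lineRestrict_le _ _ _).trans hdeg'
        gcongr
    obtain ⟨D, hD⟩ := hdec
    refine ⟨D, (hsurf D.boundary L hL gs.prod (List.prod_ne_zero fun h => hgs0 0 h rfl) hdeg'
      hD).trans (mul_le_mul_of_nonneg_left ?_ hC)⟩
    exact stBound_mono hε (Nat.cast_nonneg _) (Nat.cast_nonneg _)
      (Nat.cast_le.2 (card_le_card D.boundary_subset)) le_rfl

end Incidences

end SzemerediTrotter

/-- **Complex Szemerédi–Trotter theorem.**  Lines in `ℂ²` are sets of the form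
`{z | a z₁ + b z₂ + c = 0}` with `(a,b) ≠ (0,0)`. -/
theorem stmt_2 (ε : ℝ) (hε : 0 < ε) :
    ∃ C : ℝ, 0 < C ∧
      ∀ (P : Finset (ℂ × ℂ)) (L : Finset (Set (ℂ × ℂ))),
        (∀ ℓ ∈ L, ∃ a b c : ℂ, (a, b) ≠ ((0 : ℂ), (0 : ℂ)) ∧
          ℓ = {z : ℂ × ℂ | a * z.1 + b * z.2 + c = 0}) →
        (Set.ncard {q : (ℂ × ℂ) × Set (ℂ × ℂ) | q.1 ∈ P ∧ q.2 ∈ L ∧ q.1 ∈ q.2} : ℝ) ≤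
          C * ((P.card : ℝ) ^ ((2 : ℝ) / 3 + ε) * (L.card : ℝ) ^ ((2 : ℝ) / 3 + ε)
            + (P.card : ℝ) + (L.card : ℝ)) := by
  classical
  obtain ⟨C, hC, h⟩ := exists_incCount_le_of_isComplexLine hε
  refine ⟨C + 1, by positivity, fun P L hL => ?_⟩
  have hcard : Set.ncard {q : (ℂ × ℂ) × Set (ℂ × ℂ) | q.1 ∈ P ∧ q.2 ∈ L ∧ q.1 ∈ q.2} =
      incCount (· ∈ ·) P L := by
    rw [incCount, ← Set.ncard_coe_finset]
    congr 1
    ext q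
    simp [and_assoc]
  have hline : ∀ l ∈ L, IsComplexLine l := by
    intro l hl
    obtain ⟨a, b, c, hab, rfl⟩ := hL l hl
    exact isComplexLine_setOf hab
  rw [hcard]
  exact (h P L hline).trans (mul_le_mul_of_nonneg_right (by linarith)
    (stBound_nonneg (Nat.cast_nonneg _) (Nat.cast_nonneg _)))
end

section
/- Let p_1,…,p_m ∈ ℂ[x_1,…,x_n] be polynomials in n variables, each of degree at most d. Then the number of isolated points of the affine variety V(p_1,…,p_m) = {x ∈ ℂ^n : p_1(x)=…=p_m(x)=0} is at most d^n. Equivalently, if V(p_1,…,p_m) = V_0 ∪ V_1 where V_0 is a pure zero-dimensional variety (a finite set of isolated points) and V_1 is either empty or a positive dimensional variety, then |V_0| ≤ d^n. -/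
open MvPolynomial in
theorem MvPolynomial.height_eq_add_of_isMaximal {R : Type*} [CommRing R] [IsNoetherianRing R]
    [IsJacobsonRing R] {h : ℕ∞} (hR : ∀ N : Ideal R, N.IsMaximal → N.height = h) (n : ℕ)
    (M : Ideal (MvPolynomial (Fin n) R)) (hM : M.IsMaximal) : M.height = h + n := by
  induction n with
  | zero =>
    let e := (isEmptyAlgEquiv R (Fin 0)).symm.toRingEquiv
    have := hR (M.comap e) (Ideal.comap_isMaximal_of_equiv e)
    rw [e.height_comap] at this
    simpa using this
  | succ n ih =>
    let e := (finSuccEquiv R n).symm.toRingEquiv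
    have hP : (M.comap e).IsMaximal := Ideal.comap_isMaximal_of_equiv e
    rw [← e.height_comap]
    generalize M.comap e = P at hP
    rw [Polynomial.height_eq_height_add_one (P.under _) P,
      ih (P.under _) (Polynomial.isMaximal_comap_C_of_isJacobsonRing P)]
    push_cast
    rw [add_assoc]

/-- Maximal ideals of `k[x₁, …, xₙ]` have height `n`. -/
theorem MvPolynomial.height_of_isMaximal {k : Type*} [Field k] (n : ℕ)
    (M : Ideal (MvPolynomial (Fin n) k)) (hM : M.IsMaximal) : M.height = n := by
  have := MvPolynomial.height_eq_add_of_isMaximal (R := k) (h := 0)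
    (fun N hN ↦ by rw [(Ideal.eq_bot_or_top N).resolve_right hN.ne_top, Ideal.height_bot]) n M hM
  simpa using this

/-- Maximal ideals of `k[t][x₁, …, xₙ]` have height `n + 1`. -/
theorem MvPolynomial.height_of_isMaximal_of_polynomial {k : Type*} [Field k] (n : ℕ)
    (M : Ideal (MvPolynomial (Fin n) (Polynomial k))) (hM : M.IsMaximal) : M.height = n + 1 := by
  rw [MvPolynomial.height_eq_add_of_isMaximal (h := 1) (fun N hN ↦
    IsPrincipalIdealRing.height_eq_one_of_isMaximal N (Polynomial.not_isField k)) n M hM, add_comm]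

/-- A subspace of an algebra over an infinite field contains an element avoiding any
finite set of ideals that do not contain the subspace. -/
theorem Submodule.exists_mem_forall_notMem_of_not_le {k B : Type*} [Field k] [Infinite k]
    [CommRing B] [Algebra k B] (W : Submodule k B) (T : Set (Ideal B)) (hT : T.Finite)
    (hW : ∀ Q ∈ T, ¬ W ≤ Q.restrictScalars k) : ∃ f ∈ W, ∀ Q ∈ T, f ∉ Q := by
  by_contra! hcon
  have := hT.to_subtype
  obtain ⟨Q, hQ⟩ := Subspace.exists_eq_top_of_iUnion_eq_univ (k := k)
    (p := fun Q : T ↦ ((Q : Ideal B).restrictScalars k).comap W.subtype) (by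
      ext f
      obtain ⟨Q, hQ, hf⟩ := hcon f f.2
      simpa using ⟨Q, hQ, hf⟩)
  refine hW Q Q.2 fun f hf ↦ ?_
  have : (⟨f, hf⟩ : W) ∈ ((Q : Ideal B).restrictScalars k).comap W.subtype := hQ ▸ Submodule.mem_top
  simpa using this

/-- General elements of a subspace `W` cut out an ideal whose minimal primes
either contain `W` or have the expected height. -/
theorem Submodule.exists_forall_minimalPrimes_le_or_le_height {k B : Type*} [Field k] [Infinite k]
    [CommRing B] [IsNoetherianRing B] [Algebra k B] (W : Submodule k B) (r : ℕ) :
    ∃ f : Fin r → B, (∀ i, f i ∈ W) ∧ ∀ Q ∈ (Ideal.span (Set.range f)).minimalPrimes,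
      W ≤ Q.restrictScalars k ∨ (r : ℕ∞) ≤ Q.height := by
  induction r with
  | zero => exact ⟨Fin.elim0, fun i ↦ i.elim0, fun Q _ ↦ Or.inr (by simp)⟩
  | succ r ih =>
    obtain ⟨f, hfW, hf⟩ := ih
    obtain ⟨g, hgW, hg⟩ := W.exists_mem_forall_notMem_of_not_le
      {Q ∈ (Ideal.span (Set.range f)).minimalPrimes | ¬ W ≤ Q.restrictScalars k}
      ((Ideal.finite_minimalPrimes_of_isNoetherianRing B _).subset fun _ h ↦ h.1) fun _ h ↦ h.2
    refine ⟨Fin.cons g f, Fin.cases hgW hfW, fun Q hQ ↦ or_iff_not_imp_left.2 fun hWQ ↦ ?_⟩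
    rw [Fin.range_cons] at hQ
    have hQp : Q.IsPrime := hQ.1.1
    have hle : Ideal.span (Set.range f) ≤ Q :=
      (Ideal.span_mono (Set.subset_insert _ _)).trans hQ.1.2
    obtain ⟨Q', hQ', hQQ⟩ := Ideal.exists_minimalPrimes_le hle
    have hQ'p : Q'.IsPrime := hQ'.1.1
    have hWQ' : ¬ W ≤ Q'.restrictScalars k := fun h ↦ hWQ fun x hx ↦ hQQ (h hx)
    have hgQ : g ∈ Q := hQ.1.2 (Ideal.subset_span (Set.mem_insert _ _))
    have hlt : Q' < Q := lt_of_le_of_ne hQQ fun h ↦ hg Q' ⟨hQ', hWQ'⟩ (h ▸ hgQ)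
    have h1 := (hf Q' hQ').resolve_left hWQ'
    have h2 := Ideal.height_strict_mono_of_isPrime_of_isPrime hlt
    push_cast
    exact (add_le_add_left h1 1).trans (Order.add_one_le_of_lt h2)

namespace BezoutDeformation

open MvPolynomial

variable {n : ℕ}

/-- The one-parameter deformation `f i + t * X i ^ d`, with `t` the variable of `ℂ[t]`. -/
noncomputable def deform (d : ℕ) (f : Fin n → MvPolynomial (Fin n) ℂ) (i : Fin n) :
    MvPolynomial (Fin n) (Polynomial ℂ) :=
  map Polynomial.C (f i) + C Polynomial.X * X i ^ d

/-- Evaluation at the point `(a, 0)`. -/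
noncomputable def evalZero (a : Fin n → ℂ) : MvPolynomial (Fin n) (Polynomial ℂ) →+* ℂ :=
  eval₂Hom (Polynomial.evalRingHom 0) a

theorem evalZero_C (a : Fin n → ℂ) (h : Polynomial ℂ) : evalZero a (C h) = h.eval 0 := by
  simp [evalZero]

theorem evalZero_map (a : Fin n → ℂ) (g : MvPolynomial (Fin n) ℂ) :
    evalZero a (map Polynomial.C g) = eval a g := by
  have : (evalZero a).comp (map Polynomial.C) = (eval a : MvPolynomial (Fin n) ℂ →+* ℂ) := by
    ext <;> simp [evalZero]
  exact congrArg (fun φ ↦ φ g) this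

theorem evalZero_deform (d : ℕ) (f : Fin n → MvPolynomial (Fin n) ℂ) (a : Fin n → ℂ) (i : Fin n) :
    evalZero a (deform d f i) = eval a (f i) := by
  simp [deform, evalZero_map, evalZero_C]

theorem sub_map_mem {Q : Ideal (MvPolynomial (Fin n) (Polynomial ℂ))}
    (hX : C Polynomial.X ∈ Q) (g : MvPolynomial (Fin n) (Polynomial ℂ)) :
    g - map Polynomial.C (map (Polynomial.evalRingHom 0) g) ∈ Q := by
  have : Ideal.Quotient.mk Q = ((Ideal.Quotient.mk Q).comp (map Polynomial.C)).comp
      (map (Polynomial.evalRingHom 0)) := by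
    refine MvPolynomial.ringHom_ext' (Polynomial.ringHom_ext (fun z ↦ ?_) ?_) fun i ↦ ?_
    · simp
    · simpa using Ideal.Quotient.eq_zero_iff_mem.2 hX
    · simp
  rw [← Ideal.Quotient.eq]
  exact congrArg (fun φ ↦ φ g) this

/-- If `a` is an isolated point of the zero locus of `f`, then elements that are torsion over `ℂ[t]`
modulo the deformed system vanish at `(a, 0)`. -/
theorem evalZero_eq_zero_of_C_mul_mem (d : ℕ) (f : Fin n → MvPolynomial (Fin n) ℂ) (a : Fin n → ℂ)
    (hfa : ∀ i, eval a (f i) = 0)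
    (hmin : ∀ P : Ideal (MvPolynomial (Fin n) ℂ), P.IsPrime → (∀ i, f i ∈ P) →
      P ≤ vanishingIdeal ℂ {a} → P = vanishingIdeal ℂ {a})
    {h : Polynomial ℂ} (hh : h ≠ 0) {g : MvPolynomial (Fin n) (Polynomial ℂ)}
    (hg : C h * g ∈ Ideal.span (Set.range (deform d f))) : evalZero a g = 0 := by
  have hsurj : Function.Surjective (evalZero a) := fun z ↦
    ⟨C (Polynomial.C z), by simp [evalZero_C]⟩
  have hmax : (RingHom.ker (evalZero a)).IsMaximal := RingHom.ker_isMaximal_of_surjective _ hsurj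
  have hle : Ideal.span (Set.range (deform d f)) ≤ RingHom.ker (evalZero a) := by
    rw [Ideal.span_le]
    rintro _ ⟨i, rfl⟩
    simp [RingHom.mem_ker, evalZero_deform, hfa]
  obtain ⟨Q, hQ, hQm⟩ := Ideal.exists_minimalPrimes_le hle
  have hQp : Q.IsPrime := hQ.1.1
  by_contra hga
  have hhQ : C h ∈ Q := (hQp.mem_or_mem (hQ.1.2 hg)).resolve_right fun H ↦ hga (hQm H)
  have hcm : (Q.comap C).IsMaximal := by
    refine IsPrime.to_maximal_ideal (S := Q.comap C) fun H ↦ hh ?_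
    have : h ∈ Q.comap C := hhQ
    simpa [H] using this
  have hceq : Q.comap C = (RingHom.ker (evalZero a)).comap C :=
    hcm.eq_of_le (Ideal.comap_ne_top _ hmax.ne_top) (Ideal.comap_mono hQm)
  have hX : C Polynomial.X ∈ Q := by
    have : Polynomial.X ∈ (RingHom.ker (evalZero a)).comap C := by
      simp [RingHom.mem_ker, evalZero_C]
    rwa [← hceq] at this
  have hP : Q.comap (map Polynomial.C) = vanishingIdeal ℂ {a} := by
    refine hmin _ inferInstance (fun i ↦ ?_) fun g hg ↦ ?_
    · have : deform d f i ∈ Q := hQ.1.2 (Ideal.subset_span ⟨i, rfl⟩)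
      exact (Ideal.add_mem_iff_left _ (Ideal.mul_mem_right _ _ hX)).1 this
    · have := hQm hg
      rw [RingHom.mem_ker, evalZero_map] at this
      rw [mem_vanishingIdeal_singleton_iff]
      simpa [aeval_eq_eval] using this
  have hmQ : RingHom.ker (evalZero a) ≤ Q := fun g hg ↦ by
    have hg0 := sub_map_mem hX g
    have h1 := hQm hg0
    rw [RingHom.mem_ker, map_sub, hg, zero_sub, neg_eq_zero, evalZero_map] at h1
    have h2 : map (Polynomial.evalRingHom 0) g ∈ Q.comap (map Polynomial.C) := by
      rw [hP, mem_vanishingIdeal_singleton_iff]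
      simpa [aeval_eq_eval] using h1
    exact sub_add_cancel g _ ▸ Q.add_mem hg0 h2
  have hQeq : Q = RingHom.ker (evalZero a) := le_antisymm hQm hmQ
  have h1 := height_of_isMaximal_of_polynomial n _ hmax
  have h2 := Ideal.height_le_card_of_mem_minimalPrimes_span (Set.finite_range _) hQ
  rw [hQeq, h1] at h2
  have h3 : (Set.range (deform d f)).ncard ≤ n := by
    rw [← Set.image_univ]
    exact (Set.ncard_image_le Set.finite_univ).trans (by simp)
  have h4 : ((n + 1 : ℕ) : ℕ∞) ≤ (n : ℕ) := by
    push_cast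
    exact h2.trans (by exact_mod_cast h3)
  have := Nat.cast_le.1 h4
  omega

/-- The `ℂ[t]`-span of the monomials all of whose exponents are less than `d`. -/
noncomputable def reducedSpan (n d : ℕ) :
    Submodule (Polynomial ℂ) (MvPolynomial (Fin n) (Polynomial ℂ)) :=
  Submodule.span _ (Set.range fun β : Fin n → Fin d ↦
    monomial (Finsupp.equivFunOnFinite.symm fun i ↦ (β i : ℕ)) 1)

/-- Polynomials of bounded degree reduce, modulo the deformed system and after multiplication by a
common nonzero polynomial in `t`, to combinations of the reduced monomials. -/
theorem exists_C_mul_map_mem (d : ℕ) (f : Fin n → MvPolynomial (Fin n) ℂ)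
    (hf : ∀ i, (f i).totalDegree ≤ d) (D : ℕ) :
    ∃ h : Polynomial ℂ, h ≠ 0 ∧ ∀ g : MvPolynomial (Fin n) ℂ, g.totalDegree ≤ D →
      h • map Polynomial.C g ∈
        (Ideal.span (Set.range (deform d f))).restrictScalars (Polynomial ℂ) ⊔ reducedSpan n d := by
  set N := (Ideal.span (Set.range (deform d f))).restrictScalars (Polynomial ℂ) ⊔ reducedSpan n d
  let φ : MvPolynomial (Fin n) ℂ →ₗ[ℂ] (MvPolynomial (Fin n) (Polynomial ℂ) ⧸ N) :=
    (N.mkQ.restrictScalars ℂ).comp (mapAlgHom (Algebra.ofId ℂ (Polynomial ℂ))).toLinearMap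
  have hφ (g) : φ g = N.mkQ (map Polynomial.C g) := rfl
  set U := (restrictTotalDegree (Fin n) ℂ D).map φ
  have hXU : ∀ u ∈ U, (Polynomial.X : Polynomial ℂ) • u ∈ U := by
    rintro _ ⟨g, hg, rfl⟩
    rw [SetLike.mem_coe, mem_restrictTotalDegree] at hg
    rw [g.as_sum, map_sum, Finset.smul_sum]
    refine Submodule.sum_mem _ fun α hα ↦ ?_
    have hαD : α.degree ≤ D := (le_totalDegree hα).trans hg
    by_cases hred : ∀ i, α i < d
    · have : φ (monomial α (coeff α g)) = 0 := by
        rw [hφ, map_monomial, Submodule.mkQ_apply, Submodule.Quotient.mk_eq_zero]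
        refine Submodule.mem_sup_right ?_
        have hmon : (monomial α (Polynomial.C (coeff α g)) : MvPolynomial (Fin n) (Polynomial ℂ)) =
          Polynomial.C (coeff α g) • monomial α 1 := by simp [smul_monomial]
        rw [hmon]
        refine Submodule.smul_mem _ _ (Submodule.subset_span ⟨fun i ↦ ⟨α i, hred i⟩, ?_⟩)
        ext i
        simp
      simp [this]
    · push Not at hred
      obtain ⟨i, hi⟩ := hred
      obtain ⟨γ, rfl⟩ : ∃ γ, α = Finsupp.single i d + γ :=
        exists_add_of_le (Finsupp.single_le_iff.2 hi)
      set c := coeff (Finsupp.single i d + γ) g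
      have key : (Polynomial.X : Polynomial ℂ) • φ (monomial (Finsupp.single i d + γ) c) =
          φ (-(f i * monomial γ c)) := by
        rw [hφ, hφ, ← map_smul, ← sub_eq_zero, ← map_sub, Submodule.mkQ_apply,
          Submodule.Quotient.mk_eq_zero]
        refine Submodule.mem_sup_left ?_
        have : (Polynomial.X : Polynomial ℂ) • map Polynomial.C
            (monomial (Finsupp.single i d + γ) c) - map Polynomial.C (-(f i * monomial γ c)) =
            deform d f i * monomial γ (Polynomial.C c) := by
          have : (monomial (Finsupp.single i d + γ) c : MvPolynomial (Fin n) ℂ) =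
            X i ^ d * monomial γ c := by
            rw [X_pow_eq_monomial, monomial_mul, one_mul]
          rw [this, deform, smul_eq_C_mul]
          simp only [map_mul, map_neg, map_pow, map_X, map_monomial]
          ring
        rw [this]
        exact Ideal.mul_mem_right _ _ (Ideal.subset_span ⟨i, rfl⟩)
      rw [key]
      refine Submodule.mem_map_of_mem ?_
      rw [mem_restrictTotalDegree, totalDegree_neg]
      refine (totalDegree_mul _ _).trans ((Nat.add_le_add (hf i)
        (totalDegree_monomial_le _ _)).trans ?_)
      rw [map_add, Finsupp.degree_single] at hαD
      exact hαD
  have hpU : ∀ p : Polynomial ℂ, ∀ u ∈ U, p • u ∈ U := by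
    intro p u hu
    induction p using Polynomial.induction_on with
    | C z => rw [← Polynomial.algebraMap_eq, algebraMap_smul]; exact U.smul_mem z hu
    | add p q hp hq => rw [add_smul]; exact U.add_mem hp hq
    | monomial k z hk =>
      rw [pow_succ', mul_left_comm, mul_smul]
      exact hXU _ hk
  let ψ : Polynomial ℂ →ₗ[ℂ] (U →ₗ[ℂ] U) :=
    { toFun := fun p ↦
        { toFun := fun u ↦ ⟨p • (u : _), hpU p u u.2⟩
          map_add' := fun u v ↦ by ext; simp
          map_smul' := fun z u ↦ by ext; simp [smul_comm p z] }
      map_add' := fun p q ↦ by ext; simp [add_smul]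
      map_smul' := fun z p ↦ by ext; simp }
  have hnot : ¬ Function.Injective ψ := fun hinj ↦
    Polynomial.not_finite (R := ℂ) (Module.Finite.of_injective ψ hinj)
  rw [injective_iff_map_eq_zero] at hnot
  push Not at hnot
  obtain ⟨h, hker, hh⟩ := hnot
  refine ⟨h, hh, fun g hg ↦ ?_⟩
  have hgU : φ g ∈ U := Submodule.mem_map_of_mem ((mem_restrictTotalDegree _ _ _).2 hg)
  have := congrArg Subtype.val (LinearMap.congr_fun hker ⟨φ g, hgU⟩)
  have h2 : h • φ g = 0 := this
  rwa [hφ, ← map_smul, Submodule.mkQ_apply, Submodule.Quotient.mk_eq_zero] at h2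

end BezoutDeformation

open MvPolynomial in
theorem MvPolynomial.exists_eval_eq_one_and_forall_eval_eq_zero {σ k : Type*} [Field k]
    (S : Finset (σ → k)) (a : σ → k) :
    ∃ g : MvPolynomial σ k, eval a g = 1 ∧ ∀ b ∈ S, b ≠ a → eval b g = 0 := by
  classical
  have (b : σ → k) : ∃ g : MvPolynomial σ k, eval a g = 1 ∧ (b ≠ a → eval b g = 0) := by
    by_cases hb : b = a
    · exact ⟨1, by simp [hb]⟩
    · obtain ⟨i, hi⟩ := Function.ne_iff.1 hb
      refine ⟨C (a i - b i)⁻¹ * (X i - C (b i)), ?_, fun _ ↦ by simp⟩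
      simpa using inv_mul_cancel₀ (sub_ne_zero.2 hi.symm)
  choose g hg1 hg0 using this
  refine ⟨∏ b ∈ S, g b, ?_, fun b hb hba ↦ ?_⟩
  · simp [hg1]
  · rw [map_prod]
    exact Finset.prod_eq_zero hb (hg0 b hba)

theorem Polynomial.eq_zero_of_forall_X_pow_dvd {R : Type*} [Semiring R] {p : Polynomial R}
    (h : ∀ k : ℕ, Polynomial.X ^ k ∣ p) : p = 0 := by
  ext k
  exact Polynomial.X_pow_dvd_iff.1 (h (k + 1)) k k.lt_succ_self

/-- A family in a torsion-free `R[X]`-module is linearly independent as soon as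
the coefficients of every linear relation are divisible by `X`. -/
theorem Polynomial.linearIndependent_of_forall_X_dvd {R M ι : Type*} [CommRing R] [IsDomain R]
    [AddCommGroup M] [Module (Polynomial R) M] [Module.IsTorsionFree (Polynomial R) M] [Fintype ι]
    (v : ι → M) (h : ∀ b : ι → Polynomial R, ∑ i, b i • v i = 0 → ∀ i, Polynomial.X ∣ b i) :
    LinearIndependent (Polynomial R) v := by
  rw [Fintype.linearIndependent_iff]
  have key (k : ℕ) : ∀ b : ι → Polynomial R, ∑ i, b i • v i = 0 →
      ∀ i, Polynomial.X ^ k ∣ b i := by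
    induction k with
    | zero => simp
    | succ k ih =>
      intro b hb i
      choose c hc using h b hb
      have hc0 : ∑ i, c i • v i = 0 := by
        simp only [hc, mul_smul, ← Finset.smul_sum] at hb
        exact (smul_eq_zero.1 hb).resolve_left Polynomial.X_ne_zero
      rw [hc i, pow_succ']
      exact mul_dvd_mul_left _ (ih c hc0 i)
  exact fun b hb i ↦ Polynomial.eq_zero_of_forall_X_pow_dvd fun k ↦ key k b hb i

namespace BezoutDeformation

open MvPolynomial

/-- Bézout inequality for square systems. -/
theorem card_le_pow {n : ℕ} (d : ℕ) (f : Fin n → MvPolynomial (Fin n) ℂ)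
    (hf : ∀ i, (f i).totalDegree ≤ d) (S : Finset (Fin n → ℂ))
    (hS : ∀ a ∈ S, ∀ i, eval a (f i) = 0)
    (hmin : ∀ a ∈ S, ∀ P : Ideal (MvPolynomial (Fin n) ℂ), P.IsPrime → (∀ i, f i ∈ P) →
      P ≤ vanishingIdeal ℂ {a} → P = vanishingIdeal ℂ {a}) : S.card ≤ d ^ n := by
  choose g hg1 hg0 using exists_eval_eq_one_and_forall_eval_eq_zero S
  obtain ⟨h, hh, hmem⟩ := exists_C_mul_map_mem d f hf (S.sup fun a ↦ (g a).totalDegree)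
  have hred (a : S) : ∃ c : (Fin n → Fin d) → Polynomial ℂ,
      h • map Polynomial.C (g a) - ∑ β, c β •
        (monomial (Finsupp.equivFunOnFinite.symm fun i ↦ (β i : ℕ)) 1 :
          MvPolynomial (Fin n) (Polynomial ℂ)) ∈ Ideal.span (Set.range (deform d f)) := by
    obtain ⟨y, hy, z, hz, hyz⟩ := Submodule.mem_sup.1
      (hmem (g a) (Finset.le_sup (f := fun a ↦ (g a).totalDegree) a.2))
    obtain ⟨c, rfl⟩ := (Submodule.mem_span_range_iff_exists_fun _).1 hz
    exact ⟨c, by rw [← hyz, add_sub_cancel_right]; exact hy⟩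
  choose c hc using hred
  have hli : LinearIndependent (Polynomial ℂ) c := by
    refine Polynomial.linearIndependent_of_forall_X_dvd c fun b hb a ↦ ?_
    have h1 : ∑ a, C (b a) * (h • map Polynomial.C (g a) - ∑ β, c a β •
        (monomial (Finsupp.equivFunOnFinite.symm fun i ↦ (β i : ℕ)) 1 :
          MvPolynomial (Fin n) (Polynomial ℂ))) ∈ Ideal.span (Set.range (deform d f)) :=
      Ideal.sum_mem _ fun a _ ↦ Ideal.mul_mem_left _ _ (hc a)
    have h2 : ∑ a, C (b a) * (h • map Polynomial.C (g a) - ∑ β, c a β •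
        (monomial (Finsupp.equivFunOnFinite.symm fun i ↦ (β i : ℕ)) 1 :
          MvPolynomial (Fin n) (Polynomial ℂ))) = C h * ∑ a, C (b a) * map Polynomial.C (g a) := by
      simp only [mul_sub, Finset.sum_sub_distrib, Finset.mul_sum]
      have : ∑ a, ∑ β, C (b a) * (c a β •
        (monomial (Finsupp.equivFunOnFinite.symm fun i ↦ (β i : ℕ)) 1 :
          MvPolynomial (Fin n) (Polynomial ℂ))) = 0 := by
        rw [Finset.sum_comm]
        refine Finset.sum_eq_zero fun β _ ↦ ?_
        have := congrFun hb β
        simp only [Finset.sum_apply, Pi.smul_apply, smul_eq_mul, Pi.zero_apply] at this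
        simp only [← smul_eq_C_mul, smul_smul, ← Finset.sum_smul, this, zero_smul]
      rw [this, sub_zero]
      refine Finset.sum_congr rfl fun a _ ↦ ?_
      rw [smul_eq_C_mul]
      ring
    rw [h2] at h1
    have h3 := evalZero_eq_zero_of_C_mul_mem d f a (hS a a.2) (hmin a a.2) hh h1
    rw [map_sum, Finset.sum_eq_single a] at h3
    · simpa [evalZero_C, evalZero_map, hg1, Polynomial.X_dvd_iff,
        Polynomial.coeff_zero_eq_eval_zero] using h3
    · intro a' _ ha'
      simp [evalZero_map, hg0 a' a a.2 fun h ↦ ha' (Subtype.ext h.symm)]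
    · simp
  simpa using hli.fintype_card_le_finrank

end BezoutDeformation

/-- A root `z` of the specialized minimal polynomial of `x` is realized by a maximal ideal of `B`
whose residue map restricts to `φ` and sends `x` to `z`. -/
theorem minpoly.exists_isMaximal_aeval_mem_iff {R B K : Type*} [CommRing R] [IsDomain R]
    [IsIntegrallyClosed R] [CommRing B] [IsDomain B] [Algebra R B] [Module.IsTorsionFree R B]
    [Algebra.IsIntegral R B] [Field K] (φ : R →+* K) (hφ : Function.Surjective φ) (x : B) (z : K)
    (hz : (minpoly R x).eval₂ φ z = 0) :
    ∃ Q : Ideal B, Q.IsMaximal ∧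
      ∀ p : Polynomial R, Polynomial.aeval x p ∈ Q ↔ p.eval₂ φ z = 0 := by
  have h_int : (Polynomial.aeval x : Polynomial R →ₐ[R] B).toRingHom.IsIntegral := by
    refine RingHom.IsIntegral.tower_top Polynomial.C _ ?_
    have : (Polynomial.aeval x : Polynomial R →ₐ[R] B).toRingHom.comp Polynomial.C =
        algebraMap R B := by
      ext; simp
    rw [this]
    exact Algebra.IsIntegral.isIntegral
  have hmax : (RingHom.ker (Polynomial.eval₂RingHom φ z)).IsMaximal := by
    refine RingHom.ker_isMaximal_of_surjective _ fun w ↦ ?_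
    obtain ⟨r, rfl⟩ := hφ w
    exact ⟨Polynomial.C r, by simp⟩
  algebraize [(Polynomial.aeval x : Polynomial R →ₐ[R] B).toRingHom]
  obtain ⟨Q, -, hQp, hQ⟩ := Ideal.exists_ideal_over_prime_of_isIntegral
    (RingHom.ker (Polynomial.eval₂RingHom φ z)) (⊥ : Ideal B) (by
      intro p hp
      have hp : Polynomial.aeval x p = 0 := hp
      obtain ⟨r, rfl⟩ := minpoly.isIntegrallyClosed_dvd (Algebra.IsIntegral.isIntegral x) hp
      simp [RingHom.mem_ker, Polynomial.eval₂_mul, hz])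
  refine ⟨Q, Ideal.isMaximal_of_isIntegral_of_isMaximal_comap (R := Polynomial R) Q
    (hQ ▸ hmax), fun p ↦ ?_⟩
  have := SetLike.ext_iff.1 hQ p
  exact this

theorem Polynomial.Monic.exists_root_norm_lt {q : Polynomial ℂ} (hq : q.Monic) {ε : ℝ}
    (hε : 0 ≤ ε) (h : ‖q.coeff 0‖ < ε ^ q.natDegree) : ∃ z, q.IsRoot z ∧ ‖z‖ < ε := by
  by_contra! hcon
  refine h.not_ge ?_
  have hs : q.Splits := IsAlgClosed.splits q
  rw [hs.coeff_zero_eq_prod_roots_of_monic hq, hs.natDegree_eq_card_roots, norm_mul, norm_pow,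
    norm_neg, norm_one, one_pow, one_mul]
  have hr : ∀ z ∈ q.roots, ε ≤ ‖z‖ := fun z hz ↦ hcon z (Polynomial.isRoot_of_mem_roots hz)
  generalize q.roots = s at hr
  induction s using Multiset.induction_on with
  | empty => simp
  | cons z s ih =>
    rw [Multiset.card_cons, Multiset.prod_cons, norm_mul, pow_succ']
    exact mul_le_mul (hr z (by simp)) (ih fun w hw ↦ hr w (by simp [hw])) (by positivity)
      (norm_nonneg _)

theorem Polynomial.Monic.norm_le_one_add_sum_of_isRoot {q : Polynomial ℂ} (hq : q.Monic) {z : ℂ}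
    (hz : q.IsRoot z) : ‖z‖ ≤ 1 + ∑ j ∈ Finset.range q.natDegree, ‖q.coeff j‖ := by
  have h1 := hz.norm_lt_cauchyBound hq.ne_zero
  have h2 : q.cauchyBound ≤ 1 + ∑ j ∈ Finset.range q.natDegree, ‖q.coeff j‖₊ := by
    rw [Polynomial.cauchyBound, hq.leadingCoeff, nnnorm_one, div_one, add_comm]
    refine add_le_add_right (Finset.sup_le fun j hj ↦ ?_) 1
    exact Finset.single_le_sum (f := fun j ↦ ‖q.coeff j‖₊) (fun _ _ ↦ zero_le) hj
  simpa using NNReal.coe_le_coe.2 (h1.le.trans h2)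

open MvPolynomial in
/-- An irreducible algebraic set which is not a point has no isolated points. Here the set is the
zero locus of the prime ideal `RingHom.ker ψ`. -/
theorem MvPolynomial.exists_mem_ne_forall_eval_eq_zero_of_surjective {n : ℕ} {B : Type*}
    [CommRing B] [IsDomain B] [Algebra ℂ B] (ψ : MvPolynomial (Fin n) ℂ →ₐ[ℂ] B)
    (hψ : Function.Surjective ψ)
    (a : Fin n → ℂ) (hPa : RingHom.ker ψ < vanishingIdeal ℂ {a}) (U : Set (Fin n → ℂ))
    (hU : IsOpen U) (haU : a ∈ U) : ∃ b ∈ U, b ≠ a ∧ ∀ p ∈ RingHom.ker ψ, eval b p = 0 := by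
  have hft : Algebra.FiniteType ℂ B := Algebra.FiniteType.of_surjective ψ hψ
  obtain ⟨s, φ, hφinj, hφint⟩ := exists_integral_inj_algHom_of_fg ℂ B
  algebraize [φ.toRingHom]
  have h_int : Algebra.IsIntegral (MvPolynomial (Fin s) ℂ) B := ⟨hφint⟩
  have htf : Module.IsTorsionFree (MvPolynomial (Fin s) ℂ) B :=
    Module.isTorsionFree_iff_algebraMap_injective.2 hφinj
  have hs : Nonempty (Fin s) := by
    by_contra hs
    rw [not_nonempty_iff] at hs
    have hR : IsField (MvPolynomial (Fin s) ℂ) :=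
      (isEmptyAlgEquiv ℂ (Fin s)).toMulEquiv.isField (Field.toIsField ℂ)
    let _ := (isField_of_isIntegral_of_isField' (S := B) hR).toField
    have hPmax := RingHom.ker_isMaximal_of_surjective (ψ : MvPolynomial (Fin n) ℂ →+* B) hψ
    exact hPa.ne (hPmax.eq_of_le (isMaximal_iff_eq_vanishingIdeal_singleton.2 ⟨a, rfl⟩).ne_top
      hPa.le)
  choose Y hY using fun i ↦ hψ (φ (X i))
  let π : (Fin n → ℂ) → (Fin s → ℂ) := fun x i ↦ eval x (Y i)
  have hπ : Continuous π := continuous_pi fun i ↦ MvPolynomial.continuous_eval (Y i)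
  let V : Set (Fin n → ℂ) := {x | ∀ p ∈ RingHom.ker ψ, eval x p = 0}
  have haV : a ∈ V := fun p hp ↦ by simpa [aeval_eq_eval] using hPa.le hp
  let q (g : MvPolynomial (Fin n) ℂ) : Polynomial (MvPolynomial (Fin s) ℂ) :=
    minpoly (MvPolynomial (Fin s) ℂ) (ψ g)
  have hqm (g) : (q g).Monic := minpoly.monic (h_int.isIntegral _)
  have hroot (x) (hx : x ∈ V) (g) : ((q g).map (eval (π x))).IsRoot (eval x g) := by
    let e : B →+* ℂ := RingHom.liftOfSurjective (ψ : MvPolynomial (Fin n) ℂ →+* B) hψ ⟨eval x, hx⟩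
    have heψ (p) : e (ψ p) = eval x p :=
      RingHom.liftOfRightInverse_comp_apply _ _ _ ⟨eval x, hx⟩ p
    have he : e.comp (algebraMap (MvPolynomial (Fin s) ℂ) _) = eval (π x) := by
      refine MvPolynomial.ringHom_ext (fun z ↦ ?_) fun i ↦ ?_
      · change e (φ (C z)) = _
        rw [← algebraMap_eq, AlgHom.commutes, ← ψ.commutes, heψ, algebraMap_eq, algebraMap_eq,
          eval_C, eval_C]
      · change e (φ (X i)) = _
        rw [← hY, heψ, eval_X]
    have h := congrArg e (minpoly.aeval (MvPolynomial (Fin s) ℂ) (ψ g))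
    rw [Polynomial.aeval_def, Polynomial.hom_eval₂, he, map_zero] at h
    rw [Polynomial.IsRoot, Polynomial.eval_map]
    rwa [heψ] at h
  have hlift (y : Fin s → ℂ) (g) (z : ℂ) (hz : ((q g).map (eval y)).IsRoot z) :
      ∃ b ∈ V, π b = y ∧ eval b g = z := by
    rw [Polynomial.IsRoot, Polynomial.eval_map] at hz
    obtain ⟨Q, hQ, hQmem⟩ := minpoly.exists_isMaximal_aeval_mem_iff (eval y)
      (fun w ↦ ⟨C w, by simp⟩) (ψ g) z hz
    have hQc := Ideal.comap_isMaximal_of_surjective ψ hψ (K := Q)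
    obtain ⟨b, hb⟩ := isMaximal_iff_eq_vanishingIdeal_singleton.1 hQc
    have hb' (p) (hp : ψ p ∈ Q) : eval b p = 0 := by
      have : p ∈ Q.comap ψ := hp
      rw [hb] at this
      simpa [aeval_eq_eval] using this
    refine ⟨b, fun p hp ↦ hb' p ?_, ?_, ?_⟩
    · rw [RingHom.mem_ker.1 hp]
      exact Q.zero_mem
    · funext i
      change eval b (Y i) = y i
      have := hb' (Y i - C (y i)) (by
        have := (hQmem (Polynomial.C (X i - C (y i)))).2 (by simp)
        rw [Polynomial.aeval_C] at this
        change φ (X i - C (y i)) ∈ Q at this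
        rw [map_sub, ← algebraMap_eq, AlgHom.commutes, ← hY, ← ψ.commutes, ← map_sub] at this
        exact this)
      simpa [sub_eq_zero] using this
    · have := hb' (g - C z) (by
        have := (hQmem (Polynomial.X - Polynomial.C (C z))).2 (by simp)
        rw [map_sub, Polynomial.aeval_X, Polynomial.aeval_C] at this
        change _ - φ (C z) ∈ Q at this
        rw [← algebraMap_eq, AlgHom.commutes, ← ψ.commutes, ← map_sub] at this
        exact this)
      simpa [sub_eq_zero] using this
  have hfiber : {x ∈ V | π x = π a}.Finite := by
    refine (Set.Finite.pi' fun i ↦ Polynomial.finite_setOfPred_isRoot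
      ((hqm (X i)).map (eval (π a))).ne_zero).subset ?_
    rintro x ⟨hx, hxa⟩ i
    have := hroot x hx (X i)
    rwa [hxa, eval_X] at this
  obtain ⟨g', hg'a, hg'⟩ := exists_eval_eq_one_and_forall_eval_eq_zero hfiber.toFinset a
  obtain ⟨g, hga, hg⟩ : ∃ g : MvPolynomial (Fin n) ℂ, eval a g = 0 ∧
      ∀ x ∈ V, π x = π a → eval x g = 0 → x = a := by
    refine ⟨1 - g', by simp [hg'a], fun x hx hxa h0 ↦ ?_⟩
    by_contra hne
    simp [hg' x (by simp [hx, hxa]) hne] at h0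
  have hVc : IsClosed V := by
    have : V = ⋂ p ∈ RingHom.ker ψ, {x | eval x p = 0} := by ext; simp [V]
    rw [this]
    exact isClosed_biInter fun p _ ↦ isClosed_eq (MvPolynomial.continuous_eval p) continuous_const
  have hK : IsCompact {x ∈ V | π x ∈ Metric.closedBall (π a) 1} := by
    refine Metric.isCompact_of_isClosed_isBounded
      (hVc.inter (Metric.isClosed_closedBall.preimage hπ)) ?_
    have hM (i : Fin n) : ∃ M : ℝ, ∀ y ∈ Metric.closedBall (π a) 1,
        1 + ∑ j ∈ Finset.range (q (X i)).natDegree, ‖eval y ((q (X i)).coeff j)‖ ≤ M := by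
      obtain ⟨M, hM⟩ := (isCompact_closedBall (π a) 1).bddAbove_image
        (f := fun y ↦ 1 + ∑ j ∈ Finset.range (q (X i)).natDegree, ‖eval y ((q (X i)).coeff j)‖)
        (Continuous.continuousOn (continuous_const.add (continuous_finsetSum _ fun j _ ↦
          (MvPolynomial.continuous_eval _).norm)))
      exact ⟨M, fun y hy ↦ hM ⟨y, hy, rfl⟩⟩
    choose M hM using hM
    refine (Bornology.IsBounded.pi fun i ↦
      Metric.isBounded_closedBall (x := (0 : ℂ)) (r := M i)).subset ?_
    rintro x ⟨hxV, hx⟩ i -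
    have := ((hqm (X i)).map (eval (π x))).norm_le_one_add_sum_of_isRoot (hroot x hxV (X i))
    rw [(hqm (X i)).natDegree_map] at this
    simp only [Polynomial.coeff_map, eval_X] at this
    simpa using this.trans (hM i _ hx)
  obtain ⟨δ, hδ, hδK⟩ := (hK.diff hU).exists_forall_le' (a := (0 : ℝ))
    (f := fun x ↦ dist (π x) (π a) + ‖eval x g‖)
    ((hπ.dist continuous_const).add (MvPolynomial.continuous_eval g).norm).continuousOn (by
      rintro x ⟨⟨hxV, -⟩, hxU⟩
      refine lt_of_le_of_ne (by positivity) fun h ↦ hxU ?_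
      obtain ⟨h1, h2⟩ := (add_eq_zero_iff_of_nonneg dist_nonneg (norm_nonneg _)).1 h.symm
      rwa [hg x hxV (dist_eq_zero.1 h1) (norm_eq_zero.1 h2)])
  have h0 : eval (π a) ((q g).coeff 0) = 0 := by
    have := hroot a haV g
    rwa [hga, Polynomial.IsRoot, ← Polynomial.coeff_zero_eq_eval_zero,
      Polynomial.coeff_map] at this
  have hev : ∀ᶠ y in nhds (π a), ‖eval y ((q g).coeff 0)‖ < (δ / 2) ^ (q g).natDegree := by
    refine (MvPolynomial.continuous_eval ((q g).coeff 0)).norm.continuousAt.eventually_lt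
      continuousAt_const ?_
    rw [h0, norm_zero]
    positivity
  have hball : ∀ᶠ y in nhds (π a), y ∈ Metric.ball (π a) (min 1 (δ / 2)) :=
    Metric.ball_mem_nhds _ (by positivity)
  have : (nhdsWithin (π a) {π a}ᶜ).NeBot := Module.punctured_nhds_neBot ℂ _ _
  have hne : ∀ᶠ y in nhdsWithin (π a) {π a}ᶜ, y ≠ π a := self_mem_nhdsWithin
  obtain ⟨y, ⟨hy1, hy2⟩, hya⟩ :=
    (((hev.and hball).filter_mono nhdsWithin_le_nhds).and hne).exists
  obtain ⟨z, hz, hzδ⟩ := ((hqm g).map (eval y)).exists_root_norm_lt (ε := δ / 2) (by positivity)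
    (by rwa [(hqm g).natDegree_map, Polynomial.coeff_map])
  obtain ⟨b, hbV, hby, hbz⟩ := hlift y g z hz
  rw [Metric.mem_ball, lt_min_iff] at hy2
  refine ⟨b, ?_, fun h ↦ hya (by rw [← hby, h]), hbV⟩
  by_contra hbU
  have := hδK b ⟨⟨hbV, by rw [hby]; exact hy2.1.le⟩, hbU⟩
  rw [hby, hbz] at this
  linarith [hy2.2]

open MvPolynomial in
/-- A finite set of isolated common zeros of polynomials of degree at most `d` in `n` variables
has at most `d ^ n` elements. -/
theorem MvPolynomial.card_le_pow_of_isolated {n m d : ℕ} (p : Fin m → MvPolynomial (Fin n) ℂ)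
    (hdeg : ∀ i, (p i).totalDegree ≤ d) (S : Finset (Fin n → ℂ))
    (hS : ∀ a ∈ S, ∀ i, eval a (p i) = 0)
    (hiso : ∀ a ∈ S, ∃ U : Set (Fin n → ℂ), IsOpen U ∧ a ∈ U ∧
      ∀ b ∈ U, (∀ i, eval b (p i) = 0) → b = a) : S.card ≤ d ^ n := by
  let W : Submodule ℂ (MvPolynomial (Fin n) ℂ) := Submodule.span ℂ (Set.range p)
  obtain ⟨f, hfW, hf⟩ := W.exists_forall_minimalPrimes_le_or_le_height n
  have hWd : W ≤ restrictTotalDegree (Fin n) ℂ d := by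
    refine Submodule.span_le.2 ?_
    rintro _ ⟨i, rfl⟩
    exact (mem_restrictTotalDegree _ _ _).2 (hdeg i)
  have hW0 (a) (ha : a ∈ S) : W ≤ (vanishingIdeal ℂ {a}).restrictScalars ℂ := by
    refine Submodule.span_le.2 ?_
    rintro _ ⟨i, rfl⟩
    simpa [aeval_eq_eval] using hS a ha i
  refine BezoutDeformation.card_le_pow d f
    (fun i ↦ (mem_restrictTotalDegree _ _ _).1 (hWd (hfW i))) S
    (fun a ha i ↦ by simpa [aeval_eq_eval] using hW0 a ha (hfW i)) fun a ha P hP hfP hPa ↦ ?_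
  by_contra hne
  have hlt := lt_of_le_of_ne hPa hne
  have hmax : (vanishingIdeal ℂ {a}).IsMaximal :=
    isMaximal_iff_eq_vanishingIdeal_singleton.2 ⟨a, rfl⟩
  have hPh : P.height < n := by
    have := hmax.isPrime
    rw [← height_of_isMaximal n _ hmax]
    exact Ideal.height_strict_mono_of_isPrime_of_isPrime hlt
  obtain ⟨Q, hQ, hQP⟩ := Ideal.exists_minimalPrimes_le (I := Ideal.span (Set.range f)) (J := P)
    (Ideal.span_le.2 (by rintro _ ⟨i, rfl⟩; exact hfP i))
  have hWQ := (hf Q hQ).resolve_right (((Ideal.height_mono hQP).trans_lt hPh).not_ge)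
  obtain ⟨U, hU, haU, hUa⟩ := hiso a ha
  have hker : RingHom.ker (Ideal.Quotient.mkₐ ℂ P) = P := Ideal.Quotient.mkₐ_ker ℂ P
  obtain ⟨b, hbU, hba, hb⟩ := exists_mem_ne_forall_eval_eq_zero_of_surjective
    (Ideal.Quotient.mkₐ ℂ P) (Ideal.Quotient.mkₐ_surjective ℂ P) a (by rwa [hker]) U hU haU
  refine hba (hUa b hbU fun i ↦ hb _ ?_)
  rw [hker]
  exact hQP (hWQ (Submodule.subset_span ⟨i, rfl⟩))

/-- **Affine Bézout inequality for overdetermined systems.**  The set of isolated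
points of the common zero set of `m` polynomials of degree at most `d` in `n`
variables is finite of cardinality at most `d^n`. -/
theorem stmt_6 (n m d : ℕ) (p : Fin m → MvPolynomial (Fin n) ℂ)
    (hdeg : ∀ i, (p i).totalDegree ≤ d)
    (V : Set (Fin n → ℂ)) (hV : V = {x | ∀ i, MvPolynomial.eval x (p i) = 0})
    (V₀ : Set (Fin n → ℂ))
    (hV₀ : V₀ = {x ∈ V | ∃ U : Set (Fin n → ℂ), IsOpen U ∧ U ∩ V = {x}}) :
    V₀.Finite ∧ V₀.ncard ≤ d ^ n := by
  have key (S : Finset (Fin n → ℂ)) (hS : (S : Set (Fin n → ℂ)) ⊆ V₀) : S.card ≤ d ^ n := by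
    subst hV hV₀
    refine MvPolynomial.card_le_pow_of_isolated p hdeg S (fun a ha ↦ (hS ha).1) fun a ha ↦ ?_
    obtain ⟨-, U, hU, hUV⟩ := hS ha
    exact ⟨U, hU, (hUV ▸ Set.mem_singleton a : a ∈ U ∩ _).1, fun b hbU hb ↦
      (hUV ▸ ⟨hbU, hb⟩ : b ∈ ({a} : Set (Fin n → ℂ)))⟩
  have hfin : V₀.Finite := by
    by_contra hinf
    obtain ⟨S, hS, hcard⟩ := Set.Infinite.exists_subset_card_eq hinf (d ^ n + 1)
    have := key S hS
    omega
  refine ⟨hfin, ?_⟩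
  rw [Set.ncard_eq_toFinset_card _ hfin]
  exact key _ (by simp)
end
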